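/- arXiv:2201.01438 — 14 statements merged into one kernel-verified Lean document; each statement's English description precedes it below -/
import Mathlib

section
/- Let n ≥ 3 be an integer and let c > 0 be a real number. Define A := {λ ∈ ℝⁿ : λ_j > 0 for every j, and λ_j·λ_k > c for every pair of distinct indices j ≠ k} and B := {λ ∈ ℝⁿ : λ_j·λ_k > c for every pair of distinct indices j ≠ k}. Then A is convex, and A is a connected component of B (with respect to the standard topology on ℝⁿ). -/
/-- For `n ≥ 3` and `c > 0`, the set
`A = {λ : 0 < λ_j for all j, and λ_j λ_k > c for all j ≠ k}` is convex and is a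
connected component of `B = {λ : λ_j λ_k > c for all j ≠ k}`. -/
theorem stmt_0 (n : ℕ) (hn : 3 ≤ n) (c : ℝ) (hc : 0 < c)
    (A B : Set (Fin n → ℝ))
    (hA : A = {l | (∀ j, 0 < l j) ∧ ∀ j k, j ≠ k → c < l j * l k})
    (hB : B = {l | ∀ j k, j ≠ k → c < l j * l k}) :
    Convex ℝ A ∧ A.Nonempty ∧ ∀ x ∈ A, connectedComponentIn B x = A := by
  have hAB : A ⊆ B := by
    subst hA hB
    exact fun l hl => hl.2
  have hconv : Convex ℝ A := by
    subst hA
    intro x hx y hy a b ha hb hab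
    have key : ∀ j k, j ≠ k → 2 * c < x j * y k + x k * y j := by
      intro j k hjk
      have h1 := hx.2 j k hjk
      have h2 := hy.2 j k hjk
      have p1 := mul_pos (hx.1 j) (hy.1 k)
      have p2 := mul_pos (hx.1 k) (hy.1 j)
      have h3 : c * c < (x j * x k) * (y j * y k) := by
        apply mul_lt_mul'' h1 h2 hc.le hc.le
      apply lt_of_pow_lt_pow_left₀ 2 (by positivity)
      nlinarith [sq_nonneg (x j * y k - x k * y j)]
    refine ⟨fun j => ?_, fun j k hjk => ?_⟩
    · have := hx.1 j
      have := hy.1 j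
      simp only [Pi.add_apply, Pi.smul_apply, smul_eq_mul]
      rcases ha.eq_or_lt with h | h
      · have : b = 1 := by linarith
        subst this
        subst h
        simpa using hy.1 j
      · positivity
    · have h1 := hx.2 j k hjk
      have h2 := hy.2 j k hjk
      have h3 := key j k hjk
      simp only [Pi.add_apply, Pi.smul_apply, smul_eq_mul]
      have e : (a * x j + b * y j) * (a * x k + b * y k) - c
          = a ^ 2 * (x j * x k - c) + b ^ 2 * (y j * y k - c)
            + a * b * (x j * y k + x k * y j - 2 * c) := by
        have : b = 1 - a := by linarith
        subst this
        ring
      have q3 : 0 ≤ a * b * (x j * y k + x k * y j - 2 * c) :=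
        mul_nonneg (mul_nonneg ha hb) (by linarith)
      have q2 : 0 ≤ b ^ 2 * (y j * y k - c) := mul_nonneg (sq_nonneg b) (by linarith)
      have q1 : 0 ≤ a ^ 2 * (x j * x k - c) := mul_nonneg (sq_nonneg a) (by linarith)
      rcases ha.eq_or_lt with h | h
      · have : b = 1 := by linarith
        subst this
        subst h
        simpa using h2
      · have : 0 < a ^ 2 * (x j * x k - c) := mul_pos (by positivity) (by linarith)
        linarith
  refine ⟨hconv, ⟨fun _ => c + 1, ?_⟩, fun x hx => ?_⟩
  · subst hA
    exact ⟨fun _ => by positivity, fun _ _ _ => by nlinarith⟩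
  · apply Set.Subset.antisymm
    · intro y hy
      have hyB : y ∈ B := connectedComponentIn_subset B x hy
      have hpos : ∀ j, 0 < y j := by
        intro j
        by_contra hneg
        push Not at hneg
        have hx0 : 0 < x j := by
          rw [hA] at hx
          exact hx.1 j
        have hxm : x ∈ connectedComponentIn B x := mem_connectedComponentIn (hAB hx)
        obtain ⟨z, hz, hz0⟩ := isPreconnected_connectedComponentIn.intermediate_value hy hxm
          (continuous_apply j).continuousOn ⟨hneg, hx0.le⟩
        have hzB : z ∈ B := connectedComponentIn_subset B x hz
        have : Nontrivial (Fin n) := Fin.nontrivial_iff_two_le.mpr (by omega)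
        obtain ⟨k, hk⟩ := exists_ne j
        rw [hB] at hzB
        have h := hzB j k hk.symm
        have hz0' : z j = 0 := hz0
        rw [hz0', zero_mul] at h
        linarith
      rw [hB] at hyB
      rw [hA]
      exact ⟨hpos, hyB⟩
    · exact hconv.isPreconnected.subset_connectedComponentIn hx hAB
end

section
/- Let n ≥ 3 be an integer and let c > 0, d ≥ 0 be real numbers with 2·c^{3/2} > d. Define A := {λ ∈ ℝⁿ : λ_j > 0 for every j; λ_j·λ_k > c for every pair of distinct j ≠ k; and λ_j·λ_k·λ_l − c(λ_j+λ_k+λ_l) + d > 0 for every triple of distinct indices j, k, l} and B := {λ ∈ ℝⁿ : λ_j·λ_k·λ_l − c(λ_j+λ_k+λ_l) + d > 0 for every triple of distinct indices j, k, l}. Then A is a connected component of B (with respect to the standard topology on ℝⁿ). -/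
/-- For `n ≥ 3`, `c > 0`, `d ≥ 0` with `2 c^{3/2} > d`, the set
`A = Υⁿ_{3;1,0,−c,d} ∩ Υⁿ_{2;1,0,−c} ∩ Υⁿ_{1;1,0}` is a connected component of
`B = Υⁿ_{3;1,0,−c,d}`. -/
theorem stmt_1 (n : ℕ) (hn : 3 ≤ n) (c d : ℝ) (hc : 0 < c) (hd : 0 ≤ d)
    (hcd : d < 2 * c ^ ((3 : ℝ) / 2))
    (A B : Set (Fin n → ℝ))
    (hA : A = {l | (∀ j, 0 < l j) ∧ (∀ j k, j ≠ k → c < l j * l k) ∧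
        ∀ j k m, j ≠ k → j ≠ m → k ≠ m →
          0 < l j * l k * l m - c * (l j + l k + l m) + d})
    (hB : B = {l | ∀ j k m, j ≠ k → j ≠ m → k ≠ m →
          0 < l j * l k * l m - c * (l j + l k + l m) + d}) :
    A.Nonempty ∧ ∀ x ∈ A, connectedComponentIn B x = A := by
  obtain ⟨s, hs, rfl⟩ : ∃ s : ℝ, 0 < s ∧ c = s ^ 2 :=
    ⟨Real.sqrt c, Real.sqrt_pos.2 hc, (Real.sq_sqrt hc.le).symm⟩
  have hpow : (s ^ 2) ^ ((3 : ℝ) / 2) = s ^ 3 := by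
    rw [← Real.rpow_natCast s 2, ← Real.rpow_mul hs.le, ← Real.rpow_natCast s 3]
    norm_num
  rw [hpow] at hcd
  have hup : ∀ u ∈ A, ∀ v, u ≤ v → v ∈ A := by
    intro u hu v huv
    rw [hA] at hu ⊢
    obtain ⟨h1, h2, h3⟩ := hu
    have k1 : ∀ j, 0 < v j := fun j => (h1 j).trans_le (huv j)
    refine ⟨k1, fun j k hjk => (h2 j k hjk).trans_le
      (mul_le_mul (huv j) (huv k) (h1 k).le (k1 j).le), ?_⟩
    intro j k m hjk hjm hkm
    have h := h3 j k m hjk hjm hkm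
    have a1 := h2 k m hkm
    have a2 : s ^ 2 < v j * u m :=
      (h2 j m hjm).trans_le (mul_le_mul_of_nonneg_right (huv j) (h1 m).le)
    have a3 : s ^ 2 < v j * v k := (h2 j k hjk).trans_le
      (mul_le_mul (huv j) (huv k) (h1 k).le (k1 j).le)
    have b1 := mul_nonneg (sub_nonneg.2 (huv j)) (sub_nonneg.2 a1.le)
    have b2 := mul_nonneg (sub_nonneg.2 (huv k)) (sub_nonneg.2 a2.le)
    have b3 := mul_nonneg (sub_nonneg.2 (huv m)) (sub_nonneg.2 a3.le)
    linarith
  have hAB : A ⊆ B := by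
    rw [hA, hB]
    exact fun l hl => hl.2.2
  have hconn : IsPreconnected A := by
    apply isPreconnected_of_forall_pair
    intro x hx y hy
    refine ⟨Set.Ici x ∪ Set.Ici y, ?_, Or.inl Set.self_mem_Ici, Or.inr Set.self_mem_Ici, ?_⟩
    · rintro v (hv | hv)
      · exact hup x hx v hv
      · exact hup y hy v hv
    · exact IsPreconnected.union (x ⊔ y) (Set.mem_Ici.2 le_sup_left) (Set.mem_Ici.2 le_sup_right)
        (convex_Ici x).isPreconnected (convex_Ici y).isPreconnected
  have hopen : IsOpen A := by
    rw [hA]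
    simp only [Set.ofPred_and, Set.ofPred_forall]
    refine IsOpen.inter ?_ (IsOpen.inter ?_ ?_)
    · exact isOpen_iInter_of_finite fun j => isOpen_lt (by fun_prop) (by fun_prop)
    · exact isOpen_iInter_of_finite fun j => isOpen_iInter_of_finite fun k =>
        isOpen_iInter_of_finite fun _ => isOpen_lt (by fun_prop) (by fun_prop)
    · exact isOpen_iInter_of_finite fun j => isOpen_iInter_of_finite fun k =>
        isOpen_iInter_of_finite fun m => isOpen_iInter_of_finite fun _ =>
        isOpen_iInter_of_finite fun _ => isOpen_iInter_of_finite fun _ =>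
        isOpen_lt (by fun_prop) (by fun_prop)
  have hex : ∀ j k : Fin n, ∃ m, j ≠ m ∧ k ≠ m := by
    intro j k
    obtain ⟨m, hm⟩ : ∃ m, m ∉ ({j, k} : Finset (Fin n)) := by
      by_contra! hall
      have h1 : ({j, k} : Finset (Fin n)) = Finset.univ := Finset.eq_univ_of_forall hall
      have h2 := Finset.card_le_two (a := j) (b := k)
      rw [h1, Finset.card_univ, Fintype.card_fin] at h2
      omega
    simp only [Finset.mem_insert, Finset.mem_singleton, not_or] at hm
    exact ⟨m, Ne.symm hm.1, Ne.symm hm.2⟩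
  have hclos : closure A ∩ B ⊆ A := by
    rintro l ⟨hl, hlB⟩
    have g1 : ∀ j, 0 ≤ l j := by
      intro j
      have hcl : IsClosed {l : Fin n → ℝ | 0 ≤ l j} :=
        isClosed_le (by fun_prop) (by fun_prop)
      refine closure_minimal ?_ hcl hl
      intro u hu
      rw [hA] at hu
      exact (hu.1 j).le
    have g2 : ∀ j k, j ≠ k → s ^ 2 ≤ l j * l k := by
      intro j k hjk
      have hcl : IsClosed {l : Fin n → ℝ | s ^ 2 ≤ l j * l k} :=
        isClosed_le (by fun_prop) (by fun_prop)
      refine closure_minimal ?_ hcl hl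
      intro u hu
      rw [hA] at hu
      exact (hu.2.1 j k hjk).le
    rw [hB] at hlB
    rw [hA]
    refine ⟨fun j => ?_, fun j k hjk => ?_, hlB⟩
    · obtain ⟨m, hm, -⟩ := hex j j
      refine lt_of_le_of_ne (g1 j) fun h0 => ?_
      have := g2 j m hm
      rw [← h0, zero_mul] at this
      linarith
    · refine lt_of_le_of_ne (g2 j k hjk) fun h0 => ?_
      obtain ⟨m, hjm, hkm⟩ := hex j k
      have h := hlB j k m hjk hjm hkm
      rw [← h0] at h
      have hsum : 2 * s ≤ l j + l k := by
        exact (abs_le_of_sq_le_sq' (by nlinarith [sq_nonneg (l j - l k)]) (add_nonneg (g1 j) (g1 k))).2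
      have := mul_le_mul_of_nonneg_left hsum hc.le
      nlinarith
  refine ⟨⟨fun _ => 2 * s, ?_⟩, fun x hx => ?_⟩
  · rw [hA]
    have h3 : 0 < s ^ 3 := by positivity
    refine ⟨fun _ => by positivity, fun _ _ _ => by nlinarith, fun _ _ _ _ _ _ => by nlinarith⟩
  · apply Set.Subset.antisymm
    · have hxB := hAB hx
      refine isPreconnected_connectedComponentIn.subset_of_closure_inter_subset hopen
        ⟨x, mem_connectedComponentIn hxB, hx⟩ ?_
      exact fun l hl => hclos ⟨hl.1, connectedComponentIn_subset B x hl.2⟩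
    · exact hconn.subset_connectedComponentIn hx hAB
end

section
/- Let n ≥ 3 be an integer and let c > 0, d ≥ 0 be real numbers with 2·c^{3/2} > d. Set θ_{c,d} := (1/3)·arccos(−d/(2c^{3/2})), where arccos is the standard arccosine with values in [0, π]. Let e ∈ ℝ satisfy e > −24·c²·cos²(θ_{c,d})·cos(2θ_{c,d}). If λ ∈ ℝⁿ satisfies λ_j > 0 for every j, λ_j·λ_k > c for every pair of distinct j ≠ k, and λ_j·λ_k·λ_l − c(λ_j+λ_k+λ_l) + d > 0 for every triple of distinct indices j, k, l, then c(λ_jλ_k + λ_jλ_l + λ_kλ_l) − d(λ_j+λ_k+λ_l) + e > 0 for every triple of distinct indices j, k, l. -/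
lemma core_case (x t s m d : ℝ) (hx : 1 < x) (hx3 : x ^ 2 ≤ 3) (hd : d = 3 * x - x ^ 3)
    (ht : 1 < t) (hm : m = t ^ 2 - 1) (hs : 2 * t ≤ s) :
    0 ≤ m * (m + 1 - d * s - (3 * x ^ 4 - 6 * x ^ 2)) + (s - d) ^ 2 := by
  have hmpos : 0 < m := by rw [hm]; nlinarith
  have hd0 : 0 ≤ d := by rw [hd]; nlinarith
  rcases le_or_gt (d * (m + 2)) (4 * t) with h | h
  · have h1 : 0 ≤ (s - 2 * t) * (s + 2 * t - 2 * d - d * m) :=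
      mul_nonneg (by linarith) (by nlinarith)
    have h2 : 0 ≤ (t - x) ^ 2 * ((t + x * (x ^ 2 - 2)) ^ 2 + (x ^ 2 - 1) ^ 2 * (3 - x ^ 2)) := by
      have : 0 ≤ 3 - x ^ 2 := by linarith
      positivity
    have h3 : m * (m + 1 - d * s - (3 * x ^ 4 - 6 * x ^ 2)) + (s - d) ^ 2
        = (s - 2 * t) * (s + 2 * t - 2 * d - d * m)
        + (t - x) ^ 2 * ((t + x * (x ^ 2 - 2)) ^ 2 + (x ^ 2 - 1) ^ 2 * (3 - x ^ 2)) := by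
      subst hm hd; ring
    rw [h3]; linarith
  · have hsq : 16 * (m + 1) < d ^ 2 * (m + 2) ^ 2 := by
      have : (4 * t) ^ 2 < (d * (m + 2)) ^ 2 := by
        apply pow_lt_pow_left₀ h (by linarith) (by norm_num)
      rw [hm] at this ⊢; nlinarith
    obtain ⟨y, hy⟩ : ∃ y, y = x ^ 2 := ⟨_, rfl⟩
    have hy1 : 1 < y := by rw [hy]; nlinarith
    have hy3 : y ≤ 3 := by rw [hy]; exact hx3
    have hd2 : d ^ 2 = y * (3 - y) ^ 2 := by rw [hd, hy]; ring
    have hmy : 4 * (y - 1) ≤ m * (4 - y) := by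
      by_contra hcon
      push Not at hcon
      rw [hd2] at hsq
      have e1 : (y - 1) ^ 2 * (4 - y) * (4 * (m + 1)) < y * (3 - y) ^ 2 * m ^ 2 := by
        linarith
      -- multiply by `4 - y`
      have e2 : (y - 1) ^ 2 * (4 - y) ^ 2 * (4 * (m + 1))
          < y * (3 - y) ^ 2 * m * (m * (4 - y)) := by
        have := mul_lt_mul_of_pos_right e1 (show 0 < 4 - y by linarith)
        linarith
      have e3 : y * (3 - y) ^ 2 * m * (m * (4 - y)) ≤ y * (3 - y) ^ 2 * m * (4 * (y - 1)) :=
        mul_le_mul_of_nonneg_left hcon.le (by positivity)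
      have e4 : (y - 1) * ((y - 1) * (4 - y) ^ 2 * (m + 1))
          < (y - 1) * (y * (3 - y) ^ 2 * m) := by linarith
      have e5 := lt_of_mul_lt_mul_left e4 (by linarith)
      have e6 : (y - 1) * (4 - y) ^ 2 < m * (y * (3 - y) ^ 2 - (y - 1) * (4 - y) ^ 2) := by
        linarith
      have e7 : y * (3 - y) ^ 2 - (y - 1) * (4 - y) ^ 2 = 3 * y ^ 2 - 15 * y + 16 := by ring
      rw [e7] at e6
      have hkpos : 0 < 3 * y ^ 2 - 15 * y + 16 := by
        by_contra hk
        push Not at hk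
        have : 0 ≤ (y - 1) * (4 - y) ^ 2 := mul_nonneg (by linarith) (by positivity)
        have := mul_nonpos_of_nonneg_of_nonpos hmpos.le hk
        linarith
      have e8 := mul_lt_mul_of_pos_right e6 (show 0 < 4 - y by linarith)
      have e9 := mul_lt_mul_of_pos_right hcon hkpos
      have e10 : (y - 1) * (4 - y) ^ 3 < (y - 1) * (4 * (3 * y ^ 2 - 15 * y + 16)) := by
        linarith
      have e11 := lt_of_mul_lt_mul_left e10 (by linarith)
      have e12 : (4 - y) ^ 3 - 4 * (3 * y ^ 2 - 15 * y + 16) = y * (12 - y ^ 2) := by ring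
      linarith [mul_pos (show 0 < y by linarith) (show 0 < 12 - y ^ 2 by nlinarith)]
    have h3 : m * (m + 1 - d * s - (3 * x ^ 4 - 6 * x ^ 2)) + (s - d) ^ 2
        = (s - d - d * m / 2) ^ 2 + m * ((y - 1) ^ 2 / 4 * (m * (4 - y) - 4 * (y - 1))) := by
      subst hd hy; ring
    rw [h3]
    have : 0 ≤ m * (4 - y) - 4 * (y - 1) := by linarith
    positivity

lemma core (x a b g d : ℝ) (hx : 1 < x) (hd : d = 3 * x - x ^ 3) (hd0 : 0 ≤ d)
    (ha : 0 < a) (hb : 0 < b) (hab : 1 < a * b)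
    (h : 0 < a * b * g - (a + b + g) + d) :
    3 * x ^ 4 - 6 * x ^ 2 ≤ (a * b + a * g + b * g) - d * (a + b + g) := by
  have hx3 : x ^ 2 ≤ 3 := by
    by_contra hc
    push Not at hc
    nlinarith
  have hd2 : d < 2 := by
    have : 0 < (x - 1) ^ 2 * (x + 2) := by
      have : 0 < x - 1 := by linarith
      positivity
    nlinarith
  have ht2 : Real.sqrt (a * b) ^ 2 = a * b := Real.sq_sqrt (by positivity)
  have ht : 1 < Real.sqrt (a * b) := by
    rw [Real.lt_sqrt (by norm_num)]; linarith
  have hs : 2 * Real.sqrt (a * b) ≤ a + b := by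
    apply le_of_sq_le_sq _ (by positivity)
    nlinarith [sq_nonneg (a - b)]
  have key := core_case x (Real.sqrt (a * b)) (a + b) (a * b - 1) d hx hx3 hd ht
    (by rw [ht2]) hs
  have h1 : 0 ≤ (a + b - d) * (g * (a * b - 1) - (a + b - d)) :=
    mul_nonneg (by linarith) (by linarith)
  have hm : 0 < a * b - 1 := by linarith
  have h2 : 0 ≤ (a * b - 1) *
      ((a * b + a * g + b * g) - d * (a + b + g) - (3 * x ^ 4 - 6 * x ^ 2)) := by
    nlinarith
  have := nonneg_of_mul_nonneg_right h2 hm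
  linarith


/-- For `n ≥ 3`, `c > 0`, `d ≥ 0` with `2 c^{3/2} > d`, and
`e > −24 c² cos²(θ_{c,d}) cos(2 θ_{c,d})` where `θ_{c,d} = (1/3) arccos(−d/(2 c^{3/2}))`:
`Υⁿ_{3;1,0,−c,d} ∩ Υⁿ_{2;1,0,−c} ∩ Υⁿ_{1;1,0} ⊆ Υⁿ_{3;0,c,−d,e} ∩ Υⁿ_{2;1,0,−c} ∩ Υⁿ_{1;1,0}`. -/
theorem stmt_4 (n : ℕ) (hn : 3 ≤ n) (c d e θ : ℝ) (hc : 0 < c) (hd : 0 ≤ d)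
    (hcd : d < 2 * c ^ ((3 : ℝ) / 2))
    (hθ : θ = (1 / 3) * Real.arccos (-d / (2 * c ^ ((3 : ℝ) / 2))))
    (he : -24 * c ^ 2 * Real.cos θ ^ 2 * Real.cos (2 * θ) < e)
    (l : Fin n → ℝ)
    (hpos : ∀ j, 0 < l j) (hpair : ∀ j k, j ≠ k → c < l j * l k)
    (htriple : ∀ j k m, j ≠ k → j ≠ m → k ≠ m →
      0 < l j * l k * l m - c * (l j + l k + l m) + d) :
    ∀ j k m, j ≠ k → j ≠ m → k ≠ m →
      0 < c * (l j * l k + l j * l m + l k * l m) - d * (l j + l k + l m) + e := by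
  intro j k m hjk hjm hkm
  obtain ⟨r, hr⟩ : ∃ r, r = Real.sqrt c := ⟨_, rfl⟩
  have hr0 : 0 < r := by rw [hr]; exact Real.sqrt_pos.2 hc
  have hcr : c = r ^ 2 := by rw [hr, Real.sq_sqrt hc.le]
  have hc3 : c ^ ((3 : ℝ) / 2) = r ^ 3 := by
    rw [hr, Real.sqrt_eq_rpow, ← Real.rpow_natCast, ← Real.rpow_mul hc.le]
    norm_num
  rw [hc3] at hcd hθ
  have hr3 : 0 < r ^ 3 := by positivity
  have hlt : -1 < -d / (2 * r ^ 3) := by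
    rw [lt_div_iff₀ (by positivity)]; linarith
  have hle : -d / (2 * r ^ 3) ≤ 1 := by
    rw [div_le_one (by positivity)]; linarith
  have hcos3 : Real.cos (3 * θ) = -d / (2 * r ^ 3) := by
    rw [hθ, show 3 * (1 / 3 * Real.arccos (-d / (2 * r ^ 3)))
      = Real.arccos (-d / (2 * r ^ 3)) by ring]
    exact Real.cos_arccos hlt.le hle
  have hθ0 : 0 ≤ θ := by
    rw [hθ]; have := Real.arccos_nonneg (-d / (2 * r ^ 3)); positivity
  have hθ1 : θ < Real.pi / 3 := by
    have h1 : Real.arccos (-d / (2 * r ^ 3)) ≠ Real.pi := by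
      intro h
      rw [Real.arccos_eq_pi] at h
      linarith
    have h2 := lt_of_le_of_ne (Real.arccos_le_pi (-d / (2 * r ^ 3))) h1
    rw [hθ]; linarith
  have hcosθ : 1 / 2 < Real.cos θ := by
    rw [← Real.cos_pi_div_three]
    exact Real.cos_lt_cos_of_nonneg_of_le_pi hθ0 (by linarith [Real.pi_pos]) hθ1
  rw [Real.cos_three_mul] at hcos3
  rw [Real.cos_two_mul] at he
  have hdd : d / r ^ 3 = 3 * (2 * Real.cos θ) - (2 * Real.cos θ) ^ 3 := by
    have : -d / (2 * r ^ 3) = -(d / r ^ 3) / 2 := by field_simp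
    rw [this] at hcos3
    linarith
  obtain ⟨u, hu⟩ : ∃ u, l j = r * u := ⟨l j / r, by field_simp⟩
  obtain ⟨v, hv⟩ : ∃ v, l k = r * v := ⟨l k / r, by field_simp⟩
  obtain ⟨w, hw⟩ : ∃ w, l m = r * w := ⟨l m / r, by field_simp⟩
  obtain ⟨D, hD⟩ : ∃ D, D = d / r ^ 3 := ⟨_, rfl⟩
  have hdD : d = r ^ 3 * D := by rw [hD]; field_simp
  rw [← hD] at hdd
  have hD0 : 0 ≤ D := by rw [hD]; positivity
  have pj := hpos j
  have pk := hpos k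
  have hp := hpair j k hjk
  have ht := htriple j k m hjk hjm hkm
  rw [hu] at pj
  rw [hv] at pk
  rw [hu, hv, hcr] at hp
  rw [hu, hv, hw, hcr, hdD] at ht
  have hu0 : 0 < u := pos_of_mul_pos_right pj hr0.le
  have hv0 : 0 < v := pos_of_mul_pos_right pk hr0.le
  have huv : 1 < u * v := by
    have : r ^ 2 * 1 < r ^ 2 * (u * v) := by linarith
    exact lt_of_mul_lt_mul_left this (by positivity)
  have hT : 0 < u * v * w - (u + v + w) + D := by
    have : 0 < r ^ 3 * (u * v * w - (u + v + w) + D) := by linarith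
    exact pos_of_mul_pos_right this hr3.le
  have key := core (2 * Real.cos θ) u v w D (by linarith) hdd hD0 hu0 hv0 huv hT
  have key2 := mul_le_mul_of_nonneg_left key (show 0 ≤ r ^ 4 by positivity)
  rw [hu, hv, hw, hdD, hcr]
  rw [hcr] at he
  linarith
end

section
/- Let n ≥ 4 be an integer and let c > 0, d ≥ 0 be real numbers with 2·c^{3/2} > d, set θ_{c,d} := (1/3)·arccos(−d/(2c^{3/2})) (standard arccosine with values in [0, π]), and let e ∈ ℝ satisfy e > −24·c²·cos²(θ_{c,d})·cos(2θ_{c,d}). Define A := {λ ∈ ℝⁿ : λ_j > 0 for every j; λ_jλ_k > c for every pair of distinct j ≠ k; λ_jλ_kλ_l − c(λ_j+λ_k+λ_l) + d > 0 for every triple of distinct indices; and λ_jλ_kλ_lλ_m − c·σ_2(λ_j,λ_k,λ_l,λ_m) + d·σ_1(λ_j,λ_k,λ_l,λ_m) − e > 0 for every quadruple of distinct indices j, k, l, m} and B := {λ ∈ ℝⁿ : λ_jλ_kλ_lλ_m − c·σ_2(λ_j,λ_k,λ_l,λ_m) + d·σ_1(λ_j,λ_k,λ_l,λ_m) − e >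 0 for every quadruple of distinct indices j, k, l, m}. Then A is a connected component of B (with respect to the standard topology on ℝⁿ). -/
lemma aux_root (s c u t d : ℝ) (hcs : c = s ^ 2) (hs : 0 < s) (hu : u ^ 2 ≤ 3 * c)
    (hd : d = 3 * c * u - u ^ 3) :
    0 ≤ (6 * c * u ^ 2 - 3 * u ^ 4 + c * t ^ 2 - 2 * d * t) * (t ^ 2 - c)
      + (2 * c * t - d) ^ 2 := by
  have hc : 0 < c := by rw [hcs]; positivity
  have key : (6 * c * u ^ 2 - 3 * u ^ 4 + c * t ^ 2 - 2 * d * t) * (t ^ 2 - c)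
      + (2 * c * t - d) ^ 2
      = (t - u) ^ 2 * (c * t ^ 2 + (2 * u ^ 3 - 4 * c * u) * t
          + (3 * c ^ 2 - 3 * c * u ^ 2 + u ^ 4)) := by
    rw [hd]; ring
  rw [key]
  apply mul_nonneg (sq_nonneg _)
  have h2 : c * (c * t ^ 2 + (2 * u ^ 3 - 4 * c * u) * t
          + (3 * c ^ 2 - 3 * c * u ^ 2 + u ^ 4))
      = (c * t + (u ^ 3 - 2 * c * u)) ^ 2 + (u ^ 2 - c) ^ 2 * (3 * c - u ^ 2) := by ring
  have h3 : 0 ≤ c * (c * t ^ 2 + (2 * u ^ 3 - 4 * c * u) * t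
          + (3 * c ^ 2 - 3 * c * u ^ 2 + u ^ 4)) := by
    rw [h2]
    have := mul_nonneg (sq_nonneg (u ^ 2 - c)) (sub_nonneg.2 hu)
    positivity
  exact nonneg_of_mul_nonneg_right h3 hc

lemma aux_ord (s c u d a b x : ℝ) (hcs : c = s ^ 2) (hs : 0 < s) (hu : u ^ 2 ≤ 3 * c)
    (hd : d = 3 * c * u - u ^ 3) (hds : d < 2 * s ^ 3)
    (ha : 0 < a) (hb : 0 < b) (hx : 0 < x)
    (hbx : c ≤ b * x) (hba : b ≤ a) (hxa : x ≤ a)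
    (h3 : a * b * x - c * (a + b + x) + d = 0) :
    -c * (a * b + a * x + b * x) + d * (a + b + x) ≤ 6 * c * u ^ 2 - 3 * u ^ 4 := by
  have hc : 0 < c := by rw [hcs]; positivity
  obtain ⟨m, hm⟩ : ∃ m, m = (b + x) / 2 := ⟨_, rfl⟩
  have hm0 : 0 < m := by rw [hm]; positivity
  have hx' : x = 2 * m - b := by rw [hm]; ring
  have hmq : b * x ≤ m ^ 2 := by rw [hm]; nlinarith [sq_nonneg (b - x)]
  have hsm : s ≤ m := by
    refine (sq_le_sq₀ (by positivity) (hm0.le)).1 ?_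
    linarith
  have hma : m ≤ a := by rw [hm]; linarith
  have hN : 0 < 2 * c * m - d := by
    have : c * s ≤ c * m := mul_le_mul_of_nonneg_left hsm hc.le
    have : c * s = s ^ 3 := by rw [hcs]; ring
    linarith
  have hq : a * (b * x - c) = 2 * c * m - d := by rw [hm]; linarith
  have hD : 2 * c * m - d ≤ a * (m ^ 2 - c) := by
    rw [← hq]; exact mul_le_mul_of_nonneg_left (by linarith) ha.le
  have hD0 : 0 < m ^ 2 - c := by
    by_contra hcon
    have := mul_nonneg ha.le (sub_nonneg.2 (not_lt.1 hcon))
    nlinarith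
  have hNm : c * (m ^ 2 - c) ≤ m * (2 * c * m - d) := by
    have : d * m ≤ 2 * s ^ 3 * m := mul_le_mul_of_nonneg_right hds.le hm0.le
    rw [hcs] at *
    nlinarith [sq_nonneg (s * (m - s))]
  have hNa : c * (m ^ 2 - c) ≤ a * (2 * c * m - d) :=
    hNm.trans (mul_le_mul_of_nonneg_right hma hN.le)
  have hP := aux_root s c u m d hcs hs hu hd
  obtain ⟨N, hNdef⟩ : ∃ N, N = 2 * c * m - d := ⟨_, rfl⟩
  obtain ⟨D, hDdef⟩ : ∃ D, D = m ^ 2 - c := ⟨_, rfl⟩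
  obtain ⟨M, hMdef⟩ : ∃ M, M = 6 * c * u ^ 2 - 3 * u ^ 4 := ⟨_, rfl⟩
  rw [← hMdef] at hP ⊢
  rw [← hNdef] at hN hq hD hNm hNa hP
  rw [← hDdef] at hD hD0 hNm hNa hP
  -- goal times a * D
  have hprod : 0 ≤ (a * D - N) * (a * N - c * D) :=
    mul_nonneg (by linarith) (by linarith)
  have hg : a * (-c * (a * b + a * x + b * x) + d * (a + b + x))
      = -N * (a ^ 2 + c) + a * (2 * d * m - c ^ 2) := by
    have e1 : a * (b * x) = N + a * c := by linarith
    have e2 : b + x = 2 * m := by linarith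
    have : a * (-c * (a * b + a * x + b * x) + d * (a + b + x))
      = -c * a ^ 2 * (b + x) - c * (a * (b * x)) + d * a ^ 2 + d * a * (b + x) := by ring
    rw [this, e1, e2, hNdef]; ring
  have hfin : 0 ≤ (a * D) * (M - (-c * (a * b + a * x + b * x) + d * (a + b + x))) := by
    have : (a * D) * (M - (-c * (a * b + a * x + b * x) + d * (a + b + x)))
      = a * D * M - D * (a * (-c * (a * b + a * x + b * x) + d * (a + b + x))) := by ring
    rw [this, hg]
    have haP := mul_nonneg ha.le hP
    have e3 : m ^ 2 = D + c := by linarith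
    rw [e3] at haP
    nlinarith
  have := nonneg_of_mul_nonneg_right hfin (by positivity)
  linarith

lemma aux_all (s c u d a b x : ℝ) (hcs : c = s ^ 2) (hs : 0 < s) (hu : u ^ 2 ≤ 3 * c)
    (hd : d = 3 * c * u - u ^ 3) (hds : d < 2 * s ^ 3)
    (ha : 0 < a) (hb : 0 < b) (hx : 0 < x)
    (hab : c ≤ a * b) (hax : c ≤ a * x) (hbx : c ≤ b * x)
    (h3 : a * b * x - c * (a + b + x) + d = 0) :
    -c * (a * b + a * x + b * x) + d * (a + b + x) ≤ 6 * c * u ^ 2 - 3 * u ^ 4 := by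
  by_cases h1 : b ≤ a ∧ x ≤ a
  · exact aux_ord s c u d a b x hcs hs hu hd hds ha hb hx hbx h1.1 h1.2 h3
  by_cases h2 : a ≤ b ∧ x ≤ b
  · have := aux_ord s c u d b a x hcs hs hu hd hds hb ha hx hax h2.1 h2.2 (by linarith)
    linarith
  have h3' : a ≤ x ∧ b ≤ x := by
    rcases le_total a b with h | h <;> rcases le_total a x with h' | h' <;>
      rcases le_total b x with h'' | h'' <;> grind
  have := aux_ord s c u d x a b hcs hs hu hd hds hx ha hb hab h3'.1 h3'.2 (by linarith)
  linarith

lemma aux_u (s d θ : ℝ) (hs : 0 < s) (hd : 0 ≤ d) (hds : d < 2 * s ^ 3)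
    (hθ : θ = (1 / 3) * Real.arccos (-d / (2 * s ^ 3))) :
    ∃ u, u ^ 2 ≤ 3 * s ^ 2 ∧ d = 3 * s ^ 2 * u - u ^ 3 ∧
      -24 * (s ^ 2) ^ 2 * Real.cos θ ^ 2 * Real.cos (2 * θ) = 6 * s ^ 2 * u ^ 2 - 3 * u ^ 4 := by
  have hs3 : 0 < 2 * s ^ 3 := by positivity
  refine ⟨2 * s * Real.cos θ, ?_, ?_, ?_⟩
  · have h1 : Real.pi / 2 ≤ Real.arccos (-d / (2 * s ^ 3)) := by
      rw [Real.arccos]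
      have : Real.arcsin (-d / (2 * s ^ 3)) ≤ 0 := by
        rw [Real.arcsin_nonpos]
        exact div_nonpos_of_nonpos_of_nonneg (by linarith) hs3.le
      linarith
    have h2 := Real.arccos_le_pi (-d / (2 * s ^ 3))
    have hpi := Real.pi_pos
    have h3 : Real.cos θ ≤ Real.cos (Real.pi / 6) :=
      Real.cos_le_cos_of_nonneg_of_le_pi (by linarith) (by linarith) (by linarith)
    have h4 : 0 ≤ Real.cos θ :=
      Real.cos_nonneg_of_mem_Icc ⟨by linarith, by linarith⟩
    have h5 : Real.cos θ ^ 2 ≤ 3 / 4 := by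
      rw [← Real.sq_cos_pi_div_six]
      exact pow_le_pow_left₀ h4 h3 2
    nlinarith [sq_nonneg s]
  · have h1 : Real.cos (3 * θ) = -d / (2 * s ^ 3) := by
      rw [hθ, show (3 : ℝ) * (1 / 3 * Real.arccos (-d / (2 * s ^ 3)))
        = Real.arccos (-d / (2 * s ^ 3)) by ring]
      apply Real.cos_arccos
      · rw [le_div_iff₀ hs3]; linarith
      · rw [div_le_iff₀ hs3]; linarith
    rw [Real.cos_three_mul, eq_div_iff hs3.ne'] at h1
    linarith
  · rw [Real.cos_two_mul]; ring

lemma up3 {c d a b x a' b' x' : ℝ} (ha : a ≤ a') (hb : b ≤ b') (hx : x ≤ x')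
    (h1 : 0 < a) (h2 : 0 < b) (h3 : 0 < x)
    (hab : c < a * b) (hax : c < a * x) (hbx : c < b * x)
    (h : 0 < a * b * x - c * (a + b + x) + d) :
    0 < a' * b' * x' - c * (a' + b' + x') + d := by
  have e2 : a * x ≤ a' * x := mul_le_mul_of_nonneg_right ha h3.le
  have e3 : a * b ≤ a' * b' := mul_le_mul ha hb h2.le (by linarith)
  nlinarith [mul_nonneg (sub_nonneg.2 ha) (sub_nonneg.2 hbx.le),
    mul_nonneg (sub_nonneg.2 hb) (sub_nonneg.2 (hax.le.trans e2)),
    mul_nonneg (sub_nonneg.2 hx) (sub_nonneg.2 (hab.le.trans e3))]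

lemma up4 {c d e a b x y a' b' x' y' : ℝ} (ha : a ≤ a') (hb : b ≤ b') (hx : x ≤ x') (hy : y ≤ y')
    (h1 : 0 < a) (h2 : 0 < b) (h3 : 0 < x) (h4 : 0 < y)
    (hab : c < a * b) (hax : c < a * x) (hbx : c < b * x)
    (hay : c < a * y) (hby : c < b * y) (hxy : c < x * y)
    (habx : 0 < a * b * x - c * (a + b + x) + d)
    (haby : 0 < a * b * y - c * (a + b + y) + d)
    (haxy : 0 < a * x * y - c * (a + x + y) + d)
    (hbxy : 0 < b * x * y - c * (b + x + y) + d)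
    (h : 0 < a * b * x * y - c * (a * b + a * x + a * y + b * x + b * y + x * y)
      + d * (a + b + x + y) - e) :
    0 < a' * b' * x' * y' - c * (a' * b' + a' * x' + a' * y' + b' * x' + b' * y' + x' * y')
      + d * (a' + b' + x' + y') - e := by
  have k2 := up3 ha le_rfl le_rfl h1 h3 h4 hax hay hxy haxy
  have k3 := up3 ha hb le_rfl h1 h2 h4 hab hay hby haby
  have k4 := up3 ha hb hx h1 h2 h3 hab hax hbx habx
  have s1 := mul_nonneg (sub_nonneg.2 ha) hbxy.le
  have s2 := mul_nonneg (sub_nonneg.2 hb) k2.le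
  have s3 := mul_nonneg (sub_nonneg.2 hx) k3.le
  have s4 := mul_nonneg (sub_nonneg.2 hy) k4.le
  linarith

lemma exists_avoid {n : ℕ} (hn : 4 ≤ n) (j k m : Fin n) : ∃ p, j ≠ p ∧ k ≠ p ∧ m ≠ p := by
  obtain ⟨p, -, hp⟩ := Finset.exists_mem_notMem_of_card_lt_card
    (s := ({j, k, m} : Finset (Fin n))) (t := Finset.univ)
    (lt_of_le_of_lt Finset.card_le_three (by simp; omega))
  simp only [Finset.mem_insert, Finset.mem_singleton, not_or] at hp
  exact ⟨p, Ne.symm hp.1, Ne.symm hp.2.1, Ne.symm hp.2.2⟩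


/-- For `n ≥ 4`, `c > 0`, `d ≥ 0` with `2 c^{3/2} > d`,
`θ_{c,d} = (1/3) arccos(−d/(2 c^{3/2}))`, and `e > −24 c² cos²(θ_{c,d}) cos(2 θ_{c,d})`,
the set `A = Υⁿ_{4;1,0,−c,d,−e} ∩ Υⁿ_{3;1,0,−c,d} ∩ Υⁿ_{2;1,0,−c} ∩ Υⁿ_{1;1,0}` is a
connected component of `B = Υⁿ_{4;1,0,−c,d,−e}`. -/
theorem stmt_5 (n : ℕ) (hn : 4 ≤ n) (c d e θ : ℝ) (hc : 0 < c) (hd : 0 ≤ d)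
    (hcd : d < 2 * c ^ ((3 : ℝ) / 2))
    (hθ : θ = (1 / 3) * Real.arccos (-d / (2 * c ^ ((3 : ℝ) / 2))))
    (he : -24 * c ^ 2 * Real.cos θ ^ 2 * Real.cos (2 * θ) < e)
    (A B : Set (Fin n → ℝ))
    (hA : A = {l | (∀ j, 0 < l j) ∧ (∀ j k, j ≠ k → c < l j * l k) ∧
        (∀ j k m, j ≠ k → j ≠ m → k ≠ m →
          0 < l j * l k * l m - c * (l j + l k + l m) + d) ∧
        ∀ j k m p, j ≠ k → j ≠ m → j ≠ p → k ≠ m → k ≠ p → m ≠ p →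
          0 < l j * l k * l m * l p
            - c * (l j * l k + l j * l m + l j * l p + l k * l m + l k * l p + l m * l p)
            + d * (l j + l k + l m + l p) - e})
    (hB : B = {l | ∀ j k m p, j ≠ k → j ≠ m → j ≠ p → k ≠ m → k ≠ p → m ≠ p →
          0 < l j * l k * l m * l p
            - c * (l j * l k + l j * l m + l j * l p + l k * l m + l k * l p + l m * l p)
            + d * (l j + l k + l m + l p) - e}) :
    A.Nonempty ∧ ∀ x ∈ A, connectedComponentIn B x = A := by
  obtain ⟨s, hs, hcs⟩ : ∃ s : ℝ, 0 < s ∧ c = s ^ 2 :=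
    ⟨Real.sqrt c, Real.sqrt_pos.2 hc, (Real.sq_sqrt hc.le).symm⟩
  have hpow : c ^ ((3 : ℝ) / 2) = s ^ 3 := by
    rw [hcs, ← Real.rpow_natCast, ← Real.rpow_natCast, ← Real.rpow_mul hs.le]
    norm_num
  rw [hpow] at hcd hθ
  obtain ⟨u, hu, hdu, hM⟩ := aux_u s d θ hs hd hcd hθ
  rw [← hcs] at hu hdu hM
  rw [hM] at he
  have hAB : A ⊆ B := by
    rw [hA, hB]; exact fun l hl => hl.2.2.2
  have hup : ∀ x ∈ A, Set.Ici x ⊆ A := by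
    intro x hx y hxy
    have hxy : ∀ i, x i ≤ y i := hxy
    rw [hA] at hx ⊢
    obtain ⟨p1, p2, p3, p4⟩ := hx
    refine ⟨fun j => (p1 j).trans_le (hxy j), fun j k h => (p2 j k h).trans_le
      (mul_le_mul (hxy j) (hxy k) (p1 k).le ((p1 j).le.trans (hxy j))), ?_, ?_⟩
    · intro j k m h1 h2 h3
      exact up3 (hxy j) (hxy k) (hxy m) (p1 j) (p1 k) (p1 m) (p2 _ _ h1) (p2 _ _ h2) (p2 _ _ h3)
        (p3 _ _ _ h1 h2 h3)
    · intro j k m p h1 h2 h3 h4 h5 h6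
      exact up4 (hxy j) (hxy k) (hxy m) (hxy p) (p1 j) (p1 k) (p1 m) (p1 p)
        (p2 _ _ h1) (p2 _ _ h2) (p2 _ _ h4) (p2 _ _ h3) (p2 _ _ h5) (p2 _ _ h6)
        (p3 _ _ _ h1 h2 h4) (p3 _ _ _ h1 h3 h5) (p3 _ _ _ h2 h3 h6) (p3 _ _ _ h4 h5 h6)
        (p4 _ _ _ _ h1 h2 h3 h4 h5 h6)
  have hne : A.Nonempty := by
    obtain ⟨T, hT⟩ : ∃ T, T = 1 + 6 * c + |e| := ⟨_, rfl⟩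
    have hae := abs_nonneg e
    have hee := le_abs_self e
    have hT1 : 1 ≤ T := by linarith
    have hT2 : T ≤ T ^ 2 := by nlinarith
    have hTT : 1 + |e| ≤ T ^ 2 - 6 * c := by linarith
    refine ⟨fun _ => T, ?_⟩
    rw [hA]
    refine ⟨fun j => by linarith, fun j k _ => by nlinarith, fun j k m _ _ _ => ?_,
      fun j k m p _ _ _ _ _ _ => ?_⟩
    · have : 0 < T * (T ^ 2 - 3 * c) := mul_pos (by linarith) (by linarith)
      nlinarith
    · have h1 : 1 + |e| ≤ T ^ 2 * (T ^ 2 - 6 * c) := by nlinarith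
      have h2 : 0 ≤ d * T := mul_nonneg hd (by linarith)
      nlinarith
  have hpre : IsPreconnected A := by
    apply isPreconnected_of_forall_pair
    intro x hx y hy
    refine ⟨Set.Ici x ∪ Set.Ici y, Set.union_subset (hup x hx) (hup y hy),
      Or.inl Set.self_mem_Ici, Or.inr Set.self_mem_Ici, ?_⟩
    exact IsPreconnected.union (x ⊔ y) (le_sup_left : x ≤ x ⊔ y) (le_sup_right : y ≤ x ⊔ y)
      (convex_Ici x).isPreconnected (convex_Ici y).isPreconnected
  have hopen : IsOpen A := by
    rw [hA]
    simp only [Set.setOf_and, Set.setOf_forall]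
    refine IsOpen.inter ?_ (IsOpen.inter ?_ (IsOpen.inter ?_ ?_))
    all_goals
      repeat' (refine isOpen_iInter_of_finite fun _ => ?_)
      exact isOpen_lt (by fun_prop) (by fun_prop)
  have hcl : ∀ f : (Fin n → ℝ) → ℝ, Continuous f → (∀ l ∈ A, 0 < f l) →
      ∀ l ∈ closure A, 0 ≤ f l := fun f hf h l hl =>
    closure_minimal (fun x hx => (h x hx).le) (isClosed_le continuous_const hf) hl
  have hclosed : closure A ∩ B ⊆ A := by
    rintro l ⟨hl, hlB⟩
    have q1 : ∀ j, 0 ≤ l j := fun j => hcl (fun l => l j) (by fun_prop)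
      (fun l hl => by rw [hA] at hl; exact hl.1 j) l hl
    have q2 : ∀ j k, j ≠ k → c ≤ l j * l k := fun j k h => by
      have := hcl (fun l => l j * l k - c) (by fun_prop)
        (fun l hl => by rw [hA] at hl; exact sub_pos.2 (hl.2.1 j k h)) l hl
      linarith
    have q3 : ∀ j k m, j ≠ k → j ≠ m → k ≠ m →
          0 ≤ l j * l k * l m - c * (l j + l k + l m) + d := fun j k m h1 h2 h3 =>
      hcl (fun l => l j * l k * l m - c * (l j + l k + l m) + d) (by fun_prop)
        (fun l hl => by rw [hA] at hl; exact hl.2.2.1 j k m h1 h2 h3) l hl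
    have r1 : ∀ j, 0 < l j := by
      intro j
      obtain ⟨k, hk, -, -⟩ := exists_avoid hn j j j
      refine lt_of_le_of_ne (q1 j) fun h => ?_
      have := q2 j k hk
      rw [← h] at this
      linarith
    have r2 : ∀ j k, j ≠ k → c < l j * l k := by
      intro j k h
      refine lt_of_le_of_ne (q2 j k h) fun heq => ?_
      obtain ⟨m, h1, h2, -⟩ := exists_avoid hn j k k
      have h3 := q3 j k m h h1 h2
      rw [← heq] at h3
      have hsum : 2 * s ≤ l j + l k := by
        refine (sq_le_sq₀ (by positivity) ((by linarith [r1 j, r1 k]))).1 ?_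
        nlinarith [sq_nonneg (l j - l k)]
      have := mul_le_mul_of_nonneg_left hsum hc.le
      have e1 : c * (2 * s) = 2 * s ^ 3 := by rw [hcs]; ring
      linarith
    rw [hB] at hlB
    rw [hA]
    refine ⟨r1, r2, ?_, hlB⟩
    intro j k m h1 h2 h3
    refine lt_of_le_of_ne (q3 j k m h1 h2 h3) fun heq => ?_
    obtain ⟨p, g1, g2, g3⟩ := exists_avoid hn j k m
    have h4 := hlB j k m p h1 h2 g1 h3 g2 g3
    have h5 := aux_all s c u d (l j) (l k) (l m) hcs hs hu hdu hcd (r1 j) (r1 k) (r1 m)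
      (q2 _ _ h1) (q2 _ _ h2) (q2 _ _ h3) heq.symm
    have h6 : (l j * l k * l m - c * (l j + l k + l m) + d) * l p = 0 := by rw [← heq, zero_mul]
    linarith
  refine ⟨hne, fun x hx => Set.Subset.antisymm ?_ (hpre.subset_connectedComponentIn hx hAB)⟩
  refine isPreconnected_connectedComponentIn.subset_of_closure_inter_subset hopen
    ⟨x, mem_connectedComponentIn (hAB hx), hx⟩ ?_
  rintro y ⟨hy1, hy2⟩
  exact hclosed ⟨hy1, connectedComponentIn_subset _ _ hy2⟩
end

section
/- Let θ̂ ∈ (π/2, 5π/6) and let c₁ > 0, c₀ ≥ 0 be real numbers with c₁^{3/2} > c₀·sin(θ̂). For μ = (μ₁, μ₂, μ₃) ∈ ℝ³, the set {λ ∈ ℝ³ : cos²(θ̂)·λ₁λ₂λ₃ = c₁(λ₁+λ₂+λ₃) + 2c₀·tan(θ̂), and λ_i > μ_i for i = 1, 2, 3} is bounded if and only if μ_i > 0 for every i and μ_i·μ_j > c₁·sec²(θ̂) for every pair of distinct indices i ≠ j. -/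
lemma exists_pair (a m n d : ℝ) (ha : 0 < a) (hd : 0 < d)
    (h : ¬ (0 < m ∧ 0 < n ∧ a < m * n)) :
    ∃ x y : ℝ, m < x ∧ n < y ∧ 0 < x ∧ 0 < y ∧ x * y = a + d := by
  by_cases hm : 0 < m
  · by_cases hn : 0 < n
    · have hmn : m * n ≤ a := by
        by_contra hc
        exact h ⟨hm, hn, not_le.mp hc⟩
      have hx : 0 < m + d / (2 * n) := by positivity
      refine ⟨m + d / (2 * n), (a + d) / (m + d / (2 * n)), ?_, ?_, hx, by positivity, ?_⟩
      · have : 0 < d / (2 * n) := by positivity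
        linarith
      · rw [lt_div_iff₀ hx]
        have : n * (m + d / (2 * n)) = m * n + d / 2 := by field_simp
        linarith
      · field_simp
    · have hx : 0 < m + 1 := by linarith
      refine ⟨m + 1, (a + d) / (m + 1), by linarith, ?_, hx, by positivity, ?_⟩
      · have : 0 < (a + d) / (m + 1) := by positivity
        linarith
      · field_simp
  · have hx : 0 < |n| + 1 := by positivity
    refine ⟨(a + d) / (|n| + 1), |n| + 1, ?_, ?_, by positivity, hx, ?_⟩
    · have : 0 < (a + d) / (|n| + 1) := by positivity
      linarith
    · linarith [le_abs_self n]
    · field_simp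

lemma exists_large (a b s m n p M : ℝ) (hs : 0 < s) (ha : a = s ^ 2) (hb : b < 2 * a * s)
    (h : ¬ (0 < m ∧ 0 < n ∧ a < m * n)) :
    ∃ x y z : ℝ, m < x ∧ n < y ∧ p < z ∧ M < z ∧ x * y * z = a * (x + y + z) - b := by
  have ha0 : 0 < a := by rw [ha]; positivity
  have hN : 0 < |M| + |p| + 1 := by positivity
  have hr : 0 < 2 * a * s - b := by linarith
  have hd : 0 < (2 * a * s - b) / (|M| + |p| + 1) := by positivity
  obtain ⟨x, y, hx, hy, hx0, hy0, hxy⟩ := exists_pair a m n _ ha0 hd h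
  set d := (2 * a * s - b) / (|M| + |p| + 1) with hdef
  have hdN : (|M| + |p| + 1) * d = 2 * a * s - b := by rw [hdef]; field_simp
  have hsum : 2 * s ≤ x + y := by
    have h4 : (2 * s) ^ 2 ≤ (x + y) ^ 2 := by nlinarith [sq_nonneg (x - y)]
    exact (sq_le_sq₀ (by positivity) (by positivity)).mp h4
  have hz : |M| + |p| + 1 ≤ (a * (x + y) - b) / d := by
    rw [le_div_iff₀ hd, hdN]
    nlinarith
  refine ⟨x, y, (a * (x + y) - b) / d, hx, hy, ?_, ?_, ?_⟩
  · linarith [le_abs_self p, abs_nonneg M]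
  · linarith [le_abs_self M, abs_nonneg p]
  · have : d * ((a * (x + y) - b) / d) = a * (x + y) - b := by field_simp
    rw [hxy]
    linarith

lemma upper (a b m n x y z : ℝ) (ha : 0 < a) (hb : 0 ≤ b) (hm : 0 < m) (hn : 0 < n)
    (hmn : a < m * n) (hx : m < x) (hy : n < y)
    (he : x * y * z = a * (x + y + z) - b) : z ≤ a * (m + n) / (m * n - a) := by
  obtain ⟨u, hu, rfl⟩ : ∃ u, 0 < u ∧ x = m + u := ⟨x - m, by linarith, by ring⟩
  obtain ⟨v, hv, rfl⟩ : ∃ v, 0 < v ∧ y = n + v := ⟨y - n, by linarith, by ring⟩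
  have h0 : 0 < m * n - a := by linarith
  have h1 : 0 < (m + u) * (n + v) - a := by
    have : 0 < m * v + u * n + u * v := by positivity
    linarith
  have key : (m + u + (n + v)) * (m * n - a) ≤ (m + n) * ((m + u) * (n + v) - a) := by
    have : 0 < m ^ 2 * v + n ^ 2 * u + (m + n) * u * v + (u + v) * a := by positivity
    linarith
  have h2 : z * ((m + u) * (n + v) - a) ≤ a * (m + u + (n + v)) := by linarith
  rw [le_div_iff₀ h0]
  refine le_of_mul_le_mul_right ?_ h1
  calc z * (m * n - a) * ((m + u) * (n + v) - a)
      = (z * ((m + u) * (n + v) - a)) * (m * n - a) := by ring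
    _ ≤ (a * (m + u + (n + v))) * (m * n - a) := mul_le_mul_of_nonneg_right h2 h0.le
    _ = a * ((m + u + (n + v)) * (m * n - a)) := by ring
    _ ≤ a * ((m + n) * ((m + u) * (n + v) - a)) := mul_le_mul_of_nonneg_left key ha.le
    _ = _ := by ring


/-- For `θ̂ ∈ (π/2, 5π/6)`, `c₁ > 0`, `c₀ ≥ 0` with
`c₁^{3/2} > c₀ sin θ̂`, and `μ ∈ ℝ³`: the set of solutions `λ` of
`cos²(θ̂) λ₁λ₂λ₃ = c₁(λ₁+λ₂+λ₃) + 2 c₀ tan θ̂` with `λ_i > μ_i` for all `i`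
is bounded iff `μ_i > 0` for all `i` and `μ_i μ_j > c₁ sec²(θ̂)` for all `i ≠ j`. -/
theorem stmt_6 (θ : ℝ) (hθ : θ ∈ Set.Ioo (Real.pi / 2) (5 * Real.pi / 6))
    (c₁ c₀ : ℝ) (hc₁ : 0 < c₁) (hc₀ : 0 ≤ c₀)
    (hP : c₀ * Real.sin θ < c₁ ^ ((3 : ℝ) / 2))
    (μ : Fin 3 → ℝ) :
    Bornology.IsBounded {l : Fin 3 → ℝ |
        Real.cos θ ^ 2 * (l 0 * l 1 * l 2)
          = c₁ * (l 0 + l 1 + l 2) + 2 * c₀ * Real.tan θ ∧ ∀ i, μ i < l i}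
      ↔ ((∀ i, 0 < μ i) ∧ ∀ i j, i ≠ j → c₁ / Real.cos θ ^ 2 < μ i * μ j) := by
  obtain ⟨h1, h2⟩ := hθ
  have hpi := Real.pi_pos
  have hcos : Real.cos θ < 0 := Real.cos_neg_of_pi_div_two_lt_of_lt h1 (by linarith)
  have hsin : 0 < Real.sin θ := Real.sin_pos_of_pos_of_lt_pi (by linarith) (by linarith)
  have hK : 0 < Real.cos θ ^ 2 := by nlinarith
  have htan : Real.tan θ = - (Real.sin θ / (- Real.cos θ)) := by
    rw [Real.tan_eq_sin_div_cos, div_neg, neg_neg]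
  have hpow : c₁ ^ ((3 : ℝ) / 2) = c₁ * √c₁ := by
    rw [Real.sqrt_eq_rpow, show (3 : ℝ) / 2 = 1 + 1 / 2 by norm_num, Real.rpow_add hc₁,
      Real.rpow_one]
  rw [hpow] at hP
  have hw : 0 < - Real.cos θ := by linarith
  have hsq := Real.sq_sqrt hc₁.le
  have hs1 : 0 < √c₁ := Real.sqrt_pos.mpr hc₁
  have hKw : Real.cos θ ^ 2 = (- Real.cos θ) ^ 2 := by ring
  rw [htan, hKw]
  generalize - Real.cos θ = w at *
  generalize Real.sin θ = S at *
  generalize √c₁ = r at *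
  obtain ⟨a, hadef⟩ : ∃ a, a = c₁ / w ^ 2 := ⟨_, rfl⟩
  obtain ⟨b, hbdef⟩ : ∃ b, b = 2 * c₀ * (S / w) / w ^ 2 := ⟨_, rfl⟩
  have ha : 0 < a := by rw [hadef]; positivity
  have hb : 0 ≤ b := by rw [hbdef]; positivity
  have hs : 0 < r / w := by positivity
  have has : a = (r / w) ^ 2 := by rw [hadef, ← hsq]; ring
  have hbs : b < 2 * a * (r / w) := by
    have e1 : b = c₀ * S * (2 / w ^ 3) := by rw [hbdef]; field_simp
    have e2 : 2 * a * (r / w) = c₁ * r * (2 / w ^ 3) := by rw [hadef]; field_simp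
    rw [e1, e2]
    exact mul_lt_mul_of_pos_right hP (by positivity)
  have heq : ∀ x y z : ℝ, w ^ 2 * (x * y * z) = c₁ * (x + y + z) + 2 * c₀ * -(S / w) ↔
      x * y * z = a * (x + y + z) - b := by
    intro x y z
    have e1 : c₁ = w ^ 2 * a := by rw [hadef]; field_simp
    have e2 : 2 * c₀ * -(S / w) = - (w ^ 2 * b) := by rw [hbdef]; field_simp
    rw [e2, e1, show w ^ 2 * a * (x + y + z) + -(w ^ 2 * b)
      = w ^ 2 * (a * (x + y + z) - b) by ring]
    exact mul_right_inj' (by positivity)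
  simp only [heq]
  rw [← hadef, isBounded_iff_forall_norm_le]
  constructor
  · rintro ⟨C, hC⟩
    have hC' : ∀ x y z : ℝ, x * y * z = a * (x + y + z) - b → μ 0 < x → μ 1 < y → μ 2 < z →
        x ≤ C ∧ y ≤ C ∧ z ≤ C := by
      intro x y z h hx hy hz
      have hn := hC ![x, y, z] ⟨by simpa using h, by
        intro i; fin_cases i <;> simpa⟩
      have hi : ∀ i, (![x, y, z] : Fin 3 → ℝ) i ≤ C := fun i =>
        (le_abs_self _).trans ((norm_le_pi_norm (![x, y, z] : Fin 3 → ℝ) i).trans hn)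
      exact ⟨by simpa using hi 0, by simpa using hi 1, by simpa using hi 2⟩
    have h01 : 0 < μ 0 ∧ 0 < μ 1 ∧ a < μ 0 * μ 1 := by
      by_contra hc
      obtain ⟨x, y, z, hx, hy, hz, hM, he⟩ := exists_large a b _ _ _ (μ 2) C hs has hbs hc
      have := hC' x y z he hx hy hz
      linarith [this.2.2]
    have h02 : 0 < μ 0 ∧ 0 < μ 2 ∧ a < μ 0 * μ 2 := by
      by_contra hc
      obtain ⟨x, y, z, hx, hy, hz, hM, he⟩ := exists_large a b _ _ _ (μ 1) C hs has hbs hc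
      have := hC' x z y (by linarith) hx hz hy
      linarith [this.2.1]
    have h12 : 0 < μ 1 ∧ 0 < μ 2 ∧ a < μ 1 * μ 2 := by
      by_contra hc
      obtain ⟨x, y, z, hx, hy, hz, hM, he⟩ := exists_large a b _ _ _ (μ 0) C hs has hbs hc
      have := hC' z x y (by linarith) hz hx hy
      linarith [this.1]
    obtain ⟨p0, p1, q01⟩ := h01
    obtain ⟨-, p2, q02⟩ := h02
    obtain ⟨-, -, q12⟩ := h12
    refine ⟨fun i => by fin_cases i <;> assumption, fun i j hij => ?_⟩
    fin_cases i <;> fin_cases j <;> simp at hij ⊢ <;> first | assumption | (rw [mul_comm]; assumption)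
  · rintro ⟨hpos, hpair⟩
    refine ⟨|a * (μ 1 + μ 2) / (μ 1 * μ 2 - a)| + |a * (μ 0 + μ 2) / (μ 0 * μ 2 - a)|
      + |a * (μ 0 + μ 1) / (μ 0 * μ 1 - a)|, ?_⟩
    rintro l ⟨he, hl⟩
    have u0 := upper a b _ _ (l 1) (l 2) (l 0) ha hb (hpos 1) (hpos 2)
      (hpair 1 2 (by decide)) (hl 1) (hl 2) (by linarith)
    have u1 := upper a b _ _ (l 0) (l 2) (l 1) ha hb (hpos 0) (hpos 2)
      (hpair 0 2 (by decide)) (hl 0) (hl 2) (by linarith)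
    have u2 := upper a b _ _ (l 0) (l 1) (l 2) ha hb (hpos 0) (hpos 1)
      (hpair 0 1 (by decide)) (hl 0) (hl 1) (by linarith)
    have v0 := u0.trans (le_abs_self _)
    have v1 := u1.trans (le_abs_self _)
    have v2 := u2.trans (le_abs_self _)
    have n0 := abs_nonneg (a * (μ 1 + μ 2) / (μ 1 * μ 2 - a))
    have n1 := abs_nonneg (a * (μ 0 + μ 2) / (μ 0 * μ 2 - a))
    have n2 := abs_nonneg (a * (μ 0 + μ 1) / (μ 0 * μ 1 - a))
    rw [pi_norm_le_iff_of_nonneg (by positivity)]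
    intro i
    rw [Real.norm_eq_abs, abs_of_pos ((hpos i).trans (hl i))]
    fin_cases i <;> simp only [Fin.zero_eta, Fin.mk_one, Fin.reduceFinMk] <;> linarith
end

section
/- Let θ̂ ∈ (π, 5π/4) and let c₂ > 0, c₁ ≥ 0, c₀ ∈ ℝ be real numbers satisfying c₂^{3/2} > −c₁·cos(θ̂) and (3csc²(θ̂) − 4)·c₀ > −24·c₂²·csc²(θ̂)·cos²(θ_{c₁,c₂})·cos(2θ_{c₁,c₂}), where θ_{c₁,c₂} := (1/3)·arccos(c₁·cos(θ̂)/c₂^{3/2}) (standard arccosine with values in [0, π]). For μ = (μ₁, μ₂, μ₃, μ₄) ∈ ℝ⁴, the set {λ ∈ ℝ⁴ : sin²(θ̂)·λ₁λ₂λ₃λ₄ − c₂·σ₂(λ) + 2c₁·cot(θ̂)·σ₁(λ) − c₀·(3csc²(θ̂) − 4) = 0, and λ_i > μ_i for i = 1, 2, 3, 4} is bounded if and only if the following three conditions hold: μ_i > 0 for every i; μ_i·μ_j > c₂·csc²(θ̂) for every pair of distinct i ≠ j; and μ_i·μ_j·μ_k − c₂·csc²(θ̂)·(μ_i+μ_j+μ_k)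 + 2c₁·cot(θ̂)·csc²(θ̂) > 0 for every triple of distinct indices i, j, k. -/
/-- Minimum of `σ₂ - 2bσ₁` on the boundary of the cone (normalized). -/
lemma aux_min (b y x₁ x₂ x₃ : ℝ) (hb0 : 0 ≤ b) (hb1 : b < 1) (hy1 : 1 < y) (hy3 : y ^ 2 ≤ 3)
    (hb : 2 * b = 3 * y - y ^ 3) (h1 : 0 < x₁) (h2 : 0 < x₂) (hq : 1 < x₁ * x₂)
    (hP : x₁ * x₂ * x₃ - (x₁ + x₂ + x₃) + 2 * b = 0) :
    3 * y ^ 2 * (y ^ 2 - 2) ≤ (x₁ * x₂ + x₁ * x₃ + x₂ * x₃) - 2 * b * (x₁ + x₂ + x₃) := by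
  obtain ⟨r, hr0, hr⟩ : ∃ r : ℝ, 0 < r ∧ r ^ 2 = x₁ * x₂ :=
    ⟨Real.sqrt (x₁ * x₂), Real.sqrt_pos.2 (by linarith), Real.sq_sqrt (by linarith)⟩
  obtain ⟨s, hs⟩ : ∃ s, s = x₁ + x₂ := ⟨_, rfl⟩
  have hr1 : 1 < r := by nlinarith
  have hs2 : 2 * r ≤ s := by
    refine (sq_le_sq₀ (by linarith) (by linarith)).1 ?_
    rw [mul_pow, hr, hs]
    nlinarith [sq_nonneg (x₁ - x₂)]
  have hq1 : 0 < r ^ 2 - 1 := by linarith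
  have hx3 : x₃ * (r ^ 2 - 1) = s - 2 * b := by rw [hr, hs]; linarith
  have key : 0 ≤ s ^ 2 - 2 * b * (r ^ 2 + 1) * s + r ^ 4 - r ^ 2 + 4 * b ^ 2
      - 3 * y ^ 2 * (y ^ 2 - 2) * (r ^ 2 - 1) := by
    have hbb : b = (3 * y - y ^ 3) / 2 := by linarith
    have hY1 : 1 < y ^ 2 := by nlinarith
    rcases le_or_gt (3 * y ^ 2) (r ^ 2 * (4 - y ^ 2)) with hA | hB
    · have e : s ^ 2 - 2 * b * (r ^ 2 + 1) * s + r ^ 4 - r ^ 2 + 4 * b ^ 2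
          - 3 * y ^ 2 * (y ^ 2 - 2) * (r ^ 2 - 1)
          = (s - b * (r ^ 2 + 1)) ^ 2
            + (r ^ 2 - 1) * ((y ^ 2 - 1) ^ 2 * (r ^ 2 * (4 - y ^ 2) - 3 * y ^ 2) / 4) := by
        rw [hbb]; ring
      rw [e]
      have : 0 ≤ r ^ 2 * (4 - y ^ 2) - 3 * y ^ 2 := by linarith
      positivity
    · have hm : b * (r ^ 2 + 1) ≤ 2 * r := by
        by_contra hcon
        push Not at hcon
        -- compare at r₀
        obtain ⟨d, hd0, hd⟩ : ∃ d : ℝ, 0 < d ∧ d ^ 2 * (4 - y ^ 2) = 3 * y ^ 2 := by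
          refine ⟨Real.sqrt (3 * y ^ 2 / (4 - y ^ 2)), Real.sqrt_pos.2 ?_, ?_⟩
          · apply div_pos <;> nlinarith
          · rw [Real.sq_sqrt]
            · field_simp [show (4 - y ^ 2) ≠ 0 by nlinarith]
            · apply div_nonneg <;> nlinarith
        have h4 : 0 < 4 - y ^ 2 := by linarith
        have hrd : r < d := by
          have : r ^ 2 < d ^ 2 := by
            by_contra h; push Not at h; nlinarith
          exact lt_of_pow_lt_pow_left₀ 2 hd0.le this
        have hd2 : b * (d ^ 2 + 1) ≤ 2 * d := by
          have : (b * (d ^ 2 + 1)) ^ 2 ≤ (2 * d) ^ 2 := by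
            have e1 : (b * (d ^ 2 + 1)) ^ 2 * (4 - y ^ 2) ^ 2
                = b ^ 2 * (3 * y ^ 2 + (4 - y ^ 2)) ^ 2 := by rw [← hd]; ring
            have e2 : (2 * d) ^ 2 * (4 - y ^ 2) ^ 2 = 4 * (3 * y ^ 2) * (4 - y ^ 2) := by
              rw [← hd]; ring
            have e3 : 4 * (3 * y ^ 2) * (4 - y ^ 2) - b ^ 2 * (3 * y ^ 2 + (4 - y ^ 2)) ^ 2
                = y ^ 2 * ((y ^ 2 - 1) ^ 2 * (12 - (y ^ 2) ^ 2)) := by rw [hbb]; ring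
            have e4 : 0 ≤ 12 - (y ^ 2) ^ 2 := by nlinarith
            have e5 : 0 ≤ y ^ 2 * ((y ^ 2 - 1) ^ 2 * (12 - (y ^ 2) ^ 2)) := by positivity
            have e6 : 0 < (4 - y ^ 2) ^ 2 := by positivity
            exact le_of_mul_le_mul_right (by rw [e1, e2]; linarith) e6
          exact (sq_le_sq₀ (by positivity) (by positivity)).1 this
        -- concavity on [1,d]
        have c1 : 0 < (d - r) := by linarith
        have c2 : 0 < (r - 1) := by linarith
        have idn : (d - 1) * (2 * r - b * (r ^ 2 + 1))
            = (d - r) * (2 - 2 * b) + (r - 1) * (2 * d - b * (d ^ 2 + 1))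
              + b * ((d - r) * (r - 1) * (d - 1)) := by ring
        have p1 : 0 ≤ (d - r) * (2 - 2 * b) := mul_nonneg c1.le (by linarith)
        have p2 : 0 ≤ (r - 1) * (2 * d - b * (d ^ 2 + 1)) := mul_nonneg c2.le (by linarith)
        have p3 : 0 ≤ b * ((d - r) * (r - 1) * (d - 1)) :=
          mul_nonneg hb0 (mul_nonneg (mul_nonneg c1.le c2.le) (by linarith))
        have p4 : (d - 1) * (2 * r - b * (r ^ 2 + 1)) < 0 :=
          mul_neg_of_pos_of_neg (by linarith) (by linarith)
        linarith
      have e : s ^ 2 - 2 * b * (r ^ 2 + 1) * s + r ^ 4 - r ^ 2 + 4 * b ^ 2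
          - 3 * y ^ 2 * (y ^ 2 - 2) * (r ^ 2 - 1)
          = (s - 2 * r) * ((s - 2 * r) + 2 * (2 * r - b * (r ^ 2 + 1)))
            + (r - y) ^ 2 * ((r + y * (y ^ 2 - 2)) ^ 2 + (y ^ 2 - 1) ^ 2 * (3 - y ^ 2)) := by
        rw [hbb]; ring
      rw [e]
      have q1 : 0 ≤ s - 2 * r := by linarith
      have q2 : 0 ≤ 2 * r - b * (r ^ 2 + 1) := by linarith
      have q3 : 0 ≤ 3 - y ^ 2 := by linarith
      positivity
  have e : ((x₁ * x₂ + x₁ * x₃ + x₂ * x₃) - 2 * b * (x₁ + x₂ + x₃)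
      - 3 * y ^ 2 * (y ^ 2 - 2)) * (r ^ 2 - 1) = s ^ 2 - 2 * b * (r ^ 2 + 1) * s + r ^ 4 - r ^ 2
      + 4 * b ^ 2 - 3 * y ^ 2 * (y ^ 2 - 2) * (r ^ 2 - 1) := by
    have : (x₁ * x₂ + x₁ * x₃ + x₂ * x₃) - 2 * b * (x₁ + x₂ + x₃)
      = r ^ 2 - 2 * b * s + (s - 2 * b) * x₃ := by rw [hr, hs]; ring
    rw [this]
    linear_combination (s - 2 * b) * hx3
  by_contra hcon
  push Not at hcon
  rw [← e] at key
  have := mul_neg_of_neg_of_pos (sub_neg.2 hcon) hq1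
  linarith

/-- Scaled version. -/
lemma aux_min' (a b y x₁ x₂ x₃ : ℝ) (ha : 0 < a) (hb0 : 0 ≤ b) (hb1 : b < 1) (hy1 : 1 < y)
    (hy3 : y ^ 2 ≤ 3)
    (hb : 2 * b = 3 * y - y ^ 3) (h1 : 0 < x₁) (h2 : 0 < x₂) (hq : a ^ 2 < x₁ * x₂)
    (hP : x₁ * x₂ * x₃ - a ^ 2 * (x₁ + x₂ + x₃) + 2 * b * a ^ 3 = 0) :
    a ^ 4 * (3 * y ^ 2 * (y ^ 2 - 2)) ≤
      a ^ 2 * (x₁ * x₂ + x₁ * x₃ + x₂ * x₃) - 2 * b * a ^ 3 * (x₁ + x₂ + x₃) := by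
  obtain ⟨z₁, rfl⟩ : ∃ z, x₁ = a * z := ⟨x₁ / a, by field_simp⟩
  obtain ⟨z₂, rfl⟩ : ∃ z, x₂ = a * z := ⟨x₂ / a, by field_simp⟩
  obtain ⟨z₃, rfl⟩ : ∃ z, x₃ = a * z := ⟨x₃ / a, by field_simp⟩
  have ha2 : 0 < a ^ 2 := by positivity
  have ha3 : a ^ 3 ≠ 0 := by positivity
  have hP' : z₁ * z₂ * z₃ - (z₁ + z₂ + z₃) + 2 * b = 0 := by
    apply mul_left_cancel₀ ha3
    linear_combination hP
  have := aux_min b y z₁ z₂ z₃ hb0 hb1 hy1 hy3 hb (pos_of_mul_pos_right h1 ha.le)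
    (pos_of_mul_pos_right h2 ha.le) (by
      apply lt_of_mul_lt_mul_left _ ha2.le
      linarith) hP'
  have := mul_le_mul_of_nonneg_left this (show 0 ≤ a ^ 4 by positivity)
  linarith

/-- The triple cone. -/
def AuxCone (A D x y z : ℝ) : Prop :=
  (0 < x ∧ 0 < y ∧ 0 < z) ∧ (A < x * y ∧ A < x * z ∧ A < y * z) ∧
    0 < x * y * z - A * (x + y + z) + D

lemma aux_pair (a b x y z : ℝ) (ha : 0 < a) (hb1 : b < 1)
    (hx : 0 ≤ x) (hy : 0 ≤ y) (hxy : a ^ 2 ≤ x * y)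
    (hP : 0 ≤ x * y * z - a ^ 2 * (x + y + z) + 2 * b * a ^ 3) : a ^ 2 < x * y := by
  rcases hxy.lt_or_eq with h | h
  · exact h
  exfalso
  rw [← h] at hP
  have h3 : 0 ≤ a ^ 2 * (2 * b * a - (x + y)) := by linarith
  have h4 : 0 ≤ 2 * b * a - (x + y) := nonneg_of_mul_nonneg_right h3 (by positivity)
  have h5 : b * a < a := by nlinarith
  nlinarith [sq_nonneg (x - y)]

/-- If the triple is not in the cone, solutions with arbitrarily large last coordinate exist. -/
lemma aux_unbdd (a b y C u v w : ℝ) (ha : 0 < a) (hb0 : 0 ≤ b) (hb1 : b < 1) (hy1 : 1 < y)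
    (hy3 : y ^ 2 ≤ 3) (hb : 2 * b = 3 * y - y ^ 3)
    (hC : -(a ^ 4 * (3 * y ^ 2 * (y ^ 2 - 2))) < C)
    (hn : ¬ AuxCone (a ^ 2) (2 * b * a ^ 3) u v w) (M : ℝ) :
    ∃ p q r s : ℝ, u < p ∧ v < q ∧ w < r ∧ M < s ∧
      p * q * r * s - a ^ 2 * (p * q + p * r + p * s + q * r + q * s + r * s)
        + 2 * b * a ^ 3 * (p + q + r + s) - C = 0 := by
  obtain ⟨P, hPd⟩ : ∃ P : ℝ → ℝ, P = fun t => (u + t) * (v + t) * (w + t)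
      - a ^ 2 * ((u + t) + (v + t) + (w + t)) + 2 * b * a ^ 3 := ⟨_, rfl⟩
  have hPc : Continuous P := by rw [hPd]; fun_prop
  obtain ⟨g, hg⟩ : ∃ g : ℝ → ℝ, g = fun t => min (min (u + t) (min (v + t) (w + t)))
    (min (min ((u + t) * (v + t) - a ^ 2) (min ((u + t) * (w + t) - a ^ 2)
      ((v + t) * (w + t) - a ^ 2))) (P t)) := ⟨_, rfl⟩
  have hgc : Continuous g := by rw [hg]; fun_prop
  have hg0 : g 0 ≤ 0 := by
    by_contra h
    push Not at h
    apply hn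
    rw [hg, hPd] at h
    simp only [lt_min_iff, add_zero, sub_pos] at h
    exact h
  obtain ⟨N, hN0, hN⟩ : ∃ N : ℝ, 0 ≤ N ∧ 0 < g N := by
    refine ⟨|u| + |v| + |w| + 2 * a, by positivity, ?_⟩
    have hu : 2 * a ≤ u + (|u| + |v| + |w| + 2 * a) := by
      linarith [neg_abs_le u, abs_nonneg v, abs_nonneg w]
    have hv : 2 * a ≤ v + (|u| + |v| + |w| + 2 * a) := by
      linarith [neg_abs_le v, abs_nonneg u, abs_nonneg w]
    have hw : 2 * a ≤ w + (|u| + |v| + |w| + 2 * a) := by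
      linarith [neg_abs_le w, abs_nonneg v, abs_nonneg u]
    rw [hg, hPd]
    simp only [lt_min_iff, sub_pos]
    generalize u + (|u| + |v| + |w| + 2 * a) = x at *
    generalize v + (|u| + |v| + |w| + 2 * a) = y at *
    generalize w + (|u| + |v| + |w| + 2 * a) = z at *
    have h1 : 4 * a ^ 2 ≤ x * y := by nlinarith
    have h2 : 4 * a ^ 2 ≤ x * z := by nlinarith
    have h3 : 4 * a ^ 2 ≤ y * z := by nlinarith
    have ha2 : 0 < a ^ 2 := by positivity
    refine ⟨⟨by linarith, by linarith, by linarith⟩,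
      ⟨by linarith, by linarith, by linarith⟩, ?_⟩
    have k1 : 4 * a ^ 2 * z ≤ x * y * z := mul_le_mul_of_nonneg_right h1 (by linarith)
    have k2 : 4 * a ^ 2 * y ≤ x * z * y := mul_le_mul_of_nonneg_right h2 (by linarith)
    have k3 : 4 * a ^ 2 * x ≤ y * z * x := mul_le_mul_of_nonneg_right h3 (by linarith)
    have k4 : 0 ≤ 2 * b * a ^ 3 := by positivity
    have k5 : 0 < a ^ 2 * (x + y + z) := by
      have : 0 < x + y + z := by linarith
      positivity
    linarith
  obtain ⟨t, ⟨ht0, -⟩, ht⟩ := intermediate_value_Icc hN0 hgc.continuousOn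
    (show (0 : ℝ) ∈ Set.Icc (g 0) (g N) from ⟨hg0, hN.le⟩)
  have hge : 0 ≤ g t := ht.ge
  have hnot : ¬ 0 < g t := by rw [ht]; exact lt_irrefl _
  rw [hg] at hge hnot
  simp only [le_min_iff, lt_min_iff, sub_nonneg, sub_pos] at hge hnot
  obtain ⟨⟨gu, gv, gw⟩, ⟨guv, guw, gvw⟩, gP⟩ := hge
  have gP' := gP
  rw [hPd] at gP'
  simp only at gP'
  have ha2 : 0 < a ^ 2 := by positivity
  have luv := aux_pair a b _ _ (w + t) ha hb1 gu gv guv (by linarith)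
  have luw := aux_pair a b _ _ (v + t) ha hb1 gu gw guw (by linarith)
  have lvw := aux_pair a b _ _ (u + t) ha hb1 gv gw gvw (by linarith)
  have pu : 0 < u + t := by
    rcases gu.lt_or_eq with h | h
    · exact h
    · rw [← h] at luv; linarith
  have pv : 0 < v + t := by
    rcases gv.lt_or_eq with h | h
    · exact h
    · rw [← h] at luv; linarith
  have pw : 0 < w + t := by
    rcases gw.lt_or_eq with h | h
    · exact h
    · rw [← h] at luw; linarith
  have hP0 : P t = 0 := by
    refine le_antisymm ?_ gP
    by_contra h
    push Not at h
    exact hnot ⟨⟨pu, pv, pw⟩, ⟨luv, luw, lvw⟩, h⟩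
  have hPmono : ∀ e, 0 < e → 0 < P (t + e) := by
    intro e he
    have : P (t + e) = P t + e * (((u + t) * (v + t) - a ^ 2) + ((u + t) * (w + t) - a ^ 2)
        + ((v + t) * (w + t) - a ^ 2)) + e ^ 2 * ((u + t) + (v + t) + (w + t)) + e ^ 3 := by
      rw [hPd]; ring
    rw [this, hP0]
    have d1 := sub_pos.2 luv
    have d2 := sub_pos.2 luw
    have d3 := sub_pos.2 lvw
    positivity
  obtain ⟨Q, hQd⟩ : ∃ Q : ℝ → ℝ, Q = fun t => a ^ 2 * ((u + t) * (v + t) + (u + t) * (w + t)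
      + (v + t) * (w + t)) - 2 * b * a ^ 3 * ((u + t) + (v + t) + (w + t)) + C := ⟨_, rfl⟩
  have hQc : Continuous Q := by rw [hQd]; fun_prop
  have hQ : 0 < Q t := by
    have := aux_min' a b y _ _ (w + t) ha hb0 hb1 hy1 hy3 hb pu pv luv
      (by rw [hPd] at hP0; exact hP0)
    rw [hQd]
    simp only
    linarith
  have hcont : Continuous fun e => M * P (t + e) - Q (t + e) := by fun_prop
  have hlt : M * P (t + 0) - Q (t + 0) < 0 := by
    rw [add_zero, hP0]; linarith
  have hev := (hcont.continuousAt (x := 0)).eventually (gt_mem_nhds hlt)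
  obtain ⟨ε, hε, hball⟩ := Metric.eventually_nhds_iff.1 hev
  have hlt2 := hball (y := ε / 2) (by
    rw [Real.dist_eq, sub_zero, abs_of_pos (by linarith)]; linarith)
  have hPp := hPmono (ε / 2) (by linarith)
  obtain ⟨e, he⟩ : ∃ e, e = t + ε / 2 := ⟨_, rfl⟩
  rw [← he] at hPp hlt2
  refine ⟨u + e, v + e, w + e, Q e / P e, by linarith, by linarith, by linarith, ?_, ?_⟩
  · rw [lt_div_iff₀ hPp]; linarith
  · have h := div_mul_cancel₀ (Q e) hPp.ne'
    generalize Q e / P e = s at *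
    rw [hPd, hQd] at h
    simp only at h
    linear_combination h

lemma aux_bound (A D C x y z w p q r s : ℝ) (h : AuxCone A D x y z)
    (hxw : A < x * w) (hyw : A < y * w) (hzw : A < z * w) (hw : 0 < w)
    (h1 : 0 < x * y * w - A * (x + y + w) + D)
    (h2 : 0 < x * z * w - A * (x + z + w) + D)
    (h3 : 0 < y * z * w - A * (y + z + w) + D)
    (hp : x < p) (hq : y < q) (hr : z < r) (hs : w < s)
    (he : p * q * r * s - A * (p * q + p * r + p * s + q * r + q * s + r * s)
        + D * (p + q + r + s) - C = 0) :
    s ≤ w + |x * y * z * w - A * (x * y + x * z + x * w + y * z + y * w + z * w)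
        + D * (x + y + z + w) - C| / (x * y * z - A * (x + y + z) + D) := by
  obtain ⟨⟨hx, hy, hz⟩, ⟨hxy, hxz, hyz⟩, hP⟩ := h
  have key : (x * y * z - A * (x + y + z) + D) * (s - w) ≤
      -(x * y * z * w - A * (x * y + x * z + x * w + y * z + y * w + z * w)
        + D * (x + y + z + w) - C) := by
    obtain ⟨i, rfl⟩ : ∃ i, p = x + i := ⟨p - x, by ring⟩
    obtain ⟨j, rfl⟩ : ∃ i, q = y + i := ⟨q - y, by ring⟩
    obtain ⟨k, rfl⟩ : ∃ i, r = z + i := ⟨r - z, by ring⟩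
    obtain ⟨l, rfl⟩ : ∃ i, s = w + i := ⟨s - w, by ring⟩
    have hi : 0 < i := by linarith
    have hj : 0 < j := by linarith
    have hk : 0 < k := by linarith
    have hl : 0 < l := by linarith
    rw [← sub_pos] at hxy hxz hyz hxw hyw hzw
    have pos : 0 ≤ i * (y * z * w - A * (y + z + w) + D) + j * (x * z * w - A * (x + z + w) + D)
      + k * (x * y * w - A * (x + y + w) + D)
      + i * j * (z * w - A) + i * k * (y * w - A) + i * l * (y * z - A) + j * k * (x * w - A)
      + j * l * (x * z - A) + k * l * (x * y - A)
      + i * j * k * w + i * j * l * z + i * k * l * y + j * k * l * x + i * j * k * l := by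
      positivity
    linarith
  have : s - w ≤ |x * y * z * w - A * (x * y + x * z + x * w + y * z + y * w + z * w)
        + D * (x + y + z + w) - C| / (x * y * z - A * (x + y + z) + D) := by
    rw [le_div_iff₀ hP]
    have := neg_abs_le (x * y * z * w - A * (x * y + x * z + x * w + y * z + y * w + z * w)
        + D * (x + y + z + w) - C)
    linarith
  linarith

lemma aux_main (a b y C : ℝ) (ha : 0 < a) (hb0 : 0 ≤ b) (hb1 : b < 1) (hy1 : 1 < y)
    (hy3 : y ^ 2 ≤ 3) (hb : 2 * b = 3 * y - y ^ 3)
    (hC : -(a ^ 4 * (3 * y ^ 2 * (y ^ 2 - 2))) < C) (μ : Fin 4 → ℝ) :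
    Bornology.IsBounded {l : Fin 4 → ℝ |
        l 0 * l 1 * l 2 * l 3
          - a ^ 2 * (l 0 * l 1 + l 0 * l 2 + l 0 * l 3 + l 1 * l 2 + l 1 * l 3 + l 2 * l 3)
          + 2 * b * a ^ 3 * (l 0 + l 1 + l 2 + l 3) - C = 0 ∧ ∀ i, μ i < l i}
      ↔ ((∀ i, 0 < μ i) ∧
         (∀ i j, i ≠ j → a ^ 2 < μ i * μ j) ∧
         ∀ i j k, i ≠ j → i ≠ k → j ≠ k →
           0 < μ i * μ j * μ k - a ^ 2 * (μ i + μ j + μ k) + 2 * b * a ^ 3) := by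
  constructor
  · intro hbd
    obtain ⟨R, hR⟩ := hbd.exists_norm_le
    have hR' : ∀ p q r s : ℝ, (p * q * r * s
          - a ^ 2 * (p * q + p * r + p * s + q * r + q * s + r * s)
          + 2 * b * a ^ 3 * (p + q + r + s) - C = 0) → μ 0 < p → μ 1 < q → μ 2 < r → μ 3 < s →
          p ≤ R ∧ q ≤ R ∧ r ≤ R ∧ s ≤ R := by
      intro p q r s he h0 h1 h2 h3
      have hm := hR ![p, q, r, s] ⟨by simpa using he, by
        intro i; fin_cases i <;> simpa⟩
      have hc : ∀ i, ![p, q, r, s] i ≤ R := fun i =>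
        (le_abs_self _).trans ((norm_le_pi_norm ![p, q, r, s] i).trans hm)
      exact ⟨hc 0, hc 1, hc 2, hc 3⟩
    have U := fun u v w => aux_unbdd a b y C u v w ha hb0 hb1 hy1 hy3 hb hC
    have t3 : AuxCone (a ^ 2) (2 * b * a ^ 3) (μ 0) (μ 1) (μ 2) := by
      by_contra hn
      obtain ⟨p, q, r, s, k0, k1, k2, k3, he⟩ := U _ _ _ hn (max R (μ 3))
      have := hR' p q r s (by linarith) k0 k1 k2 (lt_of_le_of_lt (le_max_right _ _) k3)
      linarith [le_max_left R (μ 3)]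
    have t2 : AuxCone (a ^ 2) (2 * b * a ^ 3) (μ 0) (μ 1) (μ 3) := by
      by_contra hn
      obtain ⟨p, q, r, s, k0, k1, k2, k3, he⟩ := U _ _ _ hn (max R (μ 2))
      have := hR' p q s r (by linarith) k0 k1 (lt_of_le_of_lt (le_max_right _ _) k3) k2
      linarith [le_max_left R (μ 2)]
    have t1 : AuxCone (a ^ 2) (2 * b * a ^ 3) (μ 0) (μ 2) (μ 3) := by
      by_contra hn
      obtain ⟨p, q, r, s, k0, k1, k2, k3, he⟩ := U _ _ _ hn (max R (μ 1))
      have := hR' p s q r (by linarith) k0 (lt_of_le_of_lt (le_max_right _ _) k3) k1 k2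
      linarith [le_max_left R (μ 1)]
    have t0 : AuxCone (a ^ 2) (2 * b * a ^ 3) (μ 1) (μ 2) (μ 3) := by
      by_contra hn
      obtain ⟨p, q, r, s, k0, k1, k2, k3, he⟩ := U _ _ _ hn (max R (μ 0))
      have := hR' s p q r (by linarith) (lt_of_le_of_lt (le_max_right _ _) k3) k0 k1 k2
      linarith [le_max_left R (μ 0)]
    obtain ⟨⟨m0, m1, m2⟩, ⟨m01, m02, m12⟩, m012⟩ := t3
    obtain ⟨⟨-, -, m3⟩, ⟨-, m03, m13⟩, m013⟩ := t2
    obtain ⟨-, ⟨-, -, m23⟩, m023⟩ := t1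
    obtain ⟨-, -, m123⟩ := t0
    refine ⟨?_, ?_, ?_⟩
    · intro i; fin_cases i <;> assumption
    · intro i j hij
      fin_cases i <;> fin_cases j <;> first | exact absurd rfl hij | (simp; linarith)
    · intro i j k hij hik hjk
      fin_cases i <;> fin_cases j <;> first
        | exact absurd rfl hij
        | (fin_cases k <;> first
            | exact absurd rfl hik | exact absurd rfl hjk | (simp; linarith))
  · rintro ⟨hpos, hpair, htri⟩
    have cone : ∀ i j k : Fin 4, i ≠ j → i ≠ k → j ≠ k →
        AuxCone (a ^ 2) (2 * b * a ^ 3) (μ i) (μ j) (μ k) := fun i j k h1 h2 h3 =>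
      ⟨⟨hpos i, hpos j, hpos k⟩, ⟨hpair _ _ h1, hpair _ _ h2, hpair _ _ h3⟩,
        htri _ _ _ h1 h2 h3⟩
    have bnd := fun (i j k m : Fin 4) (hij : i ≠ j) (hik : i ≠ k) (hjk : j ≠ k) (him : i ≠ m)
        (hjm : j ≠ m) (hkm : k ≠ m) (l : Fin 4 → ℝ) (hl : ∀ i, μ i < l i) =>
      aux_bound (a ^ 2) (2 * b * a ^ 3) C (μ i) (μ j) (μ k) (μ m) (l i) (l j) (l k) (l m)
        (cone i j k hij hik hjk) (hpair _ _ him) (hpair _ _ hjm) (hpair _ _ hkm) (hpos m)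
        (htri _ _ _ hij him hjm) (htri _ _ _ hik him hkm) (htri _ _ _ hjk hjm hkm)
        (hl i) (hl j) (hl k) (hl m)
    have B0 := bnd 1 2 3 0 (by decide) (by decide) (by decide) (by decide) (by decide) (by decide)
    have B1 := bnd 0 2 3 1 (by decide) (by decide) (by decide) (by decide) (by decide) (by decide)
    have B2 := bnd 0 1 3 2 (by decide) (by decide) (by decide) (by decide) (by decide) (by decide)
    have B3 := bnd 0 1 2 3 (by decide) (by decide) (by decide) (by decide) (by decide) (by decide)
    generalize μ 0 + |_| / _ = b0 at B0
    generalize μ 1 + |_| / _ = b1 at B1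
    generalize μ 2 + |_| / _ = b2 at B2
    generalize μ 3 + |_| / _ = b3 at B3
    apply (Metric.isBounded_Icc μ ![b0, b1, b2, b3]).subset
    rintro l ⟨he, hl⟩
    refine ⟨fun i => (hl i).le, fun i => ?_⟩
    fin_cases i
    · exact B0 l hl (by linarith)
    · exact B1 l hl (by linarith)
    · exact B2 l hl (by linarith)
    · exact B3 l hl (by linarith)

/-- Characterization of C-subsolutions to the four-dimensional
dHYM continuity-path equation: for `θ̂ ∈ (π, 5π/4)`, `c₂ > 0`, `c₁ ≥ 0`, `c₀ ∈ ℝ`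
satisfying `c₂^{3/2} > −c₁ cos θ̂` and the Positivstellensatz bound, boundedness of the
solution set above `μ` is equivalent to the three Υ-cone conditions on `μ`. -/
theorem stmt_7 (θ : ℝ) (hθ : θ ∈ Set.Ioo Real.pi (5 * Real.pi / 4))
    (c₂ c₁ c₀ : ℝ) (hc₂ : 0 < c₂) (hc₁ : 0 ≤ c₁)
    (h1 : -c₁ * Real.cos θ < c₂ ^ ((3 : ℝ) / 2))
    (θc : ℝ) (hθc : θc = (1 / 3) * Real.arccos (c₁ * Real.cos θ / c₂ ^ ((3 : ℝ) / 2)))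
    (h2 : -24 * c₂ ^ 2 * (1 / Real.sin θ ^ 2) * Real.cos θc ^ 2 * Real.cos (2 * θc)
        < (3 / Real.sin θ ^ 2 - 4) * c₀)
    (μ : Fin 4 → ℝ) :
    Bornology.IsBounded {l : Fin 4 → ℝ |
        Real.sin θ ^ 2 * (l 0 * l 1 * l 2 * l 3)
          - c₂ * (l 0 * l 1 + l 0 * l 2 + l 0 * l 3 + l 1 * l 2 + l 1 * l 3 + l 2 * l 3)
          + 2 * c₁ * (Real.cos θ / Real.sin θ) * (l 0 + l 1 + l 2 + l 3)
          - c₀ * (3 / Real.sin θ ^ 2 - 4) = 0 ∧ ∀ i, μ i < l i}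
      ↔ ((∀ i, 0 < μ i) ∧
         (∀ i j, i ≠ j → c₂ / Real.sin θ ^ 2 < μ i * μ j) ∧
         ∀ i j k, i ≠ j → i ≠ k → j ≠ k →
           0 < μ i * μ j * μ k - c₂ / Real.sin θ ^ 2 * (μ i + μ j + μ k)
             + 2 * c₁ * (Real.cos θ / Real.sin θ) / Real.sin θ ^ 2) := by
  obtain ⟨hθ1, hθ2⟩ := hθ
  have hpi := Real.pi_pos
  have hsin : Real.sin θ < 0 := by
    have : 0 < Real.sin (θ - Real.pi) :=
      Real.sin_pos_of_pos_of_lt_pi (by linarith) (by linarith)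
    rw [Real.sin_sub_pi] at this
    linarith
  have hcos : Real.cos θ < 0 := by
    have : 0 < Real.cos (θ - Real.pi) :=
      Real.cos_pos_of_mem_Ioo ⟨by linarith, by linarith⟩
    rw [Real.cos_sub_pi] at this
    linarith
  obtain ⟨K, hK, rfl⟩ : ∃ K : ℝ, 0 < K ∧ c₂ = K ^ 2 :=
    ⟨Real.sqrt c₂, Real.sqrt_pos.2 hc₂, (Real.sq_sqrt hc₂.le).symm⟩
  have hK3 : (K ^ 2) ^ ((3 : ℝ) / 2) = K ^ 3 := by
    rw [← Real.rpow_natCast K 2, ← Real.rpow_mul hK.le, ← Real.rpow_natCast K 3]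
    norm_num
  rw [hK3] at h1 hθc
  obtain ⟨S, hS⟩ : ∃ S, S = - Real.sin θ := ⟨_, rfl⟩
  have hS0 : 0 < S := by linarith
  have hsS : Real.sin θ = -S := by linarith
  obtain ⟨b, hbd⟩ : ∃ b, b = -(c₁ * Real.cos θ / K ^ 3) := ⟨_, rfl⟩
  have hK30 : 0 < K ^ 3 := by positivity
  have hbK : b * K ^ 3 = -c₁ * Real.cos θ := by rw [hbd]; field_simp
  have hb0 : 0 ≤ b := by
    have : 0 ≤ b * K ^ 3 := by rw [hbK]; nlinarith
    exact nonneg_of_mul_nonneg_left this hK30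
  have hb1 : b < 1 := by
    rw [← hbK] at h1
    by_contra h; push Not at h; nlinarith
  have hbn : c₁ * Real.cos θ / K ^ 3 = -b := by linarith
  rw [hbn] at hθc
  have h3 : Real.cos (3 * θc) = -b := by
    rw [hθc, show 3 * (1 / 3 * Real.arccos (-b)) = Real.arccos (-b) by ring]
    exact Real.cos_arccos (by linarith) (by linarith)
  have hlo : Real.pi / 6 ≤ θc := by
    have : Real.pi / 2 ≤ Real.arccos (-b) := by
      rw [Real.arccos_neg]
      linarith [Real.arccos_le_pi_div_two.2 hb0]
    linarith
  have hhi : θc < Real.pi / 3 := by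
    have : Real.arccos (-b) < Real.pi := by
      rw [Real.arccos_neg]
      linarith [Real.arccos_pos.2 hb1]
    linarith
  obtain ⟨y, hy⟩ : ∃ y, y = 2 * Real.cos θc := ⟨_, rfl⟩
  have hy1 : 1 < y := by
    have := Real.cos_lt_cos_of_nonneg_of_le_pi (by linarith : 0 ≤ θc)
      (by linarith : Real.pi / 3 ≤ Real.pi) hhi
    rw [Real.cos_pi_div_three] at this
    linarith
  have hb : 2 * b = 3 * y - y ^ 3 := by
    rw [Real.cos_three_mul] at h3
    rw [hy]; linarith
  have hy3 : y ^ 2 ≤ 3 := by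
    by_contra h; push Not at h
    nlinarith
  have hcosc : Real.cos θc = y / 2 := by linarith
  rw [Real.cos_two_mul, hcosc, hsS] at h2
  have hmain := aux_main (K / S) b y (c₀ * (3 / S ^ 2 - 4) / S ^ 2) (by positivity) hb0 hb1 hy1 hy3
    hb (by
      rw [lt_div_iff₀ (by positivity)]
      calc _ = -24 * (K ^ 2) ^ 2 * (1 / (-S) ^ 2) * (y / 2) ^ 2 * (2 * (y / 2) ^ 2 - 1) := by
            rw [neg_sq]; field_simp; ring
        _ < _ := h2
        _ = _ := by rw [neg_sq]; ring) μ
  have hA : (K / S) ^ 2 = K ^ 2 / S ^ 2 := by rw [div_pow]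
  have hct : Real.cos θ / -S = - Real.cos θ / S := by rw [div_neg, neg_div]
  have hD : 2 * b * (K / S) ^ 3 = 2 * c₁ * (Real.cos θ / -S) / S ^ 2 := by
    have : 2 * b * (K / S) ^ 3 = 2 * (b * K ^ 3) / S ^ 3 := by rw [div_pow]; ring
    rw [this, hbK, hct]
    field_simp
  rw [hA, hD] at hmain
  rw [hsS, neg_sq]
  rw [← hmain]
  have hset : ∀ l : Fin 4 → ℝ, (S ^ 2 * (l 0 * l 1 * l 2 * l 3)
          - K ^ 2 * (l 0 * l 1 + l 0 * l 2 + l 0 * l 3 + l 1 * l 2 + l 1 * l 3 + l 2 * l 3)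
          + 2 * c₁ * (Real.cos θ / -S) * (l 0 + l 1 + l 2 + l 3)
          - c₀ * (3 / S ^ 2 - 4) = 0) ↔ (l 0 * l 1 * l 2 * l 3
          - K ^ 2 / S ^ 2 * (l 0 * l 1 + l 0 * l 2 + l 0 * l 3 + l 1 * l 2 + l 1 * l 3 + l 2 * l 3)
          + 2 * c₁ * (Real.cos θ / -S) / S ^ 2 * (l 0 + l 1 + l 2 + l 3)
          - c₀ * (3 / S ^ 2 - 4) / S ^ 2 = 0) := by
    intro l
    have hS2 : S ^ 2 ≠ 0 := by positivity
    rw [← mul_right_inj' hS2 (b := l 0 * l 1 * l 2 * l 3 - _ + _ - _), mul_zero]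
    generalize Real.cos θ / -S = X
    generalize 3 / S ^ 2 - 4 = Z
    have : ∀ Y : ℝ, S ^ 2 * (Y / S ^ 2) = Y := fun Y => by field_simp
    constructor
    · intro h
      rw [← h]; field_simp
    · intro h
      rw [← h]; field_simp
  simp only [hset]
end

section
/- Let θ̂ ∈ (π, 5π/4) and let c₁, c₂ : [0, 1] → ℝ be differentiable functions such that on [0, 1]: c₂ > 0, c₂' > 0, c₁' > 0, and (d/dt)(c₂(t)^{3/2}) ≥ −cos(θ̂)·c₁'(t). Suppose 0 ≤ t' < t ≤ 1 and μ ∈ ℝ⁴ satisfies: μ_i > 0 for every i; μ_i·μ_j > c₂(t)·csc²(θ̂) for every pair of distinct i ≠ j; and μ_i·μ_j·μ_k − c₂(t)·csc²(θ̂)·(μ_i+μ_j+μ_k) + 2c₁(t)·cot(θ̂)·csc²(θ̂) > 0 for every triple of distinct indices i, j, k. Then the same three conditions hold with t replaced by t': μ_i > 0 for every i; μ_i·μ_j > c₂(t')·csc²(θ̂) for all i ≠ j; and μ_i·μ_j·μ_k − c₂(t')·csc²(θ̂)·(μ_i+μ_j+μ_k) + 2c₁(t')·cot(θ̂)·csc²(θ̂)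 > 0 for all distinct triples. -/
/-- Under the Υ-cone constraints on the continuity path, the
C-subsolution cone `Υ₁(t)` of the four-dimensional dHYM continuity path shrinks as `t`
increases: for `0 ≤ t' < t ≤ 1` and `μ ∈ Υ₁(t)` one has `μ ∈ Υ₁(t')`. -/
theorem stmt_8 (θ : ℝ) (hθ : θ ∈ Set.Ioo Real.pi (5 * Real.pi / 4))
    (c₁ c₂ : ℝ → ℝ)
    (hdiff : ∀ t ∈ Set.Icc (0 : ℝ) 1, DifferentiableAt ℝ c₁ t ∧ DifferentiableAt ℝ c₂ t)
    (hc₂pos : ∀ t ∈ Set.Icc (0 : ℝ) 1, 0 < c₂ t)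
    (hc₂' : ∀ t ∈ Set.Icc (0 : ℝ) 1, 0 < deriv c₂ t)
    (hc₁' : ∀ t ∈ Set.Icc (0 : ℝ) 1, 0 < deriv c₁ t)
    (hmix : ∀ t ∈ Set.Icc (0 : ℝ) 1,
      -Real.cos θ * deriv c₁ t ≤ deriv (fun s => c₂ s ^ ((3 : ℝ) / 2)) t)
    (t' t : ℝ) (ht'0 : 0 ≤ t') (ht't : t' < t) (ht1 : t ≤ 1)
    (μ : Fin 4 → ℝ)
    (hpos : ∀ i, 0 < μ i)
    (hpair : ∀ i j, i ≠ j → c₂ t / Real.sin θ ^ 2 < μ i * μ j)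
    (htriple : ∀ i j k, i ≠ j → i ≠ k → j ≠ k →
      0 < μ i * μ j * μ k - c₂ t / Real.sin θ ^ 2 * (μ i + μ j + μ k)
        + 2 * c₁ t * (Real.cos θ / Real.sin θ) / Real.sin θ ^ 2) :
    (∀ i, 0 < μ i) ∧
    (∀ i j, i ≠ j → c₂ t' / Real.sin θ ^ 2 < μ i * μ j) ∧
    ∀ i j k, i ≠ j → i ≠ k → j ≠ k →
      0 < μ i * μ j * μ k - c₂ t' / Real.sin θ ^ 2 * (μ i + μ j + μ k)
        + 2 * c₁ t' * (Real.cos θ / Real.sin θ) / Real.sin θ ^ 2 := by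
  obtain ⟨h1, h2⟩ := hθ
  have hpi := Real.pi_pos
  have hs : Real.sin θ < 0 := by
    have h := Real.sin_pos_of_pos_of_lt_pi (x := θ - Real.pi) (by linarith) (by linarith)
    rw [Real.sin_sub_pi] at h
    linarith
  have hpw : ∀ u ∈ Set.Icc (0 : ℝ) 1,
      DifferentiableAt ℝ (fun s => c₂ s ^ ((3 : ℝ) / 2)) u := fun u hu =>
    (hdiff u hu).2.rpow_const (Or.inl (hc₂pos u hu).ne')
  have hsub : interior (Set.Icc (0 : ℝ) 1) ⊆ Set.Icc (0 : ℝ) 1 := interior_subset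
  have m2 : StrictMonoOn c₂ (Set.Icc 0 1) := by
    apply strictMonoOn_of_deriv_pos (convex_Icc 0 1)
    · exact fun u hu => (hdiff u hu).2.continuousAt.continuousWithinAt
    · exact fun u hu => hc₂' u (hsub hu)
  have hgd : ∀ u ∈ Set.Icc (0 : ℝ) 1, HasDerivAt
      (fun s => c₂ s ^ ((3 : ℝ) / 2) + Real.cos θ * c₁ s)
      (deriv (fun s => c₂ s ^ ((3 : ℝ) / 2)) u + Real.cos θ * deriv c₁ u) u := fun u hu =>
    (hpw u hu).hasDerivAt.add ((hdiff u hu).1.hasDerivAt.const_mul _)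
  have mg : MonotoneOn (fun s => c₂ s ^ ((3 : ℝ) / 2) + Real.cos θ * c₁ s) (Set.Icc 0 1) := by
    apply monotoneOn_of_deriv_nonneg (convex_Icc 0 1)
    · exact fun u hu => (hgd u hu).continuousAt.continuousWithinAt
    · exact fun u hu => (hgd u (hsub hu)).differentiableAt.differentiableWithinAt
    · intro u hu
      rw [(hgd u (hsub hu)).deriv]
      have := hmix u (hsub hu)
      linarith
  have ht' : t' ∈ Set.Icc (0 : ℝ) 1 := ⟨ht'0, by linarith⟩
  have ht : t ∈ Set.Icc (0 : ℝ) 1 := ⟨by linarith, ht1⟩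
  have hlt := m2 ht' ht ht't
  have hg := mg ht' ht ht't.le
  have ha := hc₂pos t ht
  have hb := hc₂pos t' ht'
  have key : ∀ a : ℝ, 0 < a → ∃ x, 0 < x ∧ a = x ^ 2 ∧ a ^ ((3 : ℝ) / 2) = x ^ 3 := by
    intro a ha
    refine ⟨√a, Real.sqrt_pos.2 ha, (Real.sq_sqrt ha.le).symm, ?_⟩
    rw [Real.sqrt_eq_rpow, ← Real.rpow_natCast, ← Real.rpow_mul ha.le]
    norm_num
  obtain ⟨x, hx, hax, hax3⟩ := key _ ha
  obtain ⟨y, hy, hby, hby3⟩ := key _ hb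
  simp only [hax3, hby3] at hg
  rw [hax] at hpair htriple hlt
  rw [hby] at hlt ⊢
  obtain ⟨s, hsdef⟩ : ∃ s, s = -Real.sin θ := ⟨_, rfl⟩
  have hs0 : 0 < s := by linarith
  have hsin : Real.sin θ = -s := by linarith
  rw [hsin] at hpair htriple ⊢
  have hs2 : (-s) ^ 2 = s ^ 2 := by ring
  rw [hs2] at hpair htriple ⊢
  refine ⟨hpos, ?_, ?_⟩
  · intro i j hij
    refine lt_trans ?_ (hpair i j hij)
    gcongr
  · intro i j k hij hik hjk
    have p1 := hpair i j hij
    have p2 := hpair i k hik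
    have p3 := hpair j k hjk
    have h3 := htriple i j k hij hik hjk
    have hi := hpos i
    have hj := hpos j
    have hk := hpos k
    have hS : 3 * (x / s) ≤ μ i + μ j + μ k := by
      refine abs_le_of_sq_le_sq' ?_ (by positivity) |>.2
      rw [← div_pow] at p1 p2 p3
      nlinarith [sq_nonneg (μ i - μ j), sq_nonneg (μ i - μ k), sq_nonneg (μ j - μ k)]
    refine lt_of_lt_of_le h3 ?_
    have e : (y ^ 2 - x ^ 2) / s ^ 2 * (μ i + μ j + μ k) ≤
        (y ^ 2 - x ^ 2) / s ^ 2 * (3 * (x / s)) :=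
      mul_le_mul_of_nonpos_left hS (div_nonpos_of_nonpos_of_nonneg (by linarith) (by positivity))
    have f : (y ^ 2 - x ^ 2) / s ^ 2 * (3 * (x / s))
        - (2 * c₁ t' * (Real.cos θ / -s) / s ^ 2 - 2 * c₁ t * (Real.cos θ / -s) / s ^ 2)
        = (3 * (y ^ 2 - x ^ 2) * x + 2 * (Real.cos θ * c₁ t' - Real.cos θ * c₁ t)) / s ^ 3 := by
      field_simp
      ring
    have g : (3 * (y ^ 2 - x ^ 2) * x + 2 * (Real.cos θ * c₁ t' - Real.cos θ * c₁ t)) / s ^ 3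
        ≤ 0 := by
      apply div_nonpos_of_nonpos_of_nonneg _ (by positivity)
      have : 0 ≤ (x - y) ^ 2 * (x + 2 * y) := by positivity
      nlinarith
    have e2 : (y ^ 2 - x ^ 2) / s ^ 2 * (μ i + μ j + μ k) =
      y ^ 2 / s ^ 2 * (μ i + μ j + μ k) - x ^ 2 / s ^ 2 * (μ i + μ j + μ k) := by ring
    linarith
end

section
/- Let θ̂ ∈ (π/2, 5π/6) and let c₁ > 0, c₀ ≥ 0, h > 0 be real numbers with c₁³·cot²(θ̂) > h·c₀². If λ ∈ ℝ³ satisfies λ_i > 0 for every i and λ_i·λ_j > c₁/h for every pair of distinct indices i ≠ j, then for each i ∈ {1, 2, 3}, writing {j, k} = {1, 2, 3} \ {i}, one has c₁·(λ_j + λ_k) + 2c₀·tan(θ̂) > 0. -/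
/-- Ellipticity of the 3-dimensional continuity-path operator on
the cone `Υ³_{2;1,0,−c₁/h} ∩ Υ³_{1;1,0}`: for `θ̂ ∈ (π/2, 5π/6)`, `c₁ > 0`, `c₀ ≥ 0`,
`h > 0` with `c₁³ cot²(θ̂) > h c₀²`, if `λ_i > 0` for all `i` and `λ_i λ_j > c₁/h` for
all `i ≠ j`, then `c₁ (λ_j + λ_k) + 2 c₀ tan θ̂ > 0` for all `j ≠ k`. -/
theorem stmt_9 (θ : ℝ) (hθ : θ ∈ Set.Ioo (Real.pi / 2) (5 * Real.pi / 6))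
    (c₁ c₀ h : ℝ) (hc₁ : 0 < c₁) (hc₀ : 0 ≤ c₀) (hh : 0 < h)
    (hcon : h * c₀ ^ 2 < c₁ ^ 3 * (Real.cos θ / Real.sin θ) ^ 2)
    (l : Fin 3 → ℝ) (hpos : ∀ i, 0 < l i)
    (hpair : ∀ i j, i ≠ j → c₁ / h < l i * l j) :
    ∀ j k, j ≠ k → 0 < c₁ * (l j + l k) + 2 * c₀ * Real.tan θ := by
  intro j k hjk
  obtain ⟨h1, h2⟩ := hθ
  have hpi := Real.pi_pos
  have hcos : Real.cos θ < 0 :=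
    Real.cos_neg_of_pi_div_two_lt_of_lt h1 (by linarith)
  have hsin : 0 < Real.sin θ := Real.sin_pos_of_pos_of_lt_pi (by linarith) (by linarith)
  have ht : (Real.cos θ / Real.sin θ) * Real.tan θ = 1 := by
    rw [Real.tan_eq_sin_div_cos]
    have := hcos.ne
    have := hsin.ne'
    field_simp
  have htne : Real.tan θ ≠ 0 := right_ne_zero_of_mul_eq_one ht
  have ht2 : 0 < Real.tan θ ^ 2 := by positivity
  have key : h * c₀ ^ 2 * Real.tan θ ^ 2 < c₁ ^ 3 := by
    calc h * c₀ ^ 2 * Real.tan θ ^ 2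
        < c₁ ^ 3 * (Real.cos θ / Real.sin θ) ^ 2 * Real.tan θ ^ 2 :=
          mul_lt_mul_of_pos_right hcon ht2
      _ = c₁ ^ 3 * ((Real.cos θ / Real.sin θ) * Real.tan θ) ^ 2 := by ring
      _ = c₁ ^ 3 := by rw [ht]; ring
  have hp := hpair j k hjk
  rw [div_lt_iff₀ hh] at hp
  have hj := hpos j
  have hk := hpos k
  have h3 : c₁ ^ 2 * c₁ < c₁ ^ 2 * (l j * l k * h) :=
    mul_lt_mul_of_pos_left hp (by positivity)
  have h4 : c₀ ^ 2 * Real.tan θ ^ 2 < c₁ ^ 2 * (l j * l k) := by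
    refine lt_of_mul_lt_mul_left (a := h) ?_ hh.le
    linarith
  have h5 : (2 * c₀ * Real.tan θ) ^ 2 < (c₁ * (l j + l k)) ^ 2 := by
    nlinarith [sq_nonneg (c₁ * (l j - l k))]
  have h6 := abs_lt_of_sq_lt_sq h5 (by positivity)
  linarith [(abs_lt.mp h6).1]
end

section
/- Let θ̂ ∈ (π/2, 5π/6) and let c₁ > 0, c₀ ≥ 0, h > 0 be real numbers with c₁³·cot²(θ̂) > h·c₀². Define f : {λ ∈ ℝ³ : λ₁λ₂λ₃ ≠ 0} → ℝ by f(λ) = (c₁·(λ₁+λ₂+λ₃) + 2c₀·tan(θ̂))/(λ₁λ₂λ₃). Suppose λ ∈ ℝ³ satisfies: λ_i > 0 for every i, λ_i·λ_j > c₁/h for every pair of distinct indices i ≠ j, and f(λ) = h. Then for every V ∈ ℝ³ orthogonal to the gradient of f at λ (that is, Σ_i (∂f/∂λ_i)(λ)·V_i = 0), the Hessian quadratic form of f at λ is nonnegative on V: Σ_{i,j} (∂²f/∂λ_i∂λ_j)(λ)·V_i·V_j ≥ 0. -/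
lemma disc_aux (x y z K : ℝ) (hx : 0 < x) (hy : 1 ≤ y) (hz : 1 ≤ z) (hyz : 1 < y * z)
    (hc0 : 0 ≤ K) (hc : K < 1) (h : x + y + z - x * y * z = 2 * K) :
    0 ≤ (x - K) * (y - K) + (x - K) * (z - K) + (y - K) * (z - K) := by
  have hp : 0 ≤ y - K := by linarith
  have hq : 0 ≤ z - K := by linarith
  have key : ((x - K) * (y - K) + (x - K) * (z - K) + (y - K) * (z - K)) * (y * z - 1)
      = (1 - K^2) * ((y-K)^2 + (z-K)^2 + (y-K)*(z-K) + K * ((y-K)+(z-K)))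
        + ((y-K)*(z-K))^2 := by
    linear_combination (-(y + z - 2 * K)) * h
  have h1 : 0 ≤ 1 - K^2 := by nlinarith
  have : 0 ≤ ((x - K) * (y - K) + (x - K) * (z - K) + (y - K) * (z - K)) * (y * z - 1) := by
    rw [key]; positivity
  exact nonneg_of_mul_nonneg_left this (by linarith)

lemma disc_all (x y z K : ℝ) (hx : 0 < x) (hy : 0 < y) (hz : 0 < z) (hxy : 1 < x * y)
    (hxz : 1 < x * z) (hyz : 1 < y * z)
    (hc0 : 0 ≤ K) (hc : K < 1) (h : x + y + z - x * y * z = 2 * K) :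
    0 ≤ (x - K) * (y - K) + (x - K) * (z - K) + (y - K) * (z - K) := by
  rcases le_or_gt 1 y with h1 | h1
  · rcases le_or_gt 1 z with h2 | h2
    · exact disc_aux x y z K hx h1 h2 hyz hc0 hc h
    · have := disc_aux z x y K hz (by nlinarith) h1 hxy hc0 hc (by linarith)
      linarith
  · have := disc_aux y x z K hy (by nlinarith) (by nlinarith) hxz hc0 hc (by linarith)
    linarith

lemma quad_aux (x y z K a b c : ℝ) (hx : 0 < x) (hy : 0 < y) (hz : 0 < z) (hxy : 1 < x * y)
    (hxz : 1 < x * z) (hyz : 1 < y * z)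
    (hc0 : 0 ≤ K) (hc : K < 1) (h : x + y + z - x * y * z = 2 * K)
    (hl : (y * z - 1) * a + (x * z - 1) * b + (x * y - 1) * c = 0) :
    z * a * b + y * a * c + x * b * c ≤ 0 := by
  have hd := disc_all x y z K hx hy hz hxy hxz hyz hc0 hc h
  obtain ⟨A, rfl⟩ : ∃ A, a = x * A := ⟨a / x, by field_simp⟩
  obtain ⟨B, rfl⟩ : ∃ B, b = y * B := ⟨b / y, by field_simp⟩
  obtain ⟨C, rfl⟩ : ∃ C, c = z * C := ⟨c / z, by field_simp⟩
  set p := x * (y * z - 1) with hp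
  set q := y * (x * z - 1) with hq
  set r := z * (x * y - 1) with hr
  have p0 : 0 < p := mul_pos hx (by linarith)
  have q0 : 0 < q := mul_pos hy (by linarith)
  have r0 : 0 < r := mul_pos hz (by linarith)
  have hl' : p * A + q * B + r * C = 0 := by rw [hp, hq, hr]; linarith
  have hD : 0 ≤ (p+q+r)^2 - 2*(p^2+q^2+r^2) := by
    have hK : K = (x + y + z - x * y * z) / 2 := by linarith
    have : (p+q+r)^2 - 2*(p^2+q^2+r^2)
      = 4 * ((x - K) * (y - K) + (x - K) * (z - K) + (y - K) * (z - K)) := by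
      rw [hp, hq, hr, hK]; ring
    rw [this]; linarith
  have e : 4 * p * r * (A*B + A*C + B*C)
      = -((2*p*A + (p+q-r)*B)^2 + ((p+q+r)^2 - 2*(p^2+q^2+r^2)) * B^2) := by
    linear_combination (4 * p * (A + B)) * hl'
  have : A*B + A*C + B*C ≤ 0 := by
    by_contra hcon
    push Not at hcon
    have h1 : 0 < 4 * p * r * (A*B + A*C + B*C) := by positivity
    have h2 : 0 ≤ (2*p*A + (p+q-r)*B)^2 + ((p+q+r)^2 - 2*(p^2+q^2+r^2)) * B^2 := by positivity
    linarith
  have h3 : 0 < x * y * z := by positivity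
  nlinarith

lemma quad_scaled (c₁ h x y z T a b c : ℝ) (hc₁ : 0 < c₁) (hh : 0 < h)
    (hx : 0 < x) (hy : 0 < y) (hz : 0 < z) (hxy : c₁ / h < x * y)
    (hxz : c₁ / h < x * z) (hyz : c₁ / h < y * z)
    (hT0 : 0 ≤ T) (hT : h * T ^ 2 < c₁ ^ 3)
    (he : c₁ * (x + y + z) - 2 * T = h * (x * y * z))
    (hl : c₁ * (a + b + c) = h * (y * z * a + x * z * b + x * y * c)) :
    z * a * b + y * a * c + x * b * c ≤ 0 := by
  obtain ⟨s, s0, hs⟩ : ∃ s : ℝ, 0 < s ∧ s ^ 2 = c₁ / h :=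
    ⟨√(c₁ / h), by positivity, Real.sq_sqrt (by positivity)⟩
  have hc : c₁ = h * s ^ 2 := by rw [hs]; field_simp
  rw [← hs] at hxy hxz hyz
  subst hc
  obtain ⟨X, rfl⟩ : ∃ A, x = s * A := ⟨x / s, by field_simp⟩
  obtain ⟨Y, rfl⟩ : ∃ A, y = s * A := ⟨y / s, by field_simp⟩
  obtain ⟨Z, rfl⟩ : ∃ A, z = s * A := ⟨z / s, by field_simp⟩
  obtain ⟨K, rfl⟩ : ∃ A, T = (h * s ^ 3) * A := ⟨T / (h * s^3), by field_simp⟩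
  have hm : 0 < h * s ^ 3 := by positivity
  have s2 : 0 < s ^ 2 := by positivity
  have hK : K < 1 := by
    by_contra hcon
    push Not at hcon
    have : 0 < h ^ 3 * s ^ 6 := by positivity
    have : 1 ≤ K ^ 2 := by nlinarith
    nlinarith
  have aux : ∀ u v : ℝ, s ^ 2 < s * u * (s * v) → 1 < u * v := by
    intro u v huv
    by_contra hcon
    nlinarith
  have := quad_aux X Y Z K a b c (pos_of_mul_pos_right hx s0.le)
    (pos_of_mul_pos_right hy s0.le) (pos_of_mul_pos_right hz s0.le)
    (aux _ _ hxy) (aux _ _ hxz) (aux _ _ hyz)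
    (nonneg_of_mul_nonneg_right hT0 hm) hK
    (by apply mul_left_cancel₀ hm.ne'; linarith)
    (by apply mul_left_cancel₀ (mul_pos hh s2).ne'; linarith)
  nlinarith

lemma second_deriv_aux (c₁ d : ℝ) (f : (Fin 3 → ℝ) → ℝ)
    (hf : f = fun l => (c₁ * (l 0 + l 1 + l 2) + d) / (l 0 * l 1 * l 2))
    (l : Fin 3 → ℝ) (hpos : ∀ i, 0 < l i) (V : Fin 3 → ℝ) :
    fderiv ℝ f l V * (l 0 * l 1 * l 2)
      + f l * (l 1 * l 2 * V 0 + l 0 * l 2 * V 1 + l 0 * l 1 * V 2) = c₁ * (V 0 + V 1 + V 2) ∧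
    fderiv ℝ (fderiv ℝ f) l V V * (l 0 * l 1 * l 2)
      + 2 * fderiv ℝ f l V * (l 1 * l 2 * V 0 + l 0 * l 2 * V 1 + l 0 * l 1 * V 2)
      + 2 * f l * (l 2 * V 0 * V 1 + l 1 * V 0 * V 2 + l 0 * V 1 * V 2) = 0 := by
  have hsm : ∀ m : Fin 3 → ℝ, (∀ i, 0 < m i) → ContDiffAt ℝ 2 f m := by
    intro m hm
    rw [hf]
    have h0 := hm 0
    have h1 := hm 1
    have h2 := hm 2
    refine ContDiffAt.div ?_ ?_ (by positivity)
    · fun_prop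
    · fun_prop
  have hco : ∀ (i : Fin 3) (m : Fin 3 → ℝ),
      HasFDerivAt (fun m : Fin 3 → ℝ => m i) (ContinuousLinearMap.proj (R := ℝ) i) m :=
    fun i m => (ContinuousLinearMap.proj (R := ℝ) (φ := fun _ : Fin 3 => ℝ) i).hasFDerivAt
  have hev : ∀ m : Fin 3 → ℝ, (∀ i, 0 < m i) → ∀ᶠ w in nhds m, ∀ i, 0 < w i := by
    intro m hm
    rw [Filter.eventually_all]
    intro i
    exact (continuous_apply i).continuousAt.eventually (lt_mem_nhds (hm i))
  have first : ∀ m : Fin 3 → ℝ, (∀ i, 0 < m i) →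
      fderiv ℝ f m V * (m 0 * m 1 * m 2)
      + f m * (m 1 * m 2 * V 0 + m 0 * m 2 * V 1 + m 0 * m 1 * V 2) = c₁ * (V 0 + V 1 + V 2) := by
    intro m hm
    have hd : HasFDerivAt f (fderiv ℝ f m) m :=
      ((hsm m hm).differentiableAt (by norm_num)).hasFDerivAt
    have hA := hd.mul (((hco 0 m).mul (hco 1 m)).mul (hco 2 m))
    have hB := ((((hco 0 m).add (hco 1 m)).add (hco 2 m)).const_mul c₁).add_const d
    have hE := hA.congr_of_eventuallyEq (f₁ := fun m => c₁ * (m 0 + m 1 + m 2) + d) (by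
      filter_upwards [hev m hm] with w hw
      have h0 := hw 0
      have h1 := hw 1
      have h2 := hw 2
      simp only [hf, Pi.mul_apply]
      field_simp)
    have := DFunLike.congr_fun (hE.unique hB) V
    simp at this
    linarith
  refine ⟨first l hpos, ?_⟩
  have hd : HasFDerivAt f (fderiv ℝ f l) l :=
    ((hsm l hpos).differentiableAt (by norm_num)).hasFDerivAt
  have hdd : HasFDerivAt (fderiv ℝ f) (fderiv ℝ (fderiv ℝ f) l) l :=
    (((hsm l hpos).fderiv_right (m := 1) (by norm_num)).differentiableAt (by norm_num)).hasFDerivAt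
  have hddV := hdd.clm_apply (hasFDerivAt_const V l)
  have hA := hddV.mul (((hco 0 l).mul (hco 1 l)).mul (hco 2 l))
  have hB := hd.mul (((((hco 1 l).mul (hco 2 l)).mul_const (V 0)).add
    (((hco 0 l).mul (hco 2 l)).mul_const (V 1))).add (((hco 0 l).mul (hco 1 l)).mul_const (V 2)))
  have hE := (hA.add hB).congr_of_eventuallyEq (f₁ := fun _ => c₁ * (V 0 + V 1 + V 2)) (by
      filter_upwards [hev l hpos] with w hw
      have := first w hw
      simp only [Pi.mul_apply, Pi.add_apply]
      linarith)
  have := DFunLike.congr_fun (hE.unique (hasFDerivAt_const _ l)) V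
  simp at this
  linarith

/-- Convexity of the level set `{f = h}` of the 3-dimensional dHYM
continuity-path operator inside the cone `Υ³_{2;1,0,−c₁/h} ∩ Υ³_{1;1,0}`: at a point `λ`
of the level set, the Hessian quadratic form of `f` is nonnegative on vectors `V`
orthogonal to the gradient of `f` at `λ`. -/
theorem stmt_10 (θ : ℝ) (hθ : θ ∈ Set.Ioo (Real.pi / 2) (5 * Real.pi / 6))
    (c₁ c₀ h : ℝ) (hc₁ : 0 < c₁) (hc₀ : 0 ≤ c₀) (hh : 0 < h)
    (hcon : h * c₀ ^ 2 < c₁ ^ 3 * (Real.cos θ / Real.sin θ) ^ 2)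
    (f : (Fin 3 → ℝ) → ℝ)
    (hf : f = fun l => (c₁ * (l 0 + l 1 + l 2) + 2 * c₀ * Real.tan θ) / (l 0 * l 1 * l 2))
    (l : Fin 3 → ℝ) (hpos : ∀ i, 0 < l i)
    (hpair : ∀ i j, i ≠ j → c₁ / h < l i * l j)
    (hsol : f l = h)
    (V : Fin 3 → ℝ) (hV : fderiv ℝ f l V = 0) :
    0 ≤ fderiv ℝ (fderiv ℝ f) l V V := by
  obtain ⟨e1, e2⟩ := second_deriv_aux c₁ (2 * c₀ * Real.tan θ) f hf l hpos V
  have h0 := hpos 0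
  have h1 := hpos 1
  have h2 := hpos 2
  have hP : 0 < l 0 * l 1 * l 2 := by positivity
  rw [hV, hsol] at e1 e2
  have hpi := Real.pi_pos
  have hs : 0 < Real.sin θ := Real.sin_pos_of_pos_of_lt_pi (by linarith [hθ.1]) (by linarith [hθ.2])
  have hcs : Real.cos θ < 0 :=
    Real.cos_neg_of_pi_div_two_lt_of_lt hθ.1 (by linarith [hθ.2])
  have ht : Real.tan θ < 0 := by rw [Real.tan_eq_sin_div_cos]; exact div_neg_of_pos_of_neg hs hcs
  have htc : (Real.cos θ / Real.sin θ) ^ 2 * Real.tan θ ^ 2 = 1 := by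
    rw [Real.tan_eq_sin_div_cos]
    have := hcs.ne
    field_simp
  have hT : h * (-(c₀ * Real.tan θ)) ^ 2 < c₁ ^ 3 := by
    have := mul_lt_mul_of_pos_right hcon (pow_pos (neg_pos.2 ht) 2)
    calc _ = h * c₀ ^ 2 * (-Real.tan θ) ^ 2 := by ring
      _ < _ := this
      _ = c₁ ^ 3 * ((Real.cos θ / Real.sin θ) ^ 2 * Real.tan θ ^ 2) := by ring
      _ = _ := by rw [htc, mul_one]
  have hsol' : c₁ * (l 0 + l 1 + l 2) + 2 * c₀ * Real.tan θ = h * (l 0 * l 1 * l 2) := by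
    rw [hf] at hsol
    exact (div_eq_iff hP.ne').1 hsol
  have q := quad_scaled c₁ h (l 0) (l 1) (l 2) (-(c₀ * Real.tan θ)) (V 0) (V 1) (V 2) hc₁ hh
    h0 h1 h2 (hpair 0 1 (by decide)) (hpair 0 2 (by decide)) (hpair 1 2 (by decide))
    (by nlinarith) hT (by linarith) (by linarith)
  refine nonneg_of_mul_nonneg_left (b := l 0 * l 1 * l 2) ?_ hP
  nlinarith
end

section
/- Let θ̂ ∈ (π/2, 5π/6) and let c₀ ≥ 0, h > 0 and 0 < c₁ ≤ 1 be real numbers with c₁³·cot²(θ̂) > h·c₀². Then there exists N > 0 such that for every λ ∈ ℝ³ with λ₁ ≥ λ₂ ≥ λ₃ > 0, λ_i·λ_j > c₁/h for every pair of distinct indices i ≠ j, (c₁·(λ₁+λ₂+λ₃) + 2c₀·tan(θ̂))/(λ₁λ₂λ₃) = h, and λ₁ > N, one has (c₁·(λ₁+λ₃) + 2c₀·tan(θ̂))/(λ₁·λ₂²·λ₃) + (c₁·(λ₁+λ₂) + 2c₀·tan(θ̂))/(λ₁·λ₂·λ₃²) > h^{3/2}/5. -/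
/-- For `θ̂ ∈ (π/2, 5π/6)`, `c₀ ≥ 0`, `h > 0`, `0 < c₁ ≤ 1` with
`c₁³ cot²(θ̂) > h c₀²`, there is `N > 0` such that any ordered solution
`λ₁ ≥ λ₂ ≥ λ₃ > 0` of the continuity-path equation with pairwise products `> c₁/h`
and `λ₁ > N` satisfies `−f₂ − f₃ > h^{3/2}/5`. -/
theorem stmt_11 (θ : ℝ) (hθ : θ ∈ Set.Ioo (Real.pi / 2) (5 * Real.pi / 6))
    (c₀ h c₁ : ℝ) (hc₀ : 0 ≤ c₀) (hh : 0 < h) (hc₁ : 0 < c₁) (hc₁1 : c₁ ≤ 1)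
    (hcon : h * c₀ ^ 2 < c₁ ^ 3 * (Real.cos θ / Real.sin θ) ^ 2) :
    ∃ N > (0 : ℝ), ∀ l₁ l₂ l₃ : ℝ, l₂ ≤ l₁ → l₃ ≤ l₂ → 0 < l₃ →
      c₁ / h < l₁ * l₂ → c₁ / h < l₁ * l₃ → c₁ / h < l₂ * l₃ →
      (c₁ * (l₁ + l₂ + l₃) + 2 * c₀ * Real.tan θ) / (l₁ * l₂ * l₃) = h →
      N < l₁ →
      h ^ ((3 : ℝ) / 2) / 5 <
        (c₁ * (l₁ + l₃) + 2 * c₀ * Real.tan θ) / (l₁ * l₂ ^ 2 * l₃)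
          + (c₁ * (l₁ + l₂) + 2 * c₀ * Real.tan θ) / (l₁ * l₂ * l₃ ^ 2) := by
  have hT : Real.tan θ ≤ 0 := by
    have h1 : Real.pi / 2 < θ := hθ.1
    have h2 : θ < 5 * Real.pi / 6 := hθ.2
    have hpi := Real.pi_pos
    rw [Real.tan_eq_sin_div_cos]
    exact div_nonpos_of_nonneg_of_nonpos
      (Real.sin_nonneg_of_nonneg_of_le_pi (by linarith) (by linarith))
      (Real.cos_nonpos_of_pi_div_two_le_of_le (by linarith) (by linarith))
  have hT2 : 2 * c₀ * Real.tan θ ≤ 0 := by nlinarith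
  generalize 2 * c₀ * Real.tan θ = T at *
  obtain ⟨s, hs, rfl⟩ : ∃ s : ℝ, 0 < s ∧ h = s ^ 2 :=
    ⟨√h, Real.sqrt_pos.2 hh, (Real.sq_sqrt hh.le).symm⟩
  refine ⟨4 / s, by positivity, ?_⟩
  intro a b c hba hcb hc _ _ hbc heq ha
  have hb : 0 < b := by linarith
  have ha0 : 0 < a := by linarith
  have hpow : (s ^ 2) ^ ((3 : ℝ) / 2) = s ^ 3 := by
    rw [← Real.rpow_natCast s 2, ← Real.rpow_mul hs.le, ← Real.rpow_natCast s 3]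
    norm_num
  rw [hpow]
  rw [div_eq_iff (by positivity)] at heq
  rw [div_lt_iff₀ hh] at hbc
  rw [div_lt_iff₀ hs] at ha
  have hp : 0 < b * c := by positivity
  have e1 : (c₁ * (a + c) + T) / (a * b ^ 2 * c) + (c₁ * (a + b) + T) / (a * b * c ^ 2)
      = (s ^ 2 * (b + c) - 2 * c₁ / a) / (b * c) := by
    have h1 : c₁ * (a + c) + T = s ^ 2 * (a * b * c) - c₁ * b := by linarith
    have h2 : c₁ * (a + b) + T = s ^ 2 * (a * b * c) - c₁ * c := by linarith
    rw [h1, h2]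
    field_simp
    ring
  rw [e1, lt_div_iff₀ hp]
  have h3 : s ^ 2 * (b * c) ≤ 3 * c₁ := by
    have : a * (s ^ 2 * (b * c)) ≤ a * (3 * c₁) := by nlinarith
    exact le_of_mul_le_mul_left this ha0
  have h4 : 2 * c₁ / a ≤ c₁ * s / 2 := by
    rw [div_le_iff₀ ha0]
    nlinarith
  have h5 : 7 / 10 * s * (b * c) ≤ b + c := by
    refine (pow_le_pow_iff_left₀ (by positivity) (by positivity) two_ne_zero).1 ?_
    nlinarith [sq_nonneg (b - c), mul_le_mul_of_nonneg_left (h3.trans (by linarith : 3 * c₁ ≤ 3)) hp.le]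
  have h6 : c₁ * s < b * c * s ^ 2 * s := mul_lt_mul_of_pos_right hbc hs
  have h7 := mul_le_mul_of_nonneg_left h5 hh.le
  nlinarith
end

section
/- Let θ̂ ∈ (π, 5π/4) and let c₂ > 0, c₁ ≥ 0, h > 0 and c₀ ∈ ℝ be real numbers with c₂³·tan²(θ̂) > h·c₁² and c₀·(3csc²(θ̂) − 4)·h + 24·c₂²·cos²(θ_h)·cos(2θ_h) > 0, where θ_h := (1/3)·arccos(−c₁·cot(θ̂)·h^{1/2}/c₂^{3/2}) (standard arccosine with values in [0, π]). Suppose λ ∈ ℝ⁴ satisfies: λ_i > 0 for every i; λ_i·λ_j > c₂/h for every pair of distinct i ≠ j; and λ_i·λ_j·λ_k − (c₂/h)·(λ_i+λ_j+λ_k) + 2c₁·cot(θ̂)/h > 0 for every triple of distinct indices i, j, k. Then for each i ∈ {1, 2, 3, 4}, writing (λ_j, λ_k, λ_l) for the triple obtained by omitting λ_i, one has c₂·(λ_jλ_k + λ_jλ_l + λ_kλ_l) − 2c₁·cot(θ̂)·(λ_j+λ_k+λ_l) + c₀·(3csc²(θ̂) − 4) > 0. -/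
theorem le_of_sq_le_sq_aux {a b : ℝ} (h : a ^ 2 ≤ b ^ 2) (hb : 0 ≤ b) : a ≤ b :=
  (le_abs_self a).trans (abs_le_of_sq_le_sq h hb)

theorem core_aux (x y z t q : ℝ) (hx : 0 < x) (hy : 0 < y) (hz : 0 < z) (ht : 1 < t)
    (hq : 2 * q = 3 * t - t ^ 3) (hq0 : 0 ≤ q) (hxy : 1 < x * y)
    (hxz : x ≤ z) (hyz : y ≤ z)
    (hc : 0 < x * y * z - (x + y + z) + 2 * q) :
    3 * t ^ 4 - 6 * t ^ 2 ≤ x * y + x * z + y * z - 2 * q * (x + y + z) := by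
  have hq1 : q ≤ 1 := by nlinarith [mul_nonneg (sq_nonneg (t - 1)) (by linarith : 0 ≤ t + 2)]
  have hF0 : 3 * t ^ 4 - 6 * t ^ 2 = 3 * t ^ 2 - 6 * q * t := by
    linear_combination (3 * t) * hq
  obtain ⟨s, hs0, hs⟩ : ∃ s, 0 ≤ s ∧ s ^ 2 = x * y :=
    ⟨Real.sqrt (x * y), Real.sqrt_nonneg _, Real.sq_sqrt (by positivity)⟩
  have hs1 : 1 < s := by nlinarith
  obtain ⟨p, hp⟩ : ∃ p, p = x + y := ⟨_, rfl⟩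
  have hp2 : 2 * s ≤ p := by
    refine le_of_sq_le_sq_aux ?_ (by rw [hp]; positivity)
    nlinarith [sq_nonneg (x - y)]
  have hzs : s ≤ z := by
    refine le_of_sq_le_sq_aux ?_ hz.le
    rw [hs]; nlinarith
  have hc' : 0 < s ^ 2 * z - (p + z) + 2 * q := by rw [hs, hp]; linarith
  have goal' : 3 * t ^ 4 - 6 * t ^ 2 ≤ s ^ 2 + p * z - 2 * q * (p + z) → 
    3 * t ^ 4 - 6 * t ^ 2 ≤ x * y + x * z + y * z - 2 * q * (x + y + z) := by
    intro h; rw [hs, hp] at h; linarith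
  apply goal'
  have hr : 0 < s ^ 2 - 1 := by nlinarith
  have hpq : 0 ≤ p - 2 * q := by linarith
  -- reduction to the boundary of the constraint
  have key : ∀ p0, p0 ≤ p → 0 ≤ p0 + p - 4 * q - 2 * q * (s ^ 2 - 1) →
      0 ≤ (s ^ 2 - 2 * q * p0 - (3 * t ^ 4 - 6 * t ^ 2)) * (s ^ 2 - 1) + (p0 - 2 * q) ^ 2 →
      3 * t ^ 4 - 6 * t ^ 2 ≤ s ^ 2 + p * z - 2 * q * (p + z) := by
    intro p0 h0 h1 h2
    have h3 := mul_nonneg (sub_nonneg.2 h0) h1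
    have h4 : 0 ≤ (p - 2 * q) * (s ^ 2 * z - (p + z) + 2 * q) := mul_nonneg hpq hc'.le
    have h5 : 0 ≤ (s ^ 2 - 1) * (s ^ 2 + p * z - 2 * q * (p + z) - (3 * t ^ 4 - 6 * t ^ 2)) := by
      nlinarith
    have := nonneg_of_mul_nonneg_right h5 hr
    linarith
  rcases le_total s t with hst | hst
  · have h6 : 0 ≤ 2 * s - 2 * q - s * (s ^ 2 - 1) := by
      have : 2 * s - 2 * q - s * (s ^ 2 - 1) = (t - s) * (t ^ 2 + t * s + s ^ 2 - 3) := by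
        linear_combination -hq
      rw [this]
      apply mul_nonneg (by linarith)
      nlinarith
    have h7 : 0 ≤ (s - q) * (s ^ 2 - 1) := mul_nonneg (by linarith) hr.le
    apply key (2 * s) hp2 (by nlinarith)
    have ht3 : t ^ 2 ≤ 3 := by
      by_contra hcon
      push Not at hcon
      nlinarith
    have hb : 0 ≤ s ^ 2 + (2 * t ^ 3 - 4 * t) * s + (t ^ 4 - 3 * t ^ 2 + 3) := by
      have : s ^ 2 + (2 * t ^ 3 - 4 * t) * s + (t ^ 4 - 3 * t ^ 2 + 3)
        = (s + t ^ 3 - 2 * t) ^ 2 + (t ^ 2 - 1) ^ 2 * (3 - t ^ 2) := by ring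
      rw [this]
      have := mul_nonneg (sq_nonneg (t ^ 2 - 1)) (by linarith : 0 ≤ 3 - t ^ 2)
      positivity
    have hq' : q = (3 * t - t ^ 3) / 2 := by linarith
    have := mul_nonneg (sq_nonneg (s - t)) hb
    rw [hq']
    linarith
  · -- the value at `z = s`, `p = s ^ 3 - s + 2 q`
    have hA : 3 * t ^ 2 - 6 * q * t ≤ s ^ 4 - 2 * q * s ^ 3 + 2 * q * s - 4 * q ^ 2 := by
      have hT : t ^ 4 - 2 * q * t ^ 3 + 2 * q * t - 4 * q ^ 2 = 3 * t ^ 2 - 6 * q * t := by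
        have hq' : q = (3 * t - t ^ 3) / 2 := by linarith
        rw [hq']; ring
      rw [← hT]
      have h8 : 0 ≤ s ^ 3 + s ^ 2 * t + s * t ^ 2 + t ^ 3
          - 2 * q * (s ^ 2 + s * t + t ^ 2) + 2 * q := by
        obtain ⟨a, ha, rfl⟩ : ∃ a, 0 < a ∧ t = 1 + a := ⟨t - 1, by linarith, by ring⟩
        obtain ⟨b, hb, rfl⟩ : ∃ b, 0 ≤ b ∧ s = 1 + a + b := ⟨s - (1 + a), by linarith, by ring⟩
        have hm : 0 ≤ (1 - q) * ((1+a+b)^2 + (1+a+b)*(1+a) + (1+a)^2 - 1) := by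
          apply mul_nonneg (by linarith); ring_nf; positivity
        have hn : 0 ≤ (1+a+b)^3 + (1+a+b)^2*(1+a) + (1+a+b)*(1+a)^2 + (1+a)^3
          - 2 * ((1+a+b)^2 + (1+a+b)*(1+a) + (1+a)^2 - 1) := by
          ring_nf; positivity
        nlinarith
      have := mul_nonneg (sub_nonneg.2 hst) h8
      linarith
    rcases le_total (s ^ 3 - s + 2 * q) p with hpp | hpp
    · apply key _ hpp
      · have h7 : 0 ≤ (s - q) * (s ^ 2 - 1) := mul_nonneg (by linarith) hr.le
        nlinarith
      · have := mul_nonneg hr.le (sub_nonneg.2 hA)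
        rw [hF0]; linarith
    · have h9 : s ^ 2 + p * s - 2 * q * (p + s) ≤ s ^ 2 + p * z - 2 * q * (p + z) := by
        nlinarith [mul_nonneg (sub_nonneg.2 hzs) hpq]
      refine le_trans ?_ h9
      rw [hF0]
      rcases le_total (2 * q) s with h | h
      · have := mul_nonneg (sub_nonneg.2 h) (sub_nonneg.2 hp2)
        have := mul_nonneg (sub_nonneg.2 hst) (by linarith : 0 ≤ s + t - 2 * q)
        linarith
      · have := mul_nonneg (sub_nonneg.2 h) (sub_nonneg.2 hpp)
        linarith

theorem core_sym (x y z t q : ℝ) (hx : 0 < x) (hy : 0 < y) (hz : 0 < z) (ht : 1 < t)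
    (hq : 2 * q = 3 * t - t ^ 3) (hq0 : 0 ≤ q) (hxy : 1 < x * y) (hxz : 1 < x * z)
    (hyz : 1 < y * z) (hc : 0 < x * y * z - (x + y + z) + 2 * q) :
    3 * t ^ 4 - 6 * t ^ 2 ≤ x * y + x * z + y * z - 2 * q * (x + y + z) := by
  rcases le_total x y with h1 | h1 <;> rcases le_total x z with h2 | h2 <;>
    rcases le_total y z with h3 | h3
  · exact core_aux x y z t q hx hy hz ht hq hq0 hxy h2 h3 hc
  · have := core_aux x z y t q hx hz hy ht hq hq0 hxz h1 h3 (by linarith)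
    linarith
  · exact core_aux x y z t q hx hy hz ht hq hq0 hxy (h1.trans h3) h3 hc
  · have := core_aux x z y t q hx hz hy ht hq hq0 hxz h1 h3 (by linarith)
    linarith
  · exact core_aux x y z t q hx hy hz ht hq hq0 hxy h2 h3 hc
  · have := core_aux z y x t q hz hy hx ht hq hq0 (by linarith) (h3.trans h1) h1 (by linarith)
    linarith
  · have := core_aux z y x t q hz hy hx ht hq hq0 (by linarith) h2 h1 (by linarith)
    linarith
  · have := core_aux z y x t q hz hy hx ht hq hq0 (by linarith) h2 h1 (by linarith)
    linarith

/-- Ellipticity of the four-dimensional continuity-path operator on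
the cone `Υ⁴_{3;1,0,−c₂/h,2c₁cot θ̂/h} ∩ Υ⁴_{2;1,0,−c₂/h} ∩ Υ⁴_{1;1,0}`:
`−∂f/∂λ_i > 0`, i.e. for each `i`, with `(λ_j, λ_k, λ_l)` the triple omitting `λ_i`,
`c₂ σ₂ − 2c₁ cot(θ̂) σ₁ + c₀ (3 csc²(θ̂) − 4) > 0`. -/
theorem stmt_12 (θ : ℝ) (hθ : θ ∈ Set.Ioo Real.pi (5 * Real.pi / 4))
    (c₂ c₁ h c₀ : ℝ) (hc₂ : 0 < c₂) (hc₁ : 0 ≤ c₁) (hh : 0 < h)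
    (h1 : h * c₁ ^ 2 < c₂ ^ 3 * (Real.sin θ / Real.cos θ) ^ 2)
    (θh : ℝ)
    (hθh : θh = (1 / 3) * Real.arccos
      (-(c₁ * (Real.cos θ / Real.sin θ) * h ^ ((1 : ℝ) / 2)) / c₂ ^ ((3 : ℝ) / 2)))
    (h2 : 0 < c₀ * (3 / Real.sin θ ^ 2 - 4) * h
        + 24 * c₂ ^ 2 * Real.cos θh ^ 2 * Real.cos (2 * θh))
    (l : Fin 4 → ℝ) (hpos : ∀ i, 0 < l i)
    (hpair : ∀ i j, i ≠ j → c₂ / h < l i * l j)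
    (htriple : ∀ i j k, i ≠ j → i ≠ k → j ≠ k →
      0 < l i * l j * l k - c₂ / h * (l i + l j + l k)
        + 2 * c₁ * (Real.cos θ / Real.sin θ) / h) :
    ∀ j k m, j ≠ k → j ≠ m → k ≠ m →
      0 < c₂ * (l j * l k + l j * l m + l k * l m)
        - 2 * c₁ * (Real.cos θ / Real.sin θ) * (l j + l k + l m)
        + c₀ * (3 / Real.sin θ ^ 2 - 4) := by
  obtain ⟨hθ1, hθ2⟩ := hθ
  have hsin : Real.sin θ < 0 := by
    have : 0 < Real.sin (θ - Real.pi) :=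
      Real.sin_pos_of_pos_of_lt_pi (by linarith) (by linarith [Real.pi_pos])
    rw [Real.sin_sub_pi] at this; linarith
  have hcos : Real.cos θ < 0 := by
    have : 0 < Real.cos (θ - Real.pi) :=
      Real.cos_pos_of_mem_Ioo ⟨by linarith [Real.pi_pos], by linarith [Real.pi_pos]⟩
    rw [Real.cos_sub_pi] at this; linarith
  obtain ⟨k0, hk0⟩ : ∃ k0, k0 = Real.cos θ / Real.sin θ := ⟨_, rfl⟩
  have hkpos : 0 < k0 := hk0 ▸ div_pos_of_neg_of_neg hcos hsin
  have htan : Real.sin θ / Real.cos θ = k0⁻¹ := by rw [hk0, inv_div]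
  rw [htan] at h1
  rw [← hk0] at hθh htriple ⊢
  obtain ⟨a, ha, rfl⟩ : ∃ a, 0 < a ∧ c₂ = a ^ 2 :=
    ⟨Real.sqrt c₂, Real.sqrt_pos.2 hc₂, (Real.sq_sqrt hc₂.le).symm⟩
  obtain ⟨b, hb, rfl⟩ : ∃ b, 0 < b ∧ h = b ^ 2 :=
    ⟨Real.sqrt h, Real.sqrt_pos.2 hh, (Real.sq_sqrt hh.le).symm⟩
  have hbp : (b ^ 2) ^ ((1 : ℝ) / 2) = b := by
    rw [← Real.sqrt_eq_rpow, Real.sqrt_sq hb.le]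
  have hap : (a ^ 2) ^ ((3 : ℝ) / 2) = a ^ 3 := by
    rw [← Real.rpow_natCast a 2, ← Real.rpow_mul ha.le, ← Real.rpow_natCast a 3]
    norm_num
  rw [hbp, hap] at hθh
  obtain ⟨q, hqd⟩ : ∃ q, q = c₁ * k0 * b / a ^ 3 := ⟨_, rfl⟩
  have hq0 : 0 ≤ q := by rw [hqd]; positivity
  have hK : c₁ * k0 = q * a ^ 3 / b := by rw [hqd]; field_simp
  have hq1 : q < 1 := by
    rw [hqd, div_lt_one (by positivity)]
    apply lt_of_pow_lt_pow_left₀ 2 (by positivity)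
    rw [inv_pow, ← div_eq_mul_inv, lt_div_iff₀ (by positivity)] at h1
    nlinarith
  rw [neg_div, ← hqd] at hθh
  have h3c : Real.cos (3 * θh) = -q := by
    rw [hθh, ← mul_assoc]; norm_num
    exact Real.cos_arccos (by linarith) (by linarith)
  have hac : Real.arccos (-q) < Real.pi := by
    apply lt_of_le_of_ne (Real.arccos_le_pi _)
    intro h
    rw [Real.arccos_eq_pi] at h
    linarith
  have hac0 := Real.arccos_nonneg (-q)
  obtain ⟨t, htd⟩ : ∃ t, t = 2 * Real.cos θh := ⟨_, rfl⟩
  have ht1 : 1 < t := by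
    have : Real.cos (Real.pi / 3) < Real.cos θh := 
      Real.cos_lt_cos_of_nonneg_of_le_pi (by rw [hθh]; positivity)
        (by linarith [Real.pi_pos]) (by rw [hθh]; linarith)
    rw [Real.cos_pi_div_three] at this
    linarith
  have hcc : Real.cos θh = t / 2 := by linarith
  rw [Real.cos_three_mul, hcc] at h3c
  rw [Real.cos_two_mul, hcc] at h2
  have hq : 2 * q = 3 * t - t ^ 3 := by linarith
  intro j k m hjk hjm hkm
  obtain ⟨x, hx⟩ : ∃ x : Fin 4 → ℝ, ∀ i, l i = a / b * x i :=
    ⟨fun i => l i * b / a, fun i => by field_simp⟩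
  have hab : 0 < a / b := by positivity
  have hxpos : ∀ i, 0 < x i := fun i => by
    have := hpos i
    rw [hx] at this
    exact (pos_iff_pos_of_mul_pos this).1 hab
  have hxp : ∀ i j, i ≠ j → 1 < x i * x j := fun i j hij => by
    have := hpair i j hij
    rw [hx, hx] at this
    have h3 : 0 < (a / b) ^ 2 * (x i * x j - 1) := by
      have : a ^ 2 / b ^ 2 = (a / b) ^ 2 := by rw [div_pow]
      nlinarith
    have := (pos_iff_pos_of_mul_pos h3).1 (by positivity)
    linarith
  have hct : 0 < x j * x k * x m - (x j + x k + x m) + 2 * q := by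
    have := htriple j k m hjk hjm hkm
    rw [mul_assoc 2 c₁, hK, hx, hx, hx] at this
    have h3 : 0 < (a / b) ^ 3 * (x j * x k * x m - (x j + x k + x m) + 2 * q) := by
      convert this using 1
      field_simp
    exact (pos_iff_pos_of_mul_pos h3).1 (by positivity)
  have main := core_sym (x j) (x k) (x m) t q (hxpos j) (hxpos k) (hxpos m) ht1 hq hq0
    (hxp j k hjk) (hxp j m hjm) (hxp k m hkm) hct
  obtain ⟨C, hC⟩ : ∃ C, C = c₀ * (3 / Real.sin θ ^ 2 - 4) := ⟨_, rfl⟩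
  rw [← hC] at h2 ⊢
  have h5 : 0 < b ^ 2 * (a ^ 2 * (l j * l k + l j * l m + l k * l m)
        - 2 * c₁ * k0 * (l j + l k + l m) + C) := by
    have e : b ^ 2 * (a ^ 2 * (l j * l k + l j * l m + l k * l m)
        - 2 * c₁ * k0 * (l j + l k + l m) + C) = a ^ 4 * (x j * x k + x j * x m + x k * x m
          - 2 * q * (x j + x k + x m)) + C * b ^ 2 := by
      rw [mul_assoc 2 c₁, hK, hx, hx, hx]
      field_simp
    rw [e]
    have := mul_le_mul_of_nonneg_left main (by positivity : 0 ≤ a ^ 4)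
    linarith
  exact (pos_iff_pos_of_mul_pos h5).1 (by positivity)
end

section
/- Let θ̂ ∈ (π, 5π/4) and let c₂ > 0, c₁ ≥ 0, h > 0 and c₀ ∈ ℝ be real numbers with c₂³·tan²(θ̂) > h·c₁² and c₀·(3csc²(θ̂) − 4)·h + 24·c₂²·cos²(θ_h)·cos(2θ_h) > 0, where θ_h := (1/3)·arccos(−c₁·cot(θ̂)·h^{1/2}/c₂^{3/2}) (standard arccosine with values in [0, π]). Define f : {λ ∈ ℝ⁴ : λ₁λ₂λ₃λ₄ ≠ 0} → ℝ by f(λ) = (c₂·σ₂(λ) − 2c₁·cot(θ̂)·σ₁(λ) + c₀·(3csc²(θ̂) − 4))/(λ₁λ₂λ₃λ₄). Suppose λ ∈ ℝ⁴ satisfies: λ_i > 0 for every i; λ_i·λ_j > c₂/h for every pair of distinct i ≠ j; λ_i·λ_j·λ_k − (c₂/h)·(λ_i+λ_j+λ_k) + 2c₁·cot(θ̂)/h > 0 for every triple of distinct indices; and f(λ) = h. Then for every V ∈ ℝ⁴ with Σ_i (∂f/∂λ_i)(λ)·V_i = 0, the Hessian quadratic form of f at λ is nonnegative on V: Σ_{i,j}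 (∂²f/∂λ_i∂λ_j)(λ)·V_i·V_j ≥ 0. -/
/-- Abstract reduction step: second-order jets of `A a b - B (a+b) + C`. -/
lemma jet_reduction (A A1 A2 B B1 B2 C C1 C2 a a1 b b1 w w1 w2 p p1 p2 : ℝ)
    (hA : 0 < A) (hp : A * p = B) (hp1 : A1 * p + A * p1 = B1)
    (hp2 : A2 * p + 2 * A1 * p1 + A * p2 = B2) (hp2n : 0 ≤ p2) (hw2n : 0 ≤ w2)
    (hpw : p < w) (ha : p < a) (hb : p < b)
    (E0 : A * w ^ 2 - 2 * B * w + C = 0)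
    (E1 : A1 * w ^ 2 - 2 * B1 * w + C1 + 2 * (A * w - B) * w1 = 0)
    (E2 : A2 * w ^ 2 - 2 * B2 * w + C2 + 4 * A1 * w * w1 - 4 * B1 * w1 + 2 * A * w1 ^ 2
      + 2 * (A * w - B) * w2 = 0)
    (F0 : A * a * b - B * (a + b) + C = 0)
    (F1 : A1 * a * b + A * (a1 * b + a * b1) - B1 * (a + b) - B * (a1 + b1) + C1 = 0) :
    A2 * a * b + 2 * A1 * (a1 * b + a * b1) + 2 * A * a1 * b1 - B2 * (a + b)
      - 2 * B1 * (a1 + b1) + C2 ≤ 0 := by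
  have hA0 : A ≠ 0 := hA.ne'
  obtain ⟨X, rfl⟩ : ∃ X, a = p + X := ⟨a - p, by ring⟩
  obtain ⟨Z, rfl⟩ : ∃ Z, b = p + Z := ⟨b - p, by ring⟩
  obtain ⟨r, rfl⟩ : ∃ r, w = p + r := ⟨w - p, by ring⟩
  obtain ⟨X1, rfl⟩ : ∃ X, a1 = p1 + X := ⟨a1 - p1, by ring⟩
  obtain ⟨Z1, rfl⟩ : ∃ Z, b1 = p1 + Z := ⟨b1 - p1, by ring⟩
  obtain ⟨r1, rfl⟩ : ∃ r, w1 = p1 + r := ⟨w1 - p1, by ring⟩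
  obtain ⟨r2, rfl⟩ : ∃ r, w2 = p2 + r := ⟨w2 - p2, by ring⟩
  have hX : 0 < X := by linarith
  have hZ : 0 < Z := by linarith
  have hr : 0 < r := by linarith
  subst hp hp1 hp2
  have e0 : X * Z = r ^ 2 := by
    apply mul_left_cancel₀ hA0
    linear_combination F0 - E0
  have e1 : X1 * Z + X * Z1 = 2 * r * r1 := by
    apply mul_left_cancel₀ hA0
    linear_combination F1 - E1 - A1 * e0
  have e2 : X1 * Z1 ≤ r1 ^ 2 := by
    have h : (4 * r ^ 2) * (X1 * Z1) ≤ (4 * r ^ 2) * r1 ^ 2 := by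
      have h2 : (X1 * Z + X * Z1) ^ 2 = 4 * r ^ 2 * r1 ^ 2 := by rw [e1]; ring
      rw [← h2, ← e0]; nlinarith [sq_nonneg (X1 * Z - X * Z1)]
    exact le_of_mul_le_mul_left h (by positivity)
  have e3 : 2 * r ≤ X + Z := by
    apply le_of_sq_le_sq _ (by linarith)
    nlinarith [sq_nonneg (X - Z)]
  have e4 : -p2 * (X + Z) + 2 * X1 * Z1 - 2 * r1 ^ 2 - 2 * r * r2 ≤ 0 := by
    nlinarith [mul_nonneg hp2n (sub_nonneg.2 e3), mul_nonneg hr.le hw2n]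
  have e5 : A * (-p2 * (X + Z) + 2 * X1 * Z1 - 2 * r1 ^ 2 - 2 * r * r2) ≤ 0 :=
    mul_nonpos_of_nonneg_of_nonpos hA.le e4
  refine le_trans (le_of_eq ?_) e5
  linear_combination E2 + A2 * e0 + 2 * A1 * e1

/-- The one-variable inequality at the extremal parameter. -/
lemma T_end (k x t u P : ℝ) (hk : 0 < k) (hk2 : k ≤ 2) (hx : 0 < x) (hxk : x ^ 2 = 1 + k)
    (ht : 2 * t = x * (2 - k)) (hu : 0 ≤ u) (hP : 0 ≤ P) (hP2 : P ^ 2 = (k + u) ^ 2 + k ^ 3) :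
    2 * (k + u) ^ 3 + 4 * t * P ^ 3 - 6 * (k + u) * P ^ 2 - 2 * (k + u) ^ 4
      + (k + u) ^ 2 * P ^ 2 + P ^ 4 + 4 * (1 - t ^ 2) * ((k + u) ^ 2 - P ^ 2) ≤ 0 := by
  have h2k : 0 ≤ 2 - k := by linarith
  have ht2 : 4 * t ^ 2 = (1 + k) * (2 - k) ^ 2 := by
    rw [← hxk]; linear_combination (2 * t + x * (2 - k)) * ht
  have key : (4 * t * P ^ 3) ^ 2 ≤ (4 * u ^ 3 + 3 * k * (k + 2) * (2 - k) * u ^ 2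
      + 6 * (1 + k) * k ^ 2 * (2 - k) * u + 2 * (1 + k) ^ 2 * k ^ 3 * (2 - k)) ^ 2 := by
    have : (4 * t * P ^ 3) ^ 2 = 4 * (4 * t ^ 2) * (P ^ 2) ^ 3 := by ring
    rw [this, ht2, hP2]
    have pos : 0 ≤ 4 * k ^ 2 * (3 - k) * u ^ 6 + 24 * k ^ 3 * (2 - k) * u ^ 5
      + 3 * k ^ 4 * (2 - k) * (10 + k) * u ^ 4 + 12 * (1 + k) * k ^ 5 * (2 - k) * u ^ 3 := by
      have : 0 ≤ 3 - k := by linarith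
      positivity
    rw [← sub_nonneg]
    refine le_trans pos (le_of_eq ?_)
    ring
  have h3 := le_of_sq_le_sq key (by positivity)
  have hP4 : P ^ 4 = ((k + u) ^ 2 + k ^ 3) ^ 2 := by rw [← hP2]; ring
  rw [hP4, hP2]
  have : 4 * (1 - t ^ 2) = 4 - (1 + k) * (2 - k) ^ 2 := by linarith
  rw [this]
  nlinarith [h3]

lemma T_neg (k x t Q P : ℝ) (hk : 0 < k) (hk2 : k ≤ 2) (hx : 0 < x) (hxk : x ^ 2 = 1 + k)
    (ht : 2 * t = x * (2 - k)) (hQ : k ≤ Q) (hP : 0 ≤ P) (hP0 : P ^ 2 ≤ Q ^ 2 + k ^ 3)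
    (hP1 : 4 * (1 + Q) ≤ (P + 2 * t) ^ 2) :
    2 * Q ^ 3 + 4 * t * P ^ 3 - 6 * Q * P ^ 2 - 2 * Q ^ 4
      + Q ^ 2 * P ^ 2 + P ^ 4 + 4 * (1 - t ^ 2) * (Q ^ 2 - P ^ 2) ≤ 0 := by
  have ht0 : 0 ≤ t := by nlinarith [mul_nonneg hx.le (sub_nonneg.2 hk2)]
  have htx : t ≤ x := by nlinarith
  obtain ⟨M, hM0, hM⟩ : ∃ M, 0 ≤ M ∧ M ^ 2 = Q ^ 2 + k ^ 3 :=
    ⟨√(Q ^ 2 + k ^ 3), Real.sqrt_nonneg _, Real.sq_sqrt (by positivity)⟩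
  obtain ⟨b, hb0, hb⟩ : ∃ b, 0 ≤ b ∧ b ^ 2 = 1 + Q :=
    ⟨√(1 + Q), Real.sqrt_nonneg _, Real.sq_sqrt (by linarith)⟩
  have hbx : x ≤ b := le_of_sq_le_sq (by linarith) hb0
  have hPM : P ≤ M := le_of_sq_le_sq (by linarith) hM0
  have hbP : 2 * b - 2 * t ≤ P := by
    have : 2 * b ≤ P + 2 * t := le_of_sq_le_sq (by linarith) (by linarith)
    linarith
  obtain ⟨m, hm⟩ : ∃ m, m = 2 * b - 2 * t := ⟨_, rfl⟩
  have hm0 : 0 ≤ m := by linarith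
  rw [← hm] at hbP
  have TM := T_end k x t (Q - k) M hk hk2 hx hxk ht (by linarith) hM0 (by rw [hM]; ring)
  rw [show k + (Q - k) = Q by ring] at TM
  have Tm : 2 * Q ^ 3 + 4 * t * m ^ 3 - 6 * Q * m ^ 2 - 2 * Q ^ 4
      + Q ^ 2 * m ^ 2 + m ^ 4 + 4 * (1 - t ^ 2) * (Q ^ 2 - m ^ 2) ≤ 0 := by
    have : Q = b ^ 2 - 1 := by linarith
    subst this hm
    have h : 0 ≤ 2 * (b ^ 2 - 1) * (b * (b ^ 2 - 1) - 2 * b + 2 * t) ^ 2 := by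
      have : 0 ≤ b ^ 2 - 1 := by linarith
      positivity
    refine le_trans (le_of_eq ?_) (neg_nonpos.2 h)
    ring
  rcases eq_or_lt_of_le (le_trans hbP hPM) with h | h
  · have : P = m := by linarith
    rw [this]; exact Tm
  · have c1 : 0 ≤ (M - P) * (P - m) * (M - m) * (M * P + P * m + M * m) :=
      mul_nonneg (mul_nonneg (mul_nonneg (by linarith) (by linarith)) (by linarith))
        (by positivity)
    have c2 : 0 ≤ (M ^ 2 - P ^ 2) * (P ^ 2 - m ^ 2) * (M ^ 2 - m ^ 2) := by
      refine mul_nonneg (mul_nonneg ?_ ?_) ?_ <;> rw [sub_nonneg] <;> gcongr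
    have c3 : 0 < M ^ 2 - m ^ 2 := by nlinarith
    have d1 := mul_nonpos_of_nonneg_of_nonpos
      (show 0 ≤ P ^ 2 - m ^ 2 by rw [sub_nonneg]; gcongr) TM
    have d2 := mul_nonpos_of_nonneg_of_nonpos
      (show 0 ≤ M ^ 2 - P ^ 2 by rw [sub_nonneg]; gcongr) Tm
    have c1' := mul_nonneg ht0 c1
    refine nonpos_of_mul_nonpos_right ?_ c3
    refine le_trans (le_of_eq ?_) (add_nonpos (add_nonpos d1 d2)
      (add_nonpos (neg_nonpos.2 (mul_nonneg (by norm_num : (0:ℝ) ≤ 4) c1')) (neg_nonpos.2 c2)))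
    ring

lemma curve_bound (k x t d w L : ℝ) (hk : 0 < k) (hx : 0 < x) (hxk : x ^ 2 = 1 + k)
    (ht : 2 * t = x * (2 - k)) (hd : 6 * x ^ 2 - 3 * x ^ 4 < d) (hw : 1 < w)
    (hL : 2 * (w - t) < (w ^ 2 - 1) * L)
    (G0 : (w ^ 2 - 1) * L ^ 2 - 2 * (2 * (w - t)) * L + (-w ^ 2 + 4 * t * w - d) = 0) :
    k ≤ L * w - 1 := by
  by_contra hcon
  push Not at hcon
  obtain ⟨Y, rfl⟩ : ∃ Y, w = x + Y := ⟨w - x, by ring⟩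
  obtain ⟨a, rfl⟩ : ∃ a, L = x + a := ⟨L - x, by ring⟩
  have hk' : k = x ^ 2 - 1 := by linarith
  have ht' : t = x * (2 - k) / 2 := by linarith
  have hw0 : 0 < x + Y := by linarith
  subst ht'
  subst hk'
  have hA : 0 < (x + Y) ^ 2 - 1 := by nlinarith
  have hN : a * (x + Y) + x * Y < 0 := by nlinarith
  obtain ⟨e, he⟩ : ∃ e, e = -x * Y / (x + Y) := ⟨_, rfl⟩
  have he1 : e * (x + Y) = -(x * Y) := by rw [he]; field_simp
  have hae : a < e := by
    by_contra h
    push Not at h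
    nlinarith [mul_le_mul_of_nonneg_right h hw0.le]
  -- the slope
  have hg : 0 < ((x + Y) ^ 2 - 1) * a + (x * Y ^ 2 + 2 * (x ^ 2 - 1) * Y) := by nlinarith
  have hge : 0 < ((x + Y) ^ 2 - 1) * e + (x * Y ^ 2 + 2 * (x ^ 2 - 1) * Y) := by
    nlinarith [mul_pos hA (sub_pos.2 hae)]
  have hinc : 0 < (e - a) * ((((x + Y) ^ 2 - 1) * a + (x * Y ^ 2 + 2 * (x ^ 2 - 1) * Y))
     + (((x + Y) ^ 2 - 1) * e + (x * Y ^ 2 + 2 * (x ^ 2 - 1) * Y))) :=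
    mul_pos (by linarith) (by linarith)
  have hFa : 0 < ((x + Y) ^ 2 - 1) * a ^ 2 + 2 * (x * Y ^ 2 + 2 * (x ^ 2 - 1) * Y) * a
      + (x ^ 2 - 1) * Y ^ 2 := by
    nlinarith
  have heY : e * Y ≤ 0 := by
    have : (e * Y) * (x + Y) ≤ 0 := by
      have : (e * Y) * (x + Y) = -(x * Y ^ 2) := by linear_combination Y * he1
      rw [this]
      nlinarith [mul_nonneg hx.le (sq_nonneg Y)]
    by_contra h
    push Not at h
    nlinarith [mul_pos h hw0]
  have hFe : ((x + Y) ^ 2 - 1) * e ^ 2 + 2 * (x * Y ^ 2 + 2 * (x ^ 2 - 1) * Y) * e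
      + (x ^ 2 - 1) * Y ^ 2 = -((e + Y) ^ 2 - 2 * (x ^ 2 - 1) * (e * Y)) := by
    have h0 : e * (x + Y) + x * Y = 0 := by linarith
    linear_combination (e * (x + Y) + x * Y) * h0
  nlinarith [sq_nonneg (e + Y), mul_nonneg hk.le (neg_nonneg.2 heY)]

set_option maxHeartbeats 1000000 in
/-- Second level of the reduction: two coordinates equal to `w`. -/
lemma level_two (k x t d w w1 a a1 b b1 : ℝ) (hk : 0 < k) (hk2 : k ≤ 2) (hx : 0 < x)
    (hxk : x ^ 2 = 1 + k)
    (ht : 2 * t = x * (2 - k)) (ht0 : 0 ≤ t) (ht1 : t < 1)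
    (hd : 6 * x ^ 2 - 3 * x ^ 4 < d) (hw : 1 < w)
    (ha : 2 * (w - t) < (w ^ 2 - 1) * a) (hb : 2 * (w - t) < (w ^ 2 - 1) * b)
    (F0 : (w ^ 2 - 1) * a * b - 2 * (w - t) * (a + b) + (-w ^ 2 + 4 * t * w - d) = 0)
    (F1 : 2 * w * w1 * a * b + (w ^ 2 - 1) * (a1 * b + a * b1) - 2 * w1 * (a + b)
      - 2 * (w - t) * (a1 + b1) + (-2 * w * w1 + 4 * t * w1) = 0) :
    2 * w1 ^ 2 * a * b + 2 * (2 * w * w1) * (a1 * b + a * b1) + 2 * (w ^ 2 - 1) * a1 * b1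
      - 0 * (a + b) - 2 * (2 * w1) * (a1 + b1) + (-2 * w1 ^ 2) ≤ 0 := by
  have hA : 0 < w ^ 2 - 1 := by nlinarith
  have hwm : 0 < w - 1 := by linarith
  have hwp : 0 < w + 1 := by linarith
  have hk' : k = x ^ 2 - 1 := by linarith
  have hR : 0 < (2 * (w - t)) ^ 2 - (w ^ 2 - 1) * (-w ^ 2 + 4 * t * w - d) := by
    have h1 : 0 < (w ^ 2 - 1) * (d - (6 * x ^ 2 - 3 * x ^ 4)) := mul_pos hA (by linarith)
    have h2 : 0 ≤ (w - x) ^ 2 * (((w - x) + k * x) ^ 2 + k ^ 2 * (2 - k)) := by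
      have : 0 ≤ 2 - k := by linarith
      positivity
    have h3 : (2 * (w - t)) ^ 2 - (w ^ 2 - 1) * (-w ^ 2 + 4 * t * w - d)
       = (w ^ 2 - 1) * (d - (6 * x ^ 2 - 3 * x ^ 4))
        + (w - x) ^ 2 * (((w - x) + k * x) ^ 2 + k ^ 2 * (2 - k)) := by
      have ht' : t = x * (2 - k) / 2 := by linarith
      subst ht' hk'
      ring
    rw [h3]; linarith
  obtain ⟨s, hs0, hs⟩ : ∃ s, 0 < s ∧
      s ^ 2 = (2 * (w - t)) ^ 2 - (w ^ 2 - 1) * (-w ^ 2 + 4 * t * w - d) :=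
    ⟨√_, Real.sqrt_pos.2 hR, Real.sq_sqrt hR.le⟩
  obtain ⟨L, hL⟩ : ∃ L, (w ^ 2 - 1) * L = 2 * (w - t) + s :=
    ⟨(2 * (w - t) + s) / (w ^ 2 - 1), by field_simp⟩
  have G0 : (w ^ 2 - 1) * L ^ 2 - 2 * (2 * (w - t)) * L + (-w ^ 2 + 4 * t * w - d) = 0 := by
    apply mul_left_cancel₀ hA.ne'
    linear_combination ((w ^ 2 - 1) * L - 2 * (w - t) + s) * hL + hs
  have hLw := curve_bound k x t d w L hk hx hxk ht hd hw (by linarith) G0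
  have hL0 : 0 < L := by
    by_contra h
    push Not at h
    nlinarith
  -- the curvature of the curve
  have hT := T_neg k x t (L * w - 1) (L + w - 2 * t) hk hk2 hx hxk ht hLw
    (by
      have : 2 * x ≤ L + w := by
        apply le_of_sq_le_sq _ (by linarith)
        nlinarith [sq_nonneg (L - w)]
      nlinarith)
    (by
      have h3 : (L * w - 1) ^ 2 + k ^ 3 - (L + w - 2 * t) ^ 2 = d - (6 * x ^ 2 - 3 * x ^ 4) := by
        have ht' : t = x * (2 - k) / 2 := by linarith
        subst ht' hk'
        linear_combination G0
      linarith)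
    (by nlinarith [sq_nonneg (L - w)])
  obtain ⟨L1, hL1⟩ : ∃ L1, L1 = -(2 * w * L ^ 2 - 4 * L - 2 * w + 4 * t) * w1 / (2 * s) :=
    ⟨_, rfl⟩
  obtain ⟨L2, hL2⟩ : ∃ L2, L2 = -(2 * w1 ^ 2 * L ^ 2 - 2 * 0 * L + (-2 * w1 ^ 2)
      + 4 * (2 * w * w1) * L * L1 - 4 * (2 * w1) * L1 + 2 * (w ^ 2 - 1) * L1 ^ 2) / (2 * s) :=
    ⟨_, rfl⟩
  have hAs : s = (w ^ 2 - 1) * L - 2 * (w - t) := by linarith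
  have hL1' : 2 * s * L1 = -(2 * w * L ^ 2 - 4 * L - 2 * w + 4 * t) * w1 := by
    rw [hL1]; field_simp
  have hL2' : 2 * s * L2 = -(2 * w1 ^ 2 * L ^ 2 - 2 * 0 * L + (-2 * w1 ^ 2)
      + 4 * (2 * w * w1) * L * L1 - 4 * (2 * w1) * L1 + 2 * (w ^ 2 - 1) * L1 ^ 2) := by
    rw [hL2]; field_simp
  have hL2n : 0 ≤ L2 := by
    have e : (2 * s) ^ 3 * L2 = -8 * w1 ^ 2 * (2 * (L * w - 1) ^ 3 + 4 * t * (L + w - 2 * t) ^ 3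
        - 6 * (L * w - 1) * (L + w - 2 * t) ^ 2 - 2 * (L * w - 1) ^ 4
        + (L * w - 1) ^ 2 * (L + w - 2 * t) ^ 2 + (L + w - 2 * t) ^ 4
        + 4 * (1 - t ^ 2) * ((L * w - 1) ^ 2 - (L + w - 2 * t) ^ 2)) := by
      have e1 : (2 * s) ^ 3 * L2 = -((2 * w1 ^ 2 * L ^ 2 - 2 * w1 ^ 2) * (2 * s) ^ 2
        + (8 * w * w1 * L - 8 * w1) * (2 * s) * (2 * s * L1)
        + 2 * (w ^ 2 - 1) * (2 * s * L1) ^ 2) := by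
        linear_combination (2 * s) ^ 2 * hL2'
      rw [e1, hL1', hAs]
      ring
    have e2 : 0 ≤ (2 * s) ^ 3 * L2 := by
      rw [e]
      exact mul_nonneg_of_nonpos_of_nonpos (by nlinarith [sq_nonneg w1]) hT
    exact nonneg_of_mul_nonneg_right e2 (by positivity)
  obtain ⟨p, hp⟩ : ∃ p, p = (1 - t) / (w - 1) + (1 + t) / (w + 1) := ⟨_, rfl⟩
  have hpA : (w ^ 2 - 1) * p = 2 * (w - t) := by rw [hp]; field_simp; ring
  have hcmp : ∀ z, 2 * (w - t) < (w ^ 2 - 1) * z → p < z := by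
    intro z hz
    rw [← hpA] at hz
    exact lt_of_mul_lt_mul_left hz hA.le
  refine jet_reduction (w ^ 2 - 1) (2 * w * w1) (2 * w1 ^ 2) (2 * (w - t)) (2 * w1) 0
    (-w ^ 2 + 4 * t * w - d) (-2 * w * w1 + 4 * t * w1) (-2 * w1 ^ 2) a a1 b b1 L L1 L2
    p (-w1 * ((1 - t) / (w - 1) ^ 2 + (1 + t) / (w + 1) ^ 2))
    (2 * w1 ^ 2 * ((1 - t) / (w - 1) ^ 3 + (1 + t) / (w + 1) ^ 3))
    hA hpA ?_ ?_ ?_ hL2n (hcmp L (by linarith)) (hcmp a ha) (hcmp b hb) G0 ?_ ?_ F0 F1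
  · rw [hp]; field_simp; ring
  · rw [hp]; field_simp; ring
  · have : 0 < 1 - t := by linarith
    have : 0 < 1 + t := by linarith
    positivity
  · rw [← hAs]; linear_combination hL1'
  · rw [← hAs]; linear_combination hL2'

set_option maxHeartbeats 1000000 in
lemma sub_diag (k x t d v m : ℝ) (hk : 0 < k) (hx : 1 < x) (hxk : x ^ 2 = 1 + k)
    (ht : 2 * t = x * (2 - k)) (hd : 6 * x ^ 2 - 3 * x ^ 4 < d) (hv : 1 ≤ v) (hvx : v < x)
    (hmv : 1 < m * v) (hD : 0 < m * m * v - (m + m + v) + 2 * t)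
    (hg : (v ^ 2 - 1) * m - 2 * (v - t) ≤ 0) :
    (v ^ 2 - 1) * m * m - 2 * (v - t) * (m + m) + (-v ^ 2 + 4 * t * v - d) < 0 := by
  have ht' : t = x * (2 - k) / 2 := by linarith
  have hk' : k = x ^ 2 - 1 := by linarith
  obtain ⟨a, rfl⟩ : ∃ a, m = x + a := ⟨m - x, by ring⟩
  obtain ⟨Y, rfl⟩ : ∃ Y, v = x + Y := ⟨v - x, by ring⟩
  have hY : Y < 0 := by linarith
  have hv0 : 0 < x + Y := by linarith
  have hD' : 0 < a ^ 2 * (x + Y) + 2 * a * (x * (x + Y) - 1) + k * Y := by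
    refine lt_of_lt_of_eq hD ?_
    subst ht' hk'; ring
  have hg' : ((x + Y) ^ 2 - 1) * a + (x * Y ^ 2 + 2 * k * Y) ≤ 0 := by
    refine le_trans (le_of_eq ?_) hg
    subst ht' hk'; ring
  have hxv : 0 < x * (x + Y) - 1 := by nlinarith
  have hkY : k * Y < 0 := mul_neg_of_pos_of_neg hk hY
  have ha : 0 < a := by
    by_contra h
    push Not at h
    have h1 : 0 ≤ (-a) * (((x + a) * (x + Y) - 1) + (x * (x + Y) - 1)) :=
      mul_nonneg (by linarith) (by linarith)
    nlinarith
  have hRe : 0 ≤ (x * (x + Y) - 1) ^ 2 - k * Y * (x + Y) := by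
    nlinarith [mul_pos (neg_pos.2 hkY) hv0, sq_nonneg (x * (x + Y) - 1)]
  obtain ⟨s, hs0, hs⟩ : ∃ s, 0 ≤ s ∧ s ^ 2 = (x * (x + Y) - 1) ^ 2 - k * Y * (x + Y) :=
    ⟨√_, Real.sqrt_nonneg _, Real.sq_sqrt hRe⟩
  have hsg : x * (x + Y) - 1 < s := by
    have h := mul_pos (neg_pos.2 hkY) hv0
    exact lt_of_pow_lt_pow_left₀ 2 hs0 (by rw [hs]; linarith)
  obtain ⟨e, he⟩ : ∃ e, e * (x + Y) = -(x * (x + Y) - 1) + s :=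
    ⟨(-(x * (x + Y) - 1) + s) / (x + Y), by field_simp⟩
  have he0 : 0 < e := by
    by_contra h
    push Not at h
    linarith [mul_nonpos_of_nonpos_of_nonneg h hv0.le]
  have hDe : e ^ 2 * (x + Y) + 2 * e * (x * (x + Y) - 1) + k * Y = 0 := by
    apply mul_left_cancel₀ hv0.ne'
    linear_combination (e * (x + Y) + (x * (x + Y) - 1) + s) * he + hs
  have hea : e ≤ a := by
    by_contra h
    push Not at h
    have : 0 < (e - a) * ((e + a) * (x + Y) + 2 * (x * (x + Y) - 1)) :=
      mul_pos (by linarith) (by positivity)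
    nlinarith
  have hA : 0 ≤ (x + Y) ^ 2 - 1 := by nlinarith
  have hE : 0 < e ^ 2 + 2 * x * e + k := by positivity
  have hFe : ((x + Y) ^ 2 - 1) * e ^ 2 + 2 * (x * Y ^ 2 + 2 * k * Y) * e + k * Y ^ 2 ≤ 0 := by
    have hYE : Y * (e ^ 2 + 2 * x * e + k) = -(x * e ^ 2 + 2 * k * e) := by
      rw [hk'] at hDe ⊢
      linear_combination hDe
    have h1 : (e ^ 2 + 2 * x * e + k) *
        (((x + Y) ^ 2 - 1) * e ^ 2 + 2 * (x * Y ^ 2 + 2 * k * Y) * e + k * Y ^ 2)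
        = -(e ^ 2 * (e ^ 2 + 2 * k * x * e + 3 * k ^ 2)) := by
      have h2 : (e ^ 2 + 2 * x * e + k) *
        (((x + Y) ^ 2 - 1) * e ^ 2 + 2 * (x * Y ^ 2 + 2 * k * Y) * e + k * Y ^ 2)
        = (Y * (e ^ 2 + 2 * x * e + k)) ^ 2
          + 2 * (Y * (e ^ 2 + 2 * x * e + k)) * (x * e ^ 2 + 2 * k * e)
          + k * e ^ 2 * (e ^ 2 + 2 * x * e + k) := by
        rw [hk']; ring
      rw [h2, hYE, hk']; ring
    have h3 : 0 ≤ e ^ 2 * (e ^ 2 + 2 * k * x * e + 3 * k ^ 2) := by positivity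
    have h4 : (e ^ 2 + 2 * x * e + k) *
        (((x + Y) ^ 2 - 1) * e ^ 2 + 2 * (x * Y ^ 2 + 2 * k * Y) * e + k * Y ^ 2) ≤ 0 := by
      rw [h1]; linarith
    exact nonpos_of_mul_nonpos_right h4 hE
  have hge : ((x + Y) ^ 2 - 1) * e + (x * Y ^ 2 + 2 * k * Y) ≤ 0 := by
    nlinarith [mul_nonneg hA (sub_nonneg.2 hea)]
  have hFa : ((x + Y) ^ 2 - 1) * a ^ 2 + 2 * (x * Y ^ 2 + 2 * k * Y) * a + k * Y ^ 2 ≤ 0 := by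
    have := mul_nonneg (sub_nonneg.2 hea) (add_nonneg (neg_nonneg.2 hge) (neg_nonneg.2 hg'))
    nlinarith
  have hfin : ((x + Y) ^ 2 - 1) * (x + a) * (x + a) - 2 * (x + Y - t) * (x + a + (x + a))
      + (-(x + Y) ^ 2 + 4 * t * (x + Y) - d)
      = ((x + Y) ^ 2 - 1) * a ^ 2 + 2 * (x * Y ^ 2 + 2 * k * Y) * a + k * Y ^ 2
        - (d - (6 * x ^ 2 - 3 * x ^ 4)) := by
    subst ht' hk'; ring
  rw [hfin]; linarith

lemma R_pos (k x t d w : ℝ) (hk2 : k ≤ 2) (hxk : x ^ 2 = 1 + k)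
    (ht : 2 * t = x * (2 - k)) (hd : 6 * x ^ 2 - 3 * x ^ 4 < d) (hw : 1 < w) :
    0 < (2 * (w - t)) ^ 2 - (w ^ 2 - 1) * (-w ^ 2 + 4 * t * w - d) := by
  have hk' : k = x ^ 2 - 1 := by linarith
  have hA : 0 < w ^ 2 - 1 := by nlinarith
  have h1 : 0 < (w ^ 2 - 1) * (d - (6 * x ^ 2 - 3 * x ^ 4)) := mul_pos hA (by linarith)
  have h2 : 0 ≤ (w - x) ^ 2 * (((w - x) + k * x) ^ 2 + k ^ 2 * (2 - k)) := by
    have : 0 ≤ 2 - k := by linarith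
    positivity
  have h3 : (2 * (w - t)) ^ 2 - (w ^ 2 - 1) * (-w ^ 2 + 4 * t * w - d)
     = (w ^ 2 - 1) * (d - (6 * x ^ 2 - 3 * x ^ 4))
      + (w - x) ^ 2 * (((w - x) + k * x) ^ 2 + k ^ 2 * (2 - k)) := by
    have ht' : t = x * (2 - k) / 2 := by linarith
    subst ht' hk'
    ring
  rw [h3]; linarith

set_option maxHeartbeats 1000000 in
lemma place (k x t d w a b : ℝ) (hk : 0 < k) (hk2 : k ≤ 2) (hx : 1 < x) (hxk : x ^ 2 = 1 + k)
    (ht : 2 * t = x * (2 - k)) (ht0 : 0 ≤ t) (ht1 : t < 1)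
    (hd : 6 * x ^ 2 - 3 * x ^ 4 < d) (ha0 : 0 < a) (hb0 : 0 < b)
    (hab : 1 < a * b) (hw : a + b - 2 * t < (a * b - 1) * w)
    (F0 : (w ^ 2 - 1) * a * b - 2 * (w - t) * (a + b) + (-w ^ 2 + 4 * t * w - d) = 0) :
    1 < w ∧ 2 * (w - t) < (w ^ 2 - 1) * a ∧ 2 * (w - t) < (w ^ 2 - 1) * b := by
  obtain ⟨m, hm⟩ : ∃ m, 2 * m = a + b := ⟨(a + b) / 2, by ring⟩
  have hb : b = 2 * m - a := by linarith
  have hmab : a * b ≤ m * m := by rw [hb]; nlinarith [sq_nonneg (a - m)]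
  have hm1 : 1 < m := by nlinarith
  have hA : 0 < a * b - 1 := by linarith
  have hw0 : 0 < w := by
    by_contra h
    push Not at h
    nlinarith
  have hw1 : 1 < w := by
    by_contra h
    push Not at h
    have := sub_diag k x t d 1 m hk hx hxk ht hd le_rfl hx (by linarith)
      (by nlinarith [mul_nonneg hA.le (sub_nonneg.2 h)]) (by nlinarith)
    nlinarith [mul_nonneg (sub_nonneg.2 h) (sub_nonneg.2 hw.le),
      mul_nonneg (mul_nonneg (sub_nonneg.2 h) (sub_nonneg.2 h)) hA.le]
  have hA' : 0 < w ^ 2 - 1 := by nlinarith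
  have hR := R_pos k x t d w hk2 hxk ht hd hw1
  have hprod : 0 < ((w ^ 2 - 1) * a - 2 * (w - t)) * ((w ^ 2 - 1) * b - 2 * (w - t)) := by
    refine lt_of_lt_of_eq hR ?_
    linear_combination (-(w ^ 2 - 1)) * F0
  refine ⟨hw1, ?_⟩
  rcases (mul_pos_iff.1 hprod) with ⟨h1, h2⟩ | ⟨h1, h2⟩
  · exact ⟨by linarith, by linarith⟩
  exfalso
  have hgm : (w ^ 2 - 1) * m - 2 * (w - t) < 0 := by nlinarith
  have hmw : 1 < m * w := by nlinarith
  have hDm : 0 < m * m * w - (m + m + w) + 2 * t := by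
    nlinarith [mul_nonneg (sub_nonneg.2 hmab) hw0.le]
  rcases lt_or_ge w x with hwx | hwx
  · have := sub_diag k x t d w m hk hx hxk ht hd hw1.le hwx hmw hDm hgm.le
    have h8 := mul_nonneg hA'.le (sub_nonneg.2 hmab)
    have h9 : a + b = m + m := by linarith
    rw [h9] at F0
    linarith
  · have hmx : m < x := by
      by_contra h
      push Not at h
      have h5 : 0 ≤ (w ^ 2 - 1) * (m - x) := mul_nonneg hA'.le (by linarith)
      have h6 : (w ^ 2 - 1) * x - 2 * (w - t) = (w - x) * (x * (w - x) + 2 * k) := by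
        have ht' : t = x * (2 - k) / 2 := by linarith
        have hk' : k = x ^ 2 - 1 := by linarith
        subst ht' hk'; ring
      have h7 : 0 ≤ (w - x) * (x * (w - x) + 2 * k) := by
        have : 0 ≤ w - x := by linarith
        positivity
      nlinarith
    nlinarith [mul_nonneg (sub_nonneg.2 hmw.le) (sub_nonneg.2 (hmx.le.trans hwx))]

set_option maxHeartbeats 1000000 in
/-- Normalized form of the statement. -/
lemma core_s13 (k x t d a b c e va vb vc ve : ℝ) (hk : 0 < k) (hk2 : k ≤ 2) (hx : 1 < x)
    (hxk : x ^ 2 = 1 + k) (ht : 2 * t = x * (2 - k)) (ht0 : 0 ≤ t) (ht1 : t < 1)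
    (hd : 6 * x ^ 2 - 3 * x ^ 4 < d) (ha0 : 0 < a) (hb0 : 0 < b)
    (hab : 1 < a * b) (hc : 0 < a * b * c - (a + b + c) + 2 * t)
    (he : 0 < a * b * e - (a + b + e) + 2 * t)
    (F0 : a * b * c * e - (a * b + a * c + a * e + b * c + b * e + c * e)
      + 2 * t * (a + b + c + e) - d = 0)
    (F1 : va * (b * c * e - (b + c + e) + 2 * t) + vb * (a * c * e - (a + c + e) + 2 * t)
      + vc * (a * b * e - (a + b + e) + 2 * t) + ve * (a * b * c - (a + b + c) + 2 * t) = 0) :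
    va * vb * (c * e - 1) + va * vc * (b * e - 1) + va * ve * (b * c - 1)
      + vb * vc * (a * e - 1) + vb * ve * (a * c - 1) + vc * ve * (a * b - 1) ≤ 0 := by
  have hA : 0 < a * b - 1 := by linarith
  have hc' : a + b - 2 * t < (a * b - 1) * c := by linarith
  have he' : a + b - 2 * t < (a * b - 1) * e := by linarith
  have hR : 0 < (a + b - 2 * t) ^ 2 - (a * b - 1) * (-(a * b) + 2 * t * (a + b) - d) := by
    refine lt_of_lt_of_eq (mul_pos (sub_pos.2 hc') (sub_pos.2 he')) ?_
    linear_combination (a * b - 1) * F0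
  obtain ⟨s, hs0, hs⟩ : ∃ s, 0 < s ∧
      s ^ 2 = (a + b - 2 * t) ^ 2 - (a * b - 1) * (-(a * b) + 2 * t * (a + b) - d) :=
    ⟨√_, Real.sqrt_pos.2 hR, Real.sq_sqrt hR.le⟩
  obtain ⟨w, hw⟩ : ∃ w, (a * b - 1) * w = (a + b - 2 * t) + s :=
    ⟨((a + b - 2 * t) + s) / (a * b - 1), by field_simp⟩
  have G0 : (a * b - 1) * w ^ 2 - 2 * (a + b - 2 * t) * w
      + (-(a * b) + 2 * t * (a + b) - d) = 0 := by
    apply mul_left_cancel₀ hA.ne'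
    linear_combination ((a * b - 1) * w - (a + b - 2 * t) + s) * hw + hs
  obtain ⟨hw1, hga, hgb⟩ := place k x t d w a b hk hk2 hx hxk ht ht0 ht1 hd ha0 hb0 hab
    (by linarith) (by linear_combination G0)
  have hAs : s = (a * b - 1) * w - (a + b - 2 * t) := by linarith
  obtain ⟨w1, hw1'⟩ : ∃ w1, 2 * s * w1 = -((va * b + a * vb) * w ^ 2 - 2 * (va + vb) * w
      + (-(va * b + a * vb) + 2 * t * (va + vb))) :=
    ⟨-((va * b + a * vb) * w ^ 2 - 2 * (va + vb) * w
      + (-(va * b + a * vb) + 2 * t * (va + vb))) / (2 * s), by field_simp⟩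
  obtain ⟨w2, hw2'⟩ : ∃ w2, 2 * s * w2 = -(2 * va * vb * w ^ 2 - 2 * 0 * w + (-2 * va * vb)
      + 4 * (va * b + a * vb) * w * w1 - 4 * (va + vb) * w1 + 2 * (a * b - 1) * w1 ^ 2) :=
    ⟨-(2 * va * vb * w ^ 2 - 2 * 0 * w + (-2 * va * vb)
      + 4 * (va * b + a * vb) * w * w1 - 4 * (va + vb) * w1 + 2 * (a * b - 1) * w1 ^ 2)
        / (2 * s), by field_simp⟩
  have hw2n : 0 ≤ w2 := by
    have h := level_two k x t d w w1 a va b vb hk hk2 (by linarith) hxk ht ht0 ht1 hd hw1 hga hgb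
      (by linear_combination G0) (by rw [hAs] at hw1'; linear_combination hw1')
    have h2 : 0 ≤ 2 * s * w2 := by
      rw [hw2']; linarith
    exact nonneg_of_mul_nonneg_right h2 (by positivity)
  obtain ⟨p, hp⟩ : ∃ p, (a * b - 1) * p = a + b - 2 * t :=
    ⟨(a + b - 2 * t) / (a * b - 1), by field_simp⟩
  obtain ⟨p1, hp1⟩ : ∃ p1, (a * b - 1) * p1 = va + vb - (va * b + a * vb) * p :=
    ⟨(va + vb - (va * b + a * vb) * p) / (a * b - 1), by field_simp⟩
  obtain ⟨p2, hp2⟩ : ∃ p2, (a * b - 1) * p2 =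
      -(2 * va * vb * p + 2 * (va * b + a * vb) * p1) :=
    ⟨-(2 * va * vb * p + 2 * (va * b + a * vb) * p1) / (a * b - 1), by field_simp⟩
  have hp2n : 0 ≤ p2 := by
    have e1 : (a * b - 1) ^ 3 * p2 = 2 * (b * (b ^ 2 - 2 * t * b + 1) * va ^ 2
        + 2 * (a + b - t - t * (a * b)) * va * vb + a * (a ^ 2 - 2 * t * a + 1) * vb ^ 2) := by
      linear_combination (a * b - 1) ^ 2 * hp2 - 2 * (a * b - 1) * (va * b + a * vb) * hp1
        + (2 * (va * b + a * vb) ^ 2 - 2 * (a * b - 1) * va * vb) * hp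
    have hSa : 0 < a ^ 2 - 2 * t * a + 1 := by
      have h1 := mul_pos (sub_pos.2 ht1) ha0
      linarith [sq_nonneg (a - 1)]
    have hSb : 0 < b ^ 2 - 2 * t * b + 1 := by
      have h1 := mul_pos (sub_pos.2 ht1) hb0
      linarith [sq_nonneg (b - 1)]
    have hbS : 0 < b * (b ^ 2 - 2 * t * b + 1) := mul_pos hb0 hSb
    have hdisc : (a + b - t - t * (a * b)) ^ 2 ≤
        (b * (b ^ 2 - 2 * t * b + 1)) * (a * (a ^ 2 - 2 * t * a + 1)) := by
      have h1 : (a ^ 2 - 2 * t * a + 1) * (b ^ 2 - 2 * t * b + 1)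
        = (a + b - t - t * (a * b)) ^ 2 + (1 - t ^ 2) * (a * b - 1) ^ 2 := by ring
      have h2 : 0 ≤ (1 - t ^ 2) * (a * b - 1) ^ 2 := by
        have : 0 ≤ 1 - t ^ 2 := by nlinarith
        positivity
      have h6 := mul_pos hA (mul_pos hSa hSb)
      have h7 : (b * (b ^ 2 - 2 * t * b + 1)) * (a * (a ^ 2 - 2 * t * a + 1)) =
        (a * b - 1) * ((a ^ 2 - 2 * t * a + 1) * (b ^ 2 - 2 * t * b + 1))
        + (a ^ 2 - 2 * t * a + 1) * (b ^ 2 - 2 * t * b + 1) := by ring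
      rw [h7]
      linarith only [h1, h2, h6]
    have h3 : 0 ≤ b * (b ^ 2 - 2 * t * b + 1) * va ^ 2
        + 2 * (a + b - t - t * (a * b)) * va * vb + a * (a ^ 2 - 2 * t * a + 1) * vb ^ 2 := by
      generalize b * (b ^ 2 - 2 * t * b + 1) = α at *
      generalize a * (a ^ 2 - 2 * t * a + 1) = γ at *
      generalize a + b - t - t * (a * b) = β at *
      have h4 : 0 ≤ α * (α * va ^ 2 + 2 * β * va * vb + γ * vb ^ 2) := by
        nlinarith [sq_nonneg (α * va + β * vb), mul_nonneg (sub_nonneg.2 hdisc) (sq_nonneg vb)]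
      exact nonneg_of_mul_nonneg_right h4 hbS
    have h5 : 0 ≤ (a * b - 1) ^ 3 * p2 := by rw [e1]; linarith
    exact nonneg_of_mul_nonneg_right h5 (by positivity)
  have hcmp : ∀ z, a + b - 2 * t < (a * b - 1) * z → p < z := by
    intro z hz
    rw [← hp] at hz
    exact lt_of_mul_lt_mul_left hz hA.le
  have := jet_reduction (a * b - 1) (va * b + a * vb) (2 * va * vb) (a + b - 2 * t) (va + vb) 0
    (-(a * b) + 2 * t * (a + b) - d) (-(va * b + a * vb) + 2 * t * (va + vb)) (-2 * va * vb)
    c vc e ve w w1 w2 p p1 p2 hA hp (by linear_combination hp1) (by linear_combination hp2)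
    hp2n hw2n (hcmp w (by linarith)) (hcmp c hc') (hcmp e he') G0
    (by rw [← hAs]; linear_combination hw1') (by rw [← hAs]; linear_combination hw2')
    (by linear_combination F0) (by linear_combination F1)
  linarith
set_option maxHeartbeats 4000000


/-- Scaled form of `core`. -/
lemma core_scaled (k x t d s B C D a b c e va vb vc ve : ℝ) (hk : 0 < k) (hk2 : k ≤ 2)
    (hx : 1 < x) (hxk : x ^ 2 = 1 + k) (ht : 2 * t = x * (2 - k)) (ht0 : 0 ≤ t) (ht1 : t < 1)
    (hd : 6 * x ^ 2 - 3 * x ^ 4 < d) (hs : 0 < s) (hB : B = s ^ 2) (hC : C = 2 * t * s ^ 3)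
    (hD : D = d * s ^ 4) (ha0 : 0 < a) (hb0 : 0 < b)
    (hab : B < a * b) (hc : 0 < a * b * c - B * (a + b + c) + C)
    (he : 0 < a * b * e - B * (a + b + e) + C)
    (F0 : a*b*c*e - B * (a*b + a*c + a*e + b*c + b*e + c*e) + C*(a+b+c+e) - D = 0)
    (F1 : va*(b*c*e - B*(b+c+e) + C) + vb*(a*c*e - B*(a+c+e) + C)
      + vc*(a*b*e - B*(a+b+e) + C) + ve*(a*b*c - B*(a+b+c) + C) = 0) :
    va*vb*(c*e-B) + va*vc*(b*e-B) + va*ve*(b*c-B)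
      + vb*vc*(a*e-B) + vb*ve*(a*c-B) + vc*ve*(a*b-B) ≤ 0 := by
  subst hB hC hD
  obtain ⟨a, rfl⟩ : ∃ a', a = s * a' := ⟨a / s, by field_simp⟩
  obtain ⟨b, rfl⟩ : ∃ a', b = s * a' := ⟨b / s, by field_simp⟩
  obtain ⟨c, rfl⟩ : ∃ a', c = s * a' := ⟨c / s, by field_simp⟩
  obtain ⟨e, rfl⟩ : ∃ a', e = s * a' := ⟨e / s, by field_simp⟩
  have hs2 : 0 < s ^ 2 := by positivity
  have hs3 : 0 < s ^ 3 := by positivity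
  have hs4 : 0 < s ^ 4 := by positivity
  have := core_s13 k x t d a b c e va vb vc ve hk hk2 hx hxk ht ht0 ht1 hd
    (pos_of_mul_pos_right ha0 hs.le) (pos_of_mul_pos_right hb0 hs.le)
    (by
      refine lt_of_mul_lt_mul_left ?_ hs2.le
      linarith)
    (by
      refine pos_of_mul_pos_right (a := s ^ 3) ?_ hs3.le
      linarith)
    (by
      refine pos_of_mul_pos_right (a := s ^ 3) ?_ hs3.le
      linarith)
    (by
      refine (mul_eq_zero.mp (?_ : s ^ 4 * _ = 0)).resolve_left hs4.ne'
      linarith)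
    (by
      refine (mul_eq_zero.mp (?_ : s ^ 3 * _ = 0)).resolve_left hs3.ne'
      linarith)
  nlinarith [mul_le_mul_of_nonneg_left this hs2.le]

/-- The trigonometric data: `x = 2 cos θh`. -/
lemma trig_data (t y : ℝ) (ht0 : 0 ≤ t) (ht1 : t < 1) (hy : y = (1 / 3) * Real.arccos (-t)) :
    1 < 2 * Real.cos y ∧ (2 * Real.cos y) ^ 2 ≤ 3 ∧
      2 * t = 3 * (2 * Real.cos y) - (2 * Real.cos y) ^ 3 := by
  have h3 : Real.cos (3 * y) = -t := by
    rw [hy, show 3 * (1 / 3 * Real.arccos (-t)) = Real.arccos (-t) by ring]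
    exact Real.cos_arccos (by linarith) (by linarith)
  rw [Real.cos_three_mul] at h3
  have hpi := Real.pi_pos
  have hlo : Real.pi / 2 ≤ Real.arccos (-t) := by
    rw [← Real.arccos_zero]
    exact Real.arccos_le_arccos (by linarith)
  have hhi : Real.arccos (-t) < Real.pi := by
    rw [← Real.arccos_neg_one]
    exact Real.arccos_lt_arccos (by norm_num) (by linarith) (by linarith)
  have c1 : 1 / 2 < Real.cos y := by
    rw [← Real.cos_pi_div_three]
    apply Real.cos_lt_cos_of_nonneg_of_le_pi <;> linarith
  refine ⟨by linarith, ?_, by linarith⟩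
  by_contra hcon
  push Not at hcon
  nlinarith

/-- Second derivative of a quotient along a line through a critical direction. -/
lemma hess_line (f : (Fin 4 → ℝ) → ℝ) (l V : Fin 4 → ℝ) (hf : ContDiffAt ℝ 2 f l)
    (n0 n1 n2 p0 p1 p2 p3 p4 h : ℝ) (hp0 : 0 < p0) (hn0 : n0 = h * p0)
    (hfl : ∀ ε : ℝ, f (l + ε • V) =
      (n0 + n1 * ε + n2 * ε ^ 2) / (p0 + p1 * ε + p2 * ε ^ 2 + p3 * ε ^ 3 + p4 * ε ^ 4))
    (hV : fderiv ℝ f l V = 0) :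
    n1 = h * p1 ∧ fderiv ℝ (fderiv ℝ f) l V V = 2 * (n2 - h * p2) / p0 := by
  have hline : ∀ ε : ℝ, HasDerivAt (fun ε : ℝ => l + ε • V) V ε := fun ε => by
    simpa using ((hasDerivAt_id ε).smul_const V).const_add l
  have hline0 : Filter.Tendsto (fun ε : ℝ => l + ε • V) (nhds 0) (nhds l) := by
    have := (hline 0).continuousAt.tendsto
    simpa using this
  have hev : ∀ᶠ ε : ℝ in nhds 0, DifferentiableAt ℝ f (l + ε • V) := by
    refine hline0.eventually ?_
    filter_upwards [hf.eventually (by simp)] with y hy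
    exact hy.differentiableAt (by norm_num)
  let n : ℝ → ℝ := fun ε => n0 + n1 * ε + n2 * ε ^ 2
  let p : ℝ → ℝ := fun ε => p0 + p1 * ε + p2 * ε ^ 2 + p3 * ε ^ 3 + p4 * ε ^ 4
  let n' : ℝ → ℝ := fun ε => n1 + n2 * (2 * ε)
  let p' : ℝ → ℝ := fun ε => p1 + p2 * (2 * ε) + p3 * (3 * ε ^ 2) + p4 * (4 * ε ^ 3)
  have hpow : ∀ (m : ℕ) (ε : ℝ), HasDerivAt (fun ε : ℝ => ε ^ m) (m * ε ^ (m - 1)) ε :=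
    fun m ε => hasDerivAt_pow m ε
  have hn : ∀ ε, HasDerivAt n (n' ε) ε := fun ε => by
    have := (((hasDerivAt_id ε).const_mul n1).const_add n0).add ((hpow 2 ε).const_mul n2)
    refine this.congr_deriv ?_
    simp [n']
  have hp : ∀ ε, HasDerivAt p (p' ε) ε := fun ε => by
    have := (((((hasDerivAt_id ε).const_mul p1).const_add p0).add ((hpow 2 ε).const_mul p2)).add
      ((hpow 3 ε).const_mul p3)).add ((hpow 4 ε).const_mul p4)
    refine this.congr_deriv ?_
    simp [p']
  have hn' : HasDerivAt n' (2 * n2) 0 := by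
    have := (((hasDerivAt_id (0:ℝ)).const_mul 2).const_mul n2).const_add n1
    refine this.congr_deriv ?_
    ring
  have hp' : HasDerivAt p' (2 * p2) 0 := by
    have := (((((hasDerivAt_id (0:ℝ)).const_mul 2).const_mul p2).const_add p1).add
      (((hpow 2 0).const_mul 3).const_mul p3)).add (((hpow 3 0).const_mul 4).const_mul p4)
    refine this.congr_deriv ?_
    simp
    ring
  have hpne : ∀ᶠ ε : ℝ in nhds 0, p ε ≠ 0 := by
    refine (hp 0).continuousAt.eventually_ne ?_
    simp [p, hp0.ne']
  have hg : ∀ᶠ ε : ℝ in nhds 0,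
      fderiv ℝ f (l + ε • V) V = (n' ε * p ε - n ε * p' ε) / p ε ^ 2 := by
    filter_upwards [hev, hpne] with ε h1 h2
    have a1 := h1.hasFDerivAt.comp_hasDerivAt ε (hline ε)
    have a2 := (hn ε).div (hp ε) h2
    refine a1.unique (a2.congr_of_eventuallyEq ?_)
    refine Filter.Eventually.of_forall fun δ => ?_
    exact hfl δ
  have hp00 : p 0 = p0 := by simp [p]
  have hn00 : n 0 = n0 := by simp [n]
  have hp10 : p' 0 = p1 := by simp [p']
  have hn10 : n' 0 = n1 := by simp [n']
  have h0 := hg.self_of_nhds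
  rw [zero_smul, add_zero, hV, hp00, hn00, hp10, hn10, hn0] at h0
  have h0' : n1 * p0 - h * p0 * p1 = 0 := by
    rcases div_eq_zero_iff.mp h0.symm with h | h
    · exact h
    · exact absurd h (by positivity)
  have hn1 : n1 = h * p1 := by
    refine mul_right_cancel₀ hp0.ne' ?_
    linarith
  refine ⟨hn1, ?_⟩
  have hff : HasFDerivAt (fderiv ℝ f) (fderiv ℝ (fderiv ℝ f) l) (l + (0:ℝ) • V) := by
    rw [zero_smul, add_zero]
    exact ((hf.fderiv_right (m := 1) (by norm_num)).differentiableAt (by norm_num)).hasFDerivAt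
  have b1 := (hff.comp_hasDerivAt (0:ℝ) (hline 0)).clm_apply (hasDerivAt_const (0:ℝ) V)
  have b2 := ((hn'.mul (hp 0)).sub ((hn 0).mul hp')).div ((hp 0).pow 2)
    (by rw [Pi.pow_apply, hp00]; positivity)
  have b3 := b1.unique (b2.congr_of_eventuallyEq ?_)
  · simp only [map_zero, add_zero] at b3
    rw [b3]
    simp only [Pi.mul_apply, Pi.sub_apply, Pi.pow_apply, hp00, hn00, hp10, hn10, hn0, hn1]
    field_simp
    ring
  · filter_upwards [hg] with ε hε
    exact hε

/-- Convexity of the level set `{f = h}` of the four-dimensional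
dHYM continuity-path operator inside the corresponding Υ-cone: at a point `λ` of the
level set, the Hessian quadratic form of `f` is nonnegative on vectors `V` orthogonal
to the gradient of `f` at `λ`. -/
theorem stmt_13 (θ : ℝ) (hθ : θ ∈ Set.Ioo Real.pi (5 * Real.pi / 4))
    (c₂ c₁ h c₀ : ℝ) (hc₂ : 0 < c₂) (hc₁ : 0 ≤ c₁) (hh : 0 < h)
    (h1 : h * c₁ ^ 2 < c₂ ^ 3 * (Real.sin θ / Real.cos θ) ^ 2)
    (θh : ℝ)
    (hθh : θh = (1 / 3) * Real.arccos
      (-(c₁ * (Real.cos θ / Real.sin θ) * h ^ ((1 : ℝ) / 2)) / c₂ ^ ((3 : ℝ) / 2)))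
    (h2 : 0 < c₀ * (3 / Real.sin θ ^ 2 - 4) * h
        + 24 * c₂ ^ 2 * Real.cos θh ^ 2 * Real.cos (2 * θh))
    (f : (Fin 4 → ℝ) → ℝ)
    (hf : f = fun l =>
      (c₂ * (l 0 * l 1 + l 0 * l 2 + l 0 * l 3 + l 1 * l 2 + l 1 * l 3 + l 2 * l 3)
        - 2 * c₁ * (Real.cos θ / Real.sin θ) * (l 0 + l 1 + l 2 + l 3)
        + c₀ * (3 / Real.sin θ ^ 2 - 4)) / (l 0 * l 1 * l 2 * l 3))
    (l : Fin 4 → ℝ) (hpos : ∀ i, 0 < l i)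
    (hpair : ∀ i j, i ≠ j → c₂ / h < l i * l j)
    (htriple : ∀ i j k, i ≠ j → i ≠ k → j ≠ k →
      0 < l i * l j * l k - c₂ / h * (l i + l j + l k)
        + 2 * c₁ * (Real.cos θ / Real.sin θ) / h)
    (hsol : f l = h)
    (V : Fin 4 → ℝ) (hV : fderiv ℝ f l V = 0) :
    0 ≤ fderiv ℝ (fderiv ℝ f) l V V := by

  obtain ⟨hθ1, hθ2⟩ := hθ
  have hpi := Real.pi_pos
  have hsin : Real.sin θ < 0 := by
    have := Real.sin_pos_of_pos_of_lt_pi (x := θ - Real.pi) (by linarith) (by linarith)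
    rw [Real.sin_sub_pi] at this
    linarith
  have hcos : Real.cos θ < 0 := by
    have := Real.cos_pos_of_mem_Ioo (x := θ - Real.pi) ⟨by linarith, by linarith⟩
    rw [Real.cos_sub_pi] at this
    linarith
  have hcot : 0 < Real.cos θ / Real.sin θ := div_pos_of_neg_of_neg hcos hsin
  have htan : Real.sin θ / Real.cos θ = (Real.cos θ / Real.sin θ)⁻¹ := by rw [inv_div]
  rw [htan] at h1
  set q := Real.cos θ / Real.sin θ with hq
  set E := c₀ * (3 / Real.sin θ ^ 2 - 4) with hE
  clear_value q E
  have hh12 : h ^ ((1 : ℝ) / 2) = Real.sqrt h := (Real.sqrt_eq_rpow h).symm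
  have hc32 : c₂ ^ ((3 : ℝ) / 2) = Real.sqrt c₂ ^ 3 := by
    rw [Real.sqrt_eq_rpow, ← Real.rpow_natCast, ← Real.rpow_mul hc₂.le]
    norm_num
  rw [hh12, hc32] at hθh
  obtain ⟨u, hu, hu2⟩ : ∃ u : ℝ, 0 < u ∧ u = Real.sqrt h := ⟨_, Real.sqrt_pos.2 hh, rfl⟩
  obtain ⟨w, hw, hw2⟩ : ∃ w : ℝ, 0 < w ∧ w = Real.sqrt c₂ := ⟨_, Real.sqrt_pos.2 hc₂, rfl⟩
  have hhu : h = u ^ 2 := by rw [hu2, Real.sq_sqrt hh.le]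
  have hcw : c₂ = w ^ 2 := by rw [hw2, Real.sq_sqrt hc₂.le]
  rw [← hu2, ← hw2] at hθh
  clear hu2 hw2 hh12 hc32
  obtain ⟨t, htdef⟩ : ∃ t, t = c₁ * q * u / w ^ 3 := ⟨_, rfl⟩
  rw [neg_div, ← htdef] at hθh
  have ht0 : 0 ≤ t := by rw [htdef]; positivity
  have ht1 : t < 1 := by
    rw [hhu, hcw] at h1
    have h1' : (u * c₁) ^ 2 < (w ^ 3 * q⁻¹) ^ 2 := by linarith
    have h1'' := lt_of_pow_lt_pow_left₀ 2 (by positivity) h1'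
    rw [htdef, div_lt_one (by positivity)]
    rw [← div_eq_mul_inv, lt_div_iff₀ hcot] at h1''
    linarith
  obtain ⟨x1, x2, x3⟩ := trig_data t θh ht0 ht1 hθh
  rw [Real.cos_two_mul] at h2
  obtain ⟨x, hxdef⟩ : ∃ x, x = 2 * Real.cos θh := ⟨_, rfl⟩
  rw [← hxdef] at x1 x2 x3
  rw [show Real.cos θh = x / 2 by linarith] at h2
  have hd : 6 * x ^ 2 - 3 * x ^ 4 < E * h / c₂ ^ 2 := by
    rw [lt_div_iff₀ (by positivity)]
    linarith
  have l0 := hpos 0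
  have l1 := hpos 1
  have l2 := hpos 2
  have l3 := hpos 3
  have hfc : ContDiffAt ℝ 2 f l := by
    rw [hf]
    refine ContDiffAt.div ?_ ?_ (by positivity)
    · fun_prop
    · fun_prop
  have hP : 0 < l 0 * l 1 * l 2 * l 3 := by positivity
  have hN : c₂ * (l 0 * l 1 + l 0 * l 2 + l 0 * l 3 + l 1 * l 2 + l 1 * l 3 + l 2 * l 3)
        - 2 * c₁ * q * (l 0 + l 1 + l 2 + l 3) + E = h * (l 0 * l 1 * l 2 * l 3) := by
    rw [hf] at hsol
    exact (div_eq_iff hP.ne').mp hsol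
  obtain ⟨g1, g2⟩ := hess_line f l V hfc
    (c₂ * (l 0 * l 1 + l 0 * l 2 + l 0 * l 3 + l 1 * l 2 + l 1 * l 3 + l 2 * l 3)
        - 2 * c₁ * q * (l 0 + l 1 + l 2 + l 3) + E)
    (c₂ * (V 0 * (l 1 + l 2 + l 3) + V 1 * (l 0 + l 2 + l 3) + V 2 * (l 0 + l 1 + l 3)
        + V 3 * (l 0 + l 1 + l 2)) - 2 * c₁ * q * (V 0 + V 1 + V 2 + V 3))
    (c₂ * (V 0 * V 1 + V 0 * V 2 + V 0 * V 3 + V 1 * V 2 + V 1 * V 3 + V 2 * V 3))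
    (l 0 * l 1 * l 2 * l 3)
    (V 0 * (l 1 * l 2 * l 3) + V 1 * (l 0 * l 2 * l 3) + V 2 * (l 0 * l 1 * l 3)
      + V 3 * (l 0 * l 1 * l 2))
    (V 0 * V 1 * (l 2 * l 3) + V 0 * V 2 * (l 1 * l 3) + V 0 * V 3 * (l 1 * l 2)
      + V 1 * V 2 * (l 0 * l 3) + V 1 * V 3 * (l 0 * l 2) + V 2 * V 3 * (l 0 * l 1))
    (V 0 * V 1 * V 2 * l 3 + V 0 * V 1 * V 3 * l 2 + V 0 * V 2 * V 3 * l 1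
      + V 1 * V 2 * V 3 * l 0)
    (V 0 * V 1 * V 2 * V 3) h hP hN
    (by
      intro ε
      rw [hf]
      simp only [Pi.add_apply, Pi.smul_apply, smul_eq_mul]
      congr 1 <;> ring) hV
  have key := core_scaled (x ^ 2 - 1) x t (E * h / c₂ ^ 2) (w / u) (c₂ / h) (2 * c₁ * q / h)
    (E / h) (l 0) (l 1) (l 2) (l 3) (V 0) (V 1) (V 2) (V 3) (by nlinarith) (by linarith) x1
    (by ring) (by linarith) ht0 ht1 hd (by positivity)
    (by rw [hhu, hcw]; field_simp) (by rw [htdef, hhu]; field_simp)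
    (by rw [hhu, hcw]; field_simp) l0 l1 (hpair 0 1 (by decide))
    (htriple 0 1 2 (by decide) (by decide) (by decide))
    (htriple 0 1 3 (by decide) (by decide) (by decide))
    (by
      refine mul_left_cancel₀ hh.ne' ?_
      field_simp
      linarith)
    (by
      refine mul_left_cancel₀ hh.ne' ?_
      field_simp
      linarith)
  rw [g2]
  refine div_nonneg ?_ hP.le
  have key2 := mul_le_mul_of_nonneg_left key hh.le
  have hch : h * (c₂ / h) = c₂ := by field_simp
  have e1 : c₂ * (V 0 * V 1 + V 0 * V 2 + V 0 * V 3 + V 1 * V 2 + V 1 * V 3 + V 2 * V 3)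
    = h * (c₂ / h) * (V 0 * V 1 + V 0 * V 2 + V 0 * V 3 + V 1 * V 2 + V 1 * V 3 + V 2 * V 3) := by
    rw [hch]
  rw [e1]
  linarith
end

section
/- Let θ̂ ∈ (π/2, 5π/6) and let Ω₀, Ω₂, Ω₃ be real numbers with Ω₀ > 0, Ω₂ > 0, Ω₃ > 0, satisfying the topological constraint cos²(θ̂)·Ω₀ − 3Ω₂ − 2·tan(θ̂)·Ω₃ = 0 and the condition: for every t ∈ [0, 1), Ω₃ < −3·(1 − t^{2/3}·(sin θ̂)^{2/3})·cot(θ̂)·Ω₂/(2(1−t)). Define c₁(t) := (cos²(θ̂)·Ω₀ − 2t·tan(θ̂)·Ω₃)/(3Ω₂) and c₀(t) := t. Then: (i) for every t ∈ [0, 1], cos²(θ̂)·Ω₀ − 3c₁(t)·Ω₂ − 2c₀(t)·tan(θ̂)·Ω₃ = 0; (ii) c₁(1) = 1, c₀(1) = 1, c₁(0) > 0 and c₀(0) = 0; (iii) for every t ∈ [0, 1], c₁(t)^{3/2} > c₀(t)·sin(θ̂); and (iv) c₁ is strictly increasing, with derivative c₁'(t) = −2·tan(θ̂)·Ω₃/(3Ω₂)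 > 0. -/
/-- If `(Ω₂, Ω₃) ∈ Ω^{3,θ̂}` and the topological constraint holds,
then the pair `c₁(t) = (cos²(θ̂)Ω₀ − 2t tan(θ̂)Ω₃)/(3Ω₂)`, `c₀(t) = t` satisfies all
four constraints of the 3-dimensional continuity path: topological, boundary,
Positivstellensatz, and Υ-cone. -/
theorem stmt_15 (θ : ℝ) (hθ : θ ∈ Set.Ioo (Real.pi / 2) (5 * Real.pi / 6))
    (Ω₀ Ω₂ Ω₃ : ℝ) (h0 : 0 < Ω₀) (h2 : 0 < Ω₂) (h3 : 0 < Ω₃)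
    (htop : Real.cos θ ^ 2 * Ω₀ - 3 * Ω₂ - 2 * Real.tan θ * Ω₃ = 0)
    (hcond : ∀ t ∈ Set.Ico (0 : ℝ) 1,
      Ω₃ < -3 * (1 - t ^ ((2 : ℝ) / 3) * Real.sin θ ^ ((2 : ℝ) / 3))
        * (Real.cos θ / Real.sin θ) * Ω₂ / (2 * (1 - t)))
    (c₁ c₀ : ℝ → ℝ)
    (hc₁ : c₁ = fun t => (Real.cos θ ^ 2 * Ω₀ - 2 * t * Real.tan θ * Ω₃) / (3 * Ω₂))
    (hc₀ : c₀ = fun t => t) :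
    (∀ t ∈ Set.Icc (0 : ℝ) 1,
      Real.cos θ ^ 2 * Ω₀ - 3 * c₁ t * Ω₂ - 2 * c₀ t * Real.tan θ * Ω₃ = 0) ∧
    (c₁ 1 = 1 ∧ c₀ 1 = 1 ∧ 0 < c₁ 0 ∧ c₀ 0 = 0) ∧
    (∀ t ∈ Set.Icc (0 : ℝ) 1, c₀ t * Real.sin θ < c₁ t ^ ((3 : ℝ) / 2)) ∧
    (StrictMono c₁ ∧
      (∀ t : ℝ, HasDerivAt c₁ (-2 * Real.tan θ * Ω₃ / (3 * Ω₂)) t) ∧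
      0 < -2 * Real.tan θ * Ω₃ / (3 * Ω₂)) := by
  obtain ⟨ha, hb⟩ := hθ
  have hpi := Real.pi_pos
  have hs : 0 < Real.sin θ := Real.sin_pos_of_pos_of_lt_pi (by linarith) (by linarith)
  have hc : Real.cos θ < 0 := Real.cos_neg_of_pi_div_two_lt_of_lt ha (by linarith)
  have hs1 : Real.sin θ < 1 := by
    nlinarith [Real.sin_sq_add_cos_sq θ, mul_pos_of_neg_of_neg hc hc]
  have hk : Real.tan θ < 0 := by
    rw [Real.tan_eq_sin_div_cos]; exact div_neg_of_pos_of_neg hs hc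
  have hcot : Real.cos θ / Real.sin θ = (Real.tan θ)⁻¹ := by
    rw [Real.tan_eq_sin_div_cos, inv_div]
  rw [hcot] at hcond
  have hd : 0 < -2 * Real.tan θ * Ω₃ / (3 * Ω₂) :=
    div_pos (mul_pos (by linarith) h3) (by linarith)
  have hder : ∀ t : ℝ, HasDerivAt c₁ (-2 * Real.tan θ * Ω₃ / (3 * Ω₂)) t := by
    intro t
    have e : c₁ = fun t => Real.cos θ ^ 2 * Ω₀ / (3 * Ω₂)
        + (-2 * Real.tan θ * Ω₃ / (3 * Ω₂)) * t := by
      rw [hc₁]; funext x; ring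
    rw [e]
    simpa using ((hasDerivAt_id t).const_mul (-2 * Real.tan θ * Ω₃ / (3 * Ω₂))).const_add
      (Real.cos θ ^ 2 * Ω₀ / (3 * Ω₂))
  have hone : c₁ 1 = 1 := by
    rw [hc₁]; simp only
    rw [div_eq_one_iff_eq (by positivity)]; linarith
  refine ⟨?_, ⟨hone, by rw [hc₀], ?_, by rw [hc₀]⟩, ?_, ?_, hder, hd⟩
  · intro t _
    rw [hc₁, hc₀]; field_simp; ring
  · rw [hc₁]; simp only
    have : 0 < Real.cos θ ^ 2 * Ω₀ := mul_pos (by nlinarith) h0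
    apply div_pos <;> linarith
  · intro t ht
    have hc0 : c₀ t = t := by rw [hc₀]
    rw [hc0]
    rcases eq_or_lt_of_le ht.2 with h | h
    · subst h; rw [hone]; simpa using hs1
    · have hh := hcond t ⟨ht.1, h⟩
      rw [← Real.mul_rpow ht.1 hs.le, lt_div_iff₀ (by linarith)] at hh
      have hts : 0 ≤ t * Real.sin θ := mul_nonneg ht.1 hs.le
      set u := (t * Real.sin θ) ^ ((2 : ℝ) / 3) with hu
      have hu0 : 0 ≤ u := Real.rpow_nonneg hts _
      have h1 := mul_lt_mul_of_neg_left hh hk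
      have h2' : Real.tan θ * (-3 * (1 - u) * (Real.tan θ)⁻¹ * Ω₂) = -3 * (1 - u) * Ω₂ := by
        have hk0 : Real.tan θ ≠ 0 := hk.ne
        field_simp
      rw [h2'] at h1
      have hlt : u < c₁ t := by
        rw [hc₁]; simp only
        rw [lt_div_iff₀ (by linarith)]
        linarith
      have h4 : u ^ ((3 : ℝ) / 2) = t * Real.sin θ := by
        rw [hu, ← Real.rpow_mul hts]; norm_num
      rw [← h4]
      exact Real.rpow_lt_rpow hu0 hlt (by norm_num)
  · apply strictMono_of_deriv_pos
    intro t
    rw [(hder t).deriv]; exact hd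
end

section
/- Let θ̂ ∈ (π/2, 5π/6) and let Ω₀, Ω₂, Ω₃ be real numbers with Ω₂ > 0, satisfying cos²(θ̂)·Ω₀ − 3Ω₂ − 2·tan(θ̂)·Ω₃ = 0 and Ω₀ > sec²(θ̂)·Ω₂. Then for every t ∈ [0, 1), Ω₃ < −3·(1 − t^{2/3}·(sin θ̂)^{2/3})·cot(θ̂)·Ω₂/(2(1−t)). -/
/-- For `θ̂ ∈ (π/2, 5π/6)`, if the topological constraint
`cos²(θ̂)Ω₀ − 3Ω₂ − 2 tan(θ̂)Ω₃ = 0` holds and `Ω₀ > sec²(θ̂)·Ω₂`, then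
`(Ω₂, Ω₃)` belongs to the set `Ω^{3,θ̂}`. -/
theorem stmt_16 (θ : ℝ) (hθ : θ ∈ Set.Ioo (Real.pi / 2) (5 * Real.pi / 6))
    (Ω₀ Ω₂ Ω₃ : ℝ) (h2 : 0 < Ω₂)
    (htop : Real.cos θ ^ 2 * Ω₀ - 3 * Ω₂ - 2 * Real.tan θ * Ω₃ = 0)
    (hsub : Ω₂ / Real.cos θ ^ 2 < Ω₀) :
    ∀ t ∈ Set.Ico (0 : ℝ) 1,
      Ω₃ < -3 * (1 - t ^ ((2 : ℝ) / 3) * Real.sin θ ^ ((2 : ℝ) / 3))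
        * (Real.cos θ / Real.sin θ) * Ω₂ / (2 * (1 - t)) := by
  obtain ⟨hθ1, hθ2⟩ := hθ
  have hpi := Real.pi_pos
  have hs : 0 < Real.sin θ := Real.sin_pos_of_pos_of_lt_pi (by linarith) (by linarith)
  have hc : Real.cos θ < 0 := Real.cos_neg_of_pi_div_two_lt_of_lt hθ1 (by linarith)
  intro t ht
  obtain ⟨ht0, ht1⟩ := ht
  have hc2 : 0 < Real.cos θ ^ 2 := by nlinarith
  rw [div_lt_iff₀ hc2] at hsub
  have h1 : -Ω₂ < Real.tan θ * Ω₃ := by nlinarith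
  have h3 : Ω₃ < -(Real.cos θ / Real.sin θ) * Ω₂ := by
    have hcot : Real.cos θ / Real.sin θ < 0 := div_neg_of_neg_of_pos hc hs
    have h4 := mul_lt_mul_of_neg_left h1 hcot
    have h5 : Real.cos θ / Real.sin θ * (Real.tan θ * Ω₃) = Ω₃ := by
      rw [Real.tan_eq_sin_div_cos]
      have := hc.ne
      have := hs.ne'
      field_simp
    rw [h5] at h4
    linarith
  refine lt_of_lt_of_le h3 ?_
  have hS : Real.sin θ ^ ((2 : ℝ) / 3) ≤ 1 :=
    Real.rpow_le_one hs.le (Real.sin_le_one θ) (by norm_num)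
  have hT : 3 * t ^ ((2 : ℝ) / 3) ≤ 1 + 2 * t := by
    have hu : 0 ≤ t ^ ((1 : ℝ) / 3) := Real.rpow_nonneg ht0 _
    have e2 : t ^ ((2 : ℝ) / 3) = (t ^ ((1 : ℝ) / 3)) ^ 2 := by
      rw [← Real.rpow_mul_natCast ht0]; norm_num
    have e3 : t = (t ^ ((1 : ℝ) / 3)) ^ 3 := by
      rw [← Real.rpow_mul_natCast ht0]; norm_num
    rw [e2]
    generalize t ^ ((1 : ℝ) / 3) = u at *
    rw [e3]
    nlinarith [mul_nonneg (sq_nonneg (u - 1)) (by linarith : 0 ≤ 2 * u + 1)]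
  have hTS : t ^ ((2 : ℝ) / 3) * Real.sin θ ^ ((2 : ℝ) / 3) ≤ t ^ ((2 : ℝ) / 3) :=
    mul_le_of_le_one_right (Real.rpow_nonneg ht0 _) hS
  have hk : 0 < -(Real.cos θ / Real.sin θ) * Ω₂ :=
    mul_pos (neg_pos.mpr (div_neg_of_neg_of_pos hc hs)) h2
  rw [le_div_iff₀ (by linarith)]
  have key : 2 * (1 - t) ≤ 3 * (1 - t ^ ((2 : ℝ) / 3) * Real.sin θ ^ ((2 : ℝ) / 3)) := by
    linarith
  have := mul_le_mul_of_nonneg_left key hk.le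
  linarith
end
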